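/- There is a total computable function F : ℕ → ℕ such that for every n, F(n) is the code of a finite presentation Q_n with the property that TorOrd of the presented group of Q_n equals {p_j | j ∉ W_n}, where p_j denotes the j-th prime (p_0 = 2). In particular, taking n' with W_{n'} non-recursive, TorOrd of the presented group of Q_{n'} is not recursively enumerable. -/

import Mathlib

/-- A word in `m` generators. -/
abbrev Word (m : ℕ) : Type := List (Fin m × Bool)

/-- A finite presentation: a number of generators together with a finite list of relator words. -/
abbrev FinPres : Type := Σ m : ℕ, List (Word m)

/-- The set of relators of a finite presentation, as elements of the free group. -/
def FinPres.rels (P : FinPres) : Set (FreeGroup (Fin P.1)) :=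
  {x | ∃ r ∈ P.2, x = FreeGroup.mk r}

/-- The group presented by a finite presentation. -/
abbrev FinPres.Grp (P : FinPres) : Type := PresentedGroup P.rels

/-- The projection from the free group onto the presented group. -/
def FinPres.proj (P : FinPres) : FreeGroup (Fin P.1) →* P.Grp :=
  PresentedGroup.mk P.rels

/-- The `n`-th recursively enumerable set: the domain of the `n`-th partial recursive
function under the canonical numbering. -/
def W (n : ℕ) : Set ℕ := {x | ((Denumerable.ofNat Nat.Partrec.Code n).eval x).Dom}

/-- The set of orders of nontrivial torsion elements of a group. -/
def TorOrd (G : Type*) [Group G] : Set ℕ := {n | 2 ≤ n ∧ ∃ g : G, orderOf g = n}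

/-- The data of one stable letter: two embeddings of a group `S`, to be conjugated into one
another. -/
structure StableLetter (G : Type) [Group G] where
  /-- the associated subgroup, as an abstract group -/
  S : Type
  [grp : Group S]
  /-- the first embedding -/
  α : S →* G
  /-- the second embedding -/
  β : S →* G
  α_inj : Function.Injective α
  β_inj : Function.Injective β

attribute [instance] StableLetter.grp

namespace StableLetter

variable {G : Type} [Group G] (ℓ : StableLetter G)

/-- The isomorphism between the associated subgroups. -/
noncomputable def iso : ℓ.α.range ≃* ℓ.β.range :=
  (MonoidHom.ofInjective ℓ.α_inj).symm.trans (MonoidHom.ofInjective ℓ.β_inj)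

theorem iso_apply (s : ℓ.S) : (ℓ.iso ⟨ℓ.α s, s, rfl⟩ : G) = ℓ.β s := by
  have : (⟨ℓ.α s, s, rfl⟩ : ℓ.α.range) = MonoidHom.ofInjective ℓ.α_inj s := rfl
  rw [this, iso, MulEquiv.trans_apply, MulEquiv.symm_apply_apply]
  rfl

/-- A subgroup is compatible with a stable letter if it meets the associated subgroups in
corresponding subgroups. -/
def Compatible (L : Subgroup G) : Prop := ∀ s, ℓ.α s ∈ L ↔ ℓ.β s ∈ L

/-- The HNN extension given by a stable letter. -/
abbrev HNN : Type := HNNExtension G ℓ.α.range ℓ.β.range ℓ.iso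

theorem t_mul_of (s : ℓ.S) :
    (HNNExtension.t : ℓ.HNN) * HNNExtension.of (ℓ.α s) =
      HNNExtension.of (ℓ.β s) * HNNExtension.t := by
  have := HNNExtension.t_mul_of (φ := ℓ.iso) ⟨ℓ.α s, s, rfl⟩
  rwa [iso_apply] at this

/-- The universal property of the HNN extension. -/
noncomputable def lift {E : Type*} [Group E] (f : G →* E) (x : E)
    (h : ∀ s, x * f (ℓ.α s) = f (ℓ.β s) * x) : ℓ.HNN →* E :=
  HNNExtension.lift f x (by
    rintro ⟨_, s, rfl⟩
    rw [iso_apply]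
    exact h s)

/-- The restriction of a stable letter to a compatible subgroup. -/
def restrict {L : Subgroup G} (hL : ℓ.Compatible L) : StableLetter L where
  S := L.comap ℓ.α
  α := (ℓ.α.comp (L.comap ℓ.α).subtype).codRestrict L fun s => s.2
  β := (ℓ.β.comp (L.comap ℓ.α).subtype).codRestrict L fun s => (hL s).1 s.2
  α_inj _ _ h := Subtype.ext (ℓ.α_inj (congrArg Subtype.val h))
  β_inj _ _ h := Subtype.ext (ℓ.β_inj (congrArg Subtype.val h))

theorem mem_toSubgroup_restrict {L : Subgroup G} (hL : ℓ.Compatible L) (u : ℤˣ) (g : L) :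
    g ∈ HNNExtension.toSubgroup (ℓ.restrict hL).α.range (ℓ.restrict hL).β.range u ↔
      (g : G) ∈ HNNExtension.toSubgroup ℓ.α.range ℓ.β.range u := by
  rcases Int.units_eq_one_or u with rfl | rfl
  · constructor
    · rintro ⟨s, rfl⟩
      exact ⟨s.1, rfl⟩
    · rintro ⟨s, hs⟩
      exact ⟨⟨s, by change ℓ.α s ∈ L; rw [hs]; exact g.2⟩, Subtype.ext hs⟩
  · constructor
    · rintro ⟨s, rfl⟩
      exact ⟨s.1, rfl⟩
    · rintro ⟨s, hs⟩
      exact ⟨⟨s, by change ℓ.α s ∈ L; rw [hL, hs]; exact g.2⟩, Subtype.ext hs⟩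

theorem lift_of {E : Type*} [Group E] (f : G →* E) (x : E)
    (h : ∀ s, x * f (ℓ.α s) = f (ℓ.β s) * x) (g : G) :
    ℓ.lift f x h (HNNExtension.of g) = f g := by
  simp [lift]

theorem lift_t {E : Type*} [Group E] (f : G →* E) (x : E)
    (h : ∀ s, x * f (ℓ.α s) = f (ℓ.β s) * x) :
    ℓ.lift f x h HNNExtension.t = x := by
  simp [lift]

/-- The map from the HNN extension of a compatible subgroup. -/
noncomputable def restrictMap {L : Subgroup G} (hL : ℓ.Compatible L) :
    (ℓ.restrict hL).HNN →* ℓ.HNN :=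
  (ℓ.restrict hL).lift (HNNExtension.of.comp L.subtype) HNNExtension.t
    fun s => ℓ.t_mul_of s.1

theorem restrictMap_of {L : Subgroup G} (hL : ℓ.Compatible L) (g : L) :
    ℓ.restrictMap hL (HNNExtension.of g) = HNNExtension.of (g : G) :=
  lift_of ..

theorem restrictMap_t {L : Subgroup G} (hL : ℓ.Compatible L) :
    ℓ.restrictMap hL HNNExtension.t = HNNExtension.t :=
  lift_t ..

theorem exists_reducedWord {G : Type*} [Group G] {A B : Subgroup G} (φ : A ≃* B)
    (x : HNNExtension G A B φ) :
    ∃ w : HNNExtension.NormalWord.ReducedWord G A B, w.prod φ = x := by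
  obtain ⟨d⟩ := HNNExtension.NormalWord.TransversalPair.nonempty G A B
  exact ⟨((HNNExtension.NormalWord.equiv φ d) x).toReducedWord,
    (HNNExtension.NormalWord.equiv φ d).symm_apply_apply x⟩

theorem exists_of_restrictMap_eq {L : Subgroup G} (hL : ℓ.Compatible L)
    (x : (ℓ.restrict hL).HNN) (g : G) (h : ℓ.restrictMap hL x = HNNExtension.of g) :
    ∃ hg : g ∈ L, x = HNNExtension.of (⟨g, hg⟩ : L) := by
  obtain ⟨⟨a, l, hl⟩, rfl⟩ := exists_reducedWord _ x
  let w' : HNNExtension.NormalWord.ReducedWord G ℓ.α.range ℓ.β.range :=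
    ⟨a, l.map fun p => (p.1, (p.2 : G)), by
      rw [List.isChain_map]
      refine hl.imp fun p q hpq hp => hpq ?_
      rwa [mem_toSubgroup_restrict]⟩
  have hw : w'.prod ℓ.iso = HNNExtension.of g := by
    rw [← h]
    simp only [HNNExtension.NormalWord.ReducedWord.prod, map_mul, map_list_prod, List.map_map, w',
      restrictMap_of, Function.comp_def, map_zpow, restrictMap_t]
  have h1 := HNNExtension.ReducedWord.toList_eq_nil_of_mem_of_range ℓ.iso w' ⟨g, hw.symm⟩
  have h2 : l = [] := by simpa [w'] using h1
  subst h2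
  have h3 : (a : G) = g := by
    apply HNNExtension.of_injective (φ := ℓ.iso)
    rw [← hw]
    simp [HNNExtension.NormalWord.ReducedWord.prod, w']
  subst h3
  exact ⟨a.2, by simp [HNNExtension.NormalWord.ReducedWord.prod]⟩

theorem restrictMap_injective {L : Subgroup G} (hL : ℓ.Compatible L) :
    Function.Injective (ℓ.restrictMap hL) := by
  rw [injective_iff_map_eq_one]
  intro x hx
  obtain ⟨_, rfl⟩ := ℓ.exists_of_restrictMap_eq hL x 1 (by rw [hx, map_one])
  exact map_one _

theorem closure_le_range_restrictMap {L : Subgroup G} (hL : ℓ.Compatible L) :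
    Subgroup.closure ((HNNExtension.of : G →* ℓ.HNN) '' L ∪ {HNNExtension.t}) ≤
      (ℓ.restrictMap hL).range := by
  rw [Subgroup.closure_le]
  rintro _ (⟨g, hg, rfl⟩ | rfl)
  · exact ⟨_, ℓ.restrictMap_of hL ⟨g, hg⟩⟩
  · exact ⟨_, ℓ.restrictMap_t hL⟩

end StableLetter

namespace HNNExtension

variable {G : Type*} [Group G] {A B : Subgroup G} (φ : A ≃* B)

/-- The product of a list of syllables. -/
noncomputable def syllProd (l : List (ℤˣ × G)) : HNNExtension G A B φ :=
  (l.map fun x => t ^ (x.1 : ℤ) * of x.2).prod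

theorem syllProd_append (l m : List (ℤˣ × G)) :
    syllProd φ (l ++ m) = syllProd φ l * syllProd φ m := by
  simp [syllProd]

theorem syllProd_flatten_replicate (l : List (ℤˣ × G)) (n : ℕ) :
    syllProd φ (List.replicate n l).flatten = syllProd φ l ^ n := by
  induction n with
  | zero => simp [syllProd]
  | succ n ih => rw [List.replicate_succ, List.flatten_cons, syllProd_append, ih, pow_succ']

variable (A B) in
/-- The relation between consecutive syllables of a reduced word. -/
def SyllRel (a b : ℤˣ × G) : Prop := a.2 ∈ toSubgroup A B a.1 → a.1 = b.1

theorem isChain_flatten_replicate {α : Type*} {r : α → α → Prop} {l : List α}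
    (hl : l.IsChain r) (h : ∀ a ∈ l.getLast?, ∀ b ∈ l.head?, r a b) (n : ℕ) :
    (List.replicate n l).flatten.IsChain r := by
  induction n with
  | zero => simp
  | succ n ih =>
    rw [List.replicate_succ, List.flatten_cons, List.isChain_append]
    refine ⟨hl, ih, fun a ha b hb => h a ha b ?_⟩
    cases n with
    | zero => simp at hb
    | succ n =>
      rw [List.replicate_succ, List.flatten_cons] at hb
      cases l with
      | nil => simp at ha
      | cons c l => simpa using hb

theorem syllProd_ne_one {l : List (ℤˣ × G)} (hl : l.IsChain (SyllRel A B)) (hne : l ≠ []) :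
    syllProd φ l ≠ 1 := by
  intro h
  refine hne (ReducedWord.toList_eq_nil_of_mem_of_range φ ⟨1, l, hl⟩ ⟨1, ?_⟩)
  rw [map_one, ← h]
  simp [NormalWord.ReducedWord.prod, syllProd]

theorem t_zpow_mul_of (u : ℤˣ) (a : toSubgroup A B u) :
    (t ^ (u : ℤ) * of (a : G) : HNNExtension G A B φ) =
      of (toSubgroupEquiv φ u a : G) * t ^ (u : ℤ) := by
  rcases Int.units_eq_one_or u with rfl | rfl
  · rw [Units.val_one, zpow_one]
    exact t_mul_of a
  · rw [Units.val_neg, Units.val_one, zpow_neg_one]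
    exact inv_t_mul_of a

theorem exists_conj_of_isOfFinOrder (x : HNNExtension G A B φ) (hx : IsOfFinOrder x) :
    ∃ (g : G), IsConj x (of g) := by
  have key : ∀ n (x : HNNExtension G A B φ) (w : NormalWord.ReducedWord G A B),
      w.toList.length = n → w.prod φ = x → IsOfFinOrder x → ∃ g, IsConj x (of g) := by
    intro n
    induction n using Nat.strong_induction_on with
    | _ n ih =>
    rintro x ⟨a, l, hl⟩ hn rfl hx
    rcases List.eq_nil_or_concat' l with rfl | ⟨m, ⟨u, b⟩, rfl⟩
    · refine ⟨a, ?_⟩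
      have h1 : NormalWord.ReducedWord.prod φ ⟨a, [], hl⟩ = of a := by
        simp [NormalWord.ReducedWord.prod]
      rw [h1]
    -- move the head to the end
    have hconj : IsConj (NormalWord.ReducedWord.prod φ ⟨a, m ++ [(u, b)], hl⟩)
        (syllProd φ (m ++ [(u, b * a)])) := by
      rw [isConj_iff]
      refine ⟨(of a)⁻¹, ?_⟩
      simp [NormalWord.ReducedWord.prod, syllProd, mul_assoc]
    set y := syllProd φ (m ++ [(u, b * a)]) with hy
    have hyf : IsOfFinOrder y := by
      obtain ⟨c, hc⟩ := isConj_iff.1 hconj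
      rw [← hc]
      exact (MulAut.conj c).toMonoidHom.isOfFinOrder hx
    have hchain : (m ++ [(u, b * a)]).IsChain (SyllRel A B) := by
      rw [List.isChain_append] at hl ⊢
      refine ⟨hl.1, by simp, fun p hp q hq => ?_⟩
      have h1 := hl.2.2 p hp (u, b) (by simp)
      simp only [List.head?_cons, Option.mem_def, Option.some.injEq] at hq
      subst hq
      exact h1
    by_cases hc : ∀ p ∈ (m ++ [(u, b * a)]).getLast?, ∀ q ∈ (m ++ [(u, b * a)]).head?,
        SyllRel A B p q
    · exfalso
      obtain ⟨k, hk, hk1⟩ := isOfFinOrder_iff_pow_eq_one.1 hyf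
      rw [hy, ← syllProd_flatten_replicate] at hk1
      refine syllProd_ne_one φ (isChain_flatten_replicate hchain hc k) ?_ hk1
      simp [hk.ne']
    · push Not at hc
      obtain ⟨p, hp, q, hq, hpq⟩ := hc
      simp only [List.getLast?_append, List.getLast?_singleton, Option.some_or, Option.mem_def,
        Option.some.injEq] at hp
      subst hp
      cases m with
      | nil =>
        simp only [List.nil_append, List.head?_cons, Option.mem_def, Option.some.injEq] at hq
        subst hq
        exact absurd (fun _ => rfl) hpq
      | cons q' m =>
        simp only [List.cons_append, List.head?_cons, Option.mem_def, Option.some.injEq] at hq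
        subst hq
        obtain ⟨v, c⟩ := q'
        rw [SyllRel] at hpq
        push Not at hpq
        obtain ⟨hmem, huv⟩ := hpq
        simp only at hmem huv
        have hv : v = -u := by
          rcases Int.units_eq_one_or u with rfl | rfl <;>
            rcases Int.units_eq_one_or v with rfl | rfl <;> simp_all
        subst hv
        have hm : m.IsChain (SyllRel A B) := by
          rw [List.cons_append, List.isChain_cons, List.isChain_append] at hchain
          exact hchain.2.1
        have hconj2 : IsConj y (NormalWord.ReducedWord.prod φ
            ⟨(toSubgroupEquiv φ u ⟨b * a, hmem⟩ : G) * c, m, hm⟩) := by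
          rw [isConj_iff]
          refine ⟨t ^ (u : ℤ) * of (b * a), ?_⟩
          have h1 : syllProd φ [(u, b * a)] = t ^ (u : ℤ) * of (b * a) := by simp [syllProd]
          have h2 := t_zpow_mul_of φ u ⟨b * a, hmem⟩
          have h3 : syllProd φ ((-u, c) :: m) = t ^ (-(u : ℤ)) * of c * syllProd φ m := by
            simp [syllProd]
          change _ = of _ * syllProd φ m
          rw [hy, syllProd_append, h1, mul_assoc, mul_assoc (syllProd φ _), mul_inv_cancel,
            mul_one, h2, h3, map_mul]
          simp [mul_assoc]
        obtain ⟨g, hg⟩ := ih m.length (by rw [← hn]; simp) _ _ rfl rfl (by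
          obtain ⟨c, hc⟩ := isConj_iff.1 hconj2
          rw [← hc]
          exact (MulAut.conj c).toMonoidHom.isOfFinOrder hyf)
        exact ⟨g, hconj.trans (hconj2.trans hg)⟩
  obtain ⟨w, hw⟩ := StableLetter.exists_reducedWord φ x
  exact key _ x w rfl hw hx

end HNNExtension

/-- An iterated HNN extension of `G` by a family of stable letters, with the properties
following from Britton's lemma. -/
structure LetterTower {G : Type} [Group G] {I : Type} (ℓ : I → StableLetter G) where
  /-- the iterated HNN extension -/
  H : Type
  [grp : Group H]
  /-- the embedding of the base -/
  ι : G →* H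
  /-- the stable letters -/
  ρ : I → H
  ι_inj : Function.Injective ι
  rel : ∀ i s, ρ i * ι ((ℓ i).α s) = ι ((ℓ i).β s) * ρ i
  gen : Subgroup.closure (Set.range ι ∪ Set.range ρ) = ⊤
  conj : ∀ h : H, IsOfFinOrder h → ∃ g, IsConj h (ι g)
  mem_of : ∀ L : Subgroup G, (∀ i, (ℓ i).Compatible L) →
    ∀ g, ι g ∈ Subgroup.closure (ι '' L ∪ Set.range ρ) → g ∈ L
  extend : ∀ L : Subgroup G, (∀ i, (ℓ i).Compatible L) →
    ∀ {E : Type} [Group E] (π : L →* E) (e : I → E),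
    (∀ i s (hα : (ℓ i).α s ∈ L) (hβ : (ℓ i).β s ∈ L), e i * π ⟨_, hα⟩ = π ⟨_, hβ⟩ * e i) →
    ∃ Θ : Subgroup.closure (ι '' L ∪ Set.range ρ) →* E,
      (∀ (x : Subgroup.closure (ι '' L ∪ Set.range ρ)) (g : L), (x : H) = ι g → Θ x = π g) ∧
        ∀ (x : Subgroup.closure (ι '' L ∪ Set.range ρ)) i, (x : H) = ρ i → Θ x = e i

attribute [instance] LetterTower.grp

namespace StableLetter

variable {G : Type} [Group G] (ℓ : StableLetter G)

theorem hnn_mem_of (L : Subgroup G) (hL : ℓ.Compatible L) (g : G)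
    (h : (HNNExtension.of g : ℓ.HNN) ∈
      Subgroup.closure ((HNNExtension.of : G →* ℓ.HNN) '' L ∪ {HNNExtension.t})) : g ∈ L := by
  obtain ⟨x, hx⟩ := ℓ.closure_le_range_restrictMap hL h
  exact (ℓ.exists_of_restrictMap_eq hL x g hx).1

theorem hnn_extend (L : Subgroup G) (hL : ℓ.Compatible L) {E : Type} [Group E] (π : L →* E) (e : E)
    (h : ∀ s (hα : ℓ.α s ∈ L) (hβ : ℓ.β s ∈ L), e * π ⟨_, hα⟩ = π ⟨_, hβ⟩ * e) :
    ∃ Θ : Subgroup.closure ((HNNExtension.of : G →* ℓ.HNN) '' L ∪ {HNNExtension.t}) →* E,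
      (∀ x : Subgroup.closure ((HNNExtension.of : G →* ℓ.HNN) '' L ∪ {HNNExtension.t}),
        ∀ g : L, (x : ℓ.HNN) = HNNExtension.of (g : G) → Θ x = π g) ∧
      ∀ x : Subgroup.closure ((HNNExtension.of : G →* ℓ.HNN) '' L ∪ {HNNExtension.t}),
        (x : ℓ.HNN) = HNNExtension.t → Θ x = e := by
  let j := MonoidHom.ofInjective (ℓ.restrictMap_injective hL)
  let P : (ℓ.restrict hL).HNN →* E :=
    (ℓ.restrict hL).lift π e fun s => h s.1 s.2 ((hL _).1 s.2)
  have key : ∀ (y : (ℓ.restrictMap hL).range) (x : (ℓ.restrict hL).HNN),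
      (y : ℓ.HNN) = ℓ.restrictMap hL x → j.symm y = x := by
    intro y x hyx
    rw [MulEquiv.symm_apply_eq]
    exact Subtype.ext hyx
  refine ⟨(P.comp j.symm.toMonoidHom).comp
    (Subgroup.inclusion (ℓ.closure_le_range_restrictMap hL)), fun x g hx => ?_, fun x hx => ?_⟩
  · change P (j.symm _) = _
    rw [key _ (HNNExtension.of g) (by rw [restrictMap_of]; exact hx)]
    exact lift_of ..
  · change P (j.symm _) = _
    rw [key _ HNNExtension.t (by rw [restrictMap_t]; exact hx)]
    exact lift_t ..

theorem hnn_gen : Subgroup.closure (Set.range (HNNExtension.of : G →* ℓ.HNN) ∪ {HNNExtension.t})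
    = ⊤ := by
  rw [eq_top_iff]
  rintro x -
  induction x using HNNExtension.induction_on with
  | of g => exact Subgroup.subset_closure (Or.inl ⟨g, rfl⟩)
  | t => exact Subgroup.subset_closure (Or.inr rfl)
  | mul a b ha hb => exact mul_mem ha hb
  | inv a ha => exact inv_mem ha

/-- A stable letter over `G` induces one over any overgroup. -/
def map {H : Type} [Group H] (f : G →* H) (hf : Function.Injective f) : StableLetter H where
  S := ℓ.S
  α := f.comp ℓ.α
  β := f.comp ℓ.β
  α_inj := hf.comp ℓ.α_inj
  β_inj := hf.comp ℓ.β_inj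

end StableLetter

namespace LetterTower

variable {G : Type} [Group G]

theorem closure_image_union {H K : Type} [Group H] [Group K] (f : H →* K) (X : Set H) (Y : Set K) :
    Subgroup.closure (f '' (Subgroup.closure X) ∪ Y) = Subgroup.closure (f '' X ∪ Y) := by
  rw [Subgroup.closure_union, Subgroup.closure_union, ← Subgroup.coe_map, Subgroup.closure_eq,
    MonoidHom.map_closure]

/-- Adding one more stable letter to a tower. -/
noncomputable def option {I : Type} (ℓ : Option I → StableLetter G)
    (T : LetterTower fun i => ℓ (some i)) : LetterTower ℓ :=
  let m := (ℓ none).map T.ι T.ι_inj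
  have hset : ∀ X : Set G,
      Subgroup.closure (((HNNExtension.of : T.H →* m.HNN).comp T.ι) '' X ∪
        Set.range fun i => Option.elim i HNNExtension.t fun i => HNNExtension.of (T.ρ i)) =
      Subgroup.closure ((HNNExtension.of : T.H →* m.HNN) ''
        Subgroup.closure (T.ι '' X ∪ Set.range T.ρ) ∪ {HNNExtension.t}) := fun X => by
    rw [closure_image_union, MonoidHom.coe_comp, Set.image_comp, Set.image_union, Set.union_assoc]
    congr 2
    ext x
    simp [Option.exists, eq_comm]
  have hcompat : ∀ L : Subgroup G, (∀ i, (ℓ i).Compatible L) →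
      m.Compatible (Subgroup.closure (T.ι '' L ∪ Set.range T.ρ)) := fun L hL s => by
    have h1 : ∀ g, T.ι g ∈ Subgroup.closure (T.ι '' L ∪ Set.range T.ρ) ↔ g ∈ L := fun g =>
      ⟨T.mem_of L (fun i => hL _) g, fun hg => Subgroup.subset_closure (Or.inl ⟨g, hg, rfl⟩)⟩
    exact (h1 _).trans ((hL none s).trans (h1 _).symm)
  { H := m.HNN
    ι := HNNExtension.of.comp T.ι
    ρ := fun i => i.elim HNNExtension.t fun i => HNNExtension.of (T.ρ i)
    ι_inj := (HNNExtension.of_injective (φ := m.iso)).comp T.ι_inj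
    rel := by
      rintro (_ | i) s
      · exact m.t_mul_of s
      · have := congrArg (HNNExtension.of : T.H →* m.HNN) (T.rel i s)
        simpa using this
    gen := by
      have := hset Set.univ
      rw [Set.image_univ, Set.image_univ, T.gen, Subgroup.coe_top, Set.image_univ,
        m.hnn_gen] at this
      rw [← this]
    conj := fun h hh => by
      obtain ⟨x, hx⟩ := HNNExtension.exists_conj_of_isOfFinOrder _ h hh
      obtain ⟨c, hc⟩ := isConj_iff.1 hx
      have hxf : IsOfFinOrder x := by
        rw [← (HNNExtension.of_injective (φ := m.iso)).isOfFinOrder_iff,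
          ← hc]
        exact (MulAut.conj c).toMonoidHom.isOfFinOrder hh
      obtain ⟨g, hg⟩ := T.conj x hxf
      exact ⟨g, hx.trans ((HNNExtension.of : T.H →* m.HNN).map_isConj hg)⟩
    mem_of := fun L hL g hg => by
      rw [hset] at hg
      exact T.mem_of L (fun i => hL _) g (m.hnn_mem_of _ (hcompat L hL) _ hg)
    extend := fun L hL E _ π e he => by
      obtain ⟨Θ, hΘ, hΘ'⟩ := T.extend L (fun i => hL _) π (fun i => e (some i))
        fun i => he (some i)
      obtain ⟨Φ, hΦ, hΦ'⟩ := m.hnn_extend _ (hcompat L hL) Θ (e none) fun s hα hβ => by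
        have hα' : (ℓ none).α s ∈ L := T.mem_of L (fun i => hL _) _ hα
        have hβ' : (ℓ none).β s ∈ L := T.mem_of L (fun i => hL _) _ hβ
        rw [hΘ _ ⟨_, hα'⟩ rfl, hΘ _ ⟨_, hβ'⟩ rfl]
        exact he none s hα' hβ'
      refine ⟨Φ.comp (Subgroup.inclusion (hset _).le), fun x g hx => ?_, ?_⟩
      · have hmem : T.ι g ∈ Subgroup.closure (T.ι '' L ∪ Set.range T.ρ) :=
          Subgroup.subset_closure (Or.inl ⟨g, g.2, rfl⟩)
        rw [← hΘ ⟨_, hmem⟩ g rfl]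
        exact hΦ _ ⟨_, hmem⟩ hx
      · rintro x (_ | i) hx
        · exact hΦ' _ hx
        · have hmem : T.ρ i ∈ Subgroup.closure (T.ι '' L ∪ Set.range T.ρ) :=
            Subgroup.subset_closure (Or.inr ⟨i, rfl⟩)
          rw [← hΘ' ⟨_, hmem⟩ i rfl]
          exact hΦ _ ⟨_, hmem⟩ hx }

/-- The tower with no stable letter. -/
def empty {I : Type} [IsEmpty I] (ℓ : I → StableLetter G) : LetterTower ℓ where
  H := G
  ι := MonoidHom.id G
  ρ i := isEmptyElim i
  ι_inj := Function.injective_id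
  rel := isEmptyElim
  gen := by simp
  conj h _ := ⟨h, IsConj.refl _⟩
  mem_of L _ g hg := by simpa [Set.range_eq_empty] using hg
  extend L _ E _ π e _ := by
    have h : Subgroup.closure
        (MonoidHom.id G '' L ∪ Set.range fun i : I => (isEmptyElim i : G)) ≤ L := by
      simp [Set.range_eq_empty]
    exact ⟨π.comp (Subgroup.inclusion h), fun x g hx => congrArg π (Subtype.ext hx),
      fun x => isEmptyElim⟩

/-- Reindexing a tower. -/
def reindex {I J : Type} (σ : I ≃ J) (ℓ : J → StableLetter G)
    (T : LetterTower fun i => ℓ (σ i)) : LetterTower ℓ where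
  H := T.H
  ι := T.ι
  ρ j := T.ρ (σ.symm j)
  ι_inj := T.ι_inj
  rel j s := by
    obtain ⟨i, rfl⟩ := σ.surjective j
    rw [σ.symm_apply_apply]
    exact T.rel i s
  gen := by
    have := σ.symm.surjective.range_comp T.ρ
    rw [Function.comp_def] at this
    rw [this]
    exact T.gen
  conj := T.conj
  mem_of L hL g hg := by
    have := σ.symm.surjective.range_comp T.ρ
    rw [Function.comp_def] at this
    rw [this] at hg
    exact T.mem_of L (fun i => hL _) g hg
  extend L hL E _ π e he := by
    have := σ.symm.surjective.range_comp T.ρ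
    rw [Function.comp_def] at this
    rw [this]
    obtain ⟨Θ, hΘ, hΘ'⟩ := T.extend L (fun i => hL _) π (fun i => e (σ i)) fun i => he (σ i)
    refine ⟨Θ, hΘ, fun x j hx => ?_⟩
    rw [hΘ' x _ hx, σ.apply_symm_apply]

theorem nonempty {I : Type} [Finite I] (ℓ : I → StableLetter G) : Nonempty (LetterTower ℓ) := by
  refine Finite.induction_empty_option
    (P := fun I => ∀ ℓ : I → StableLetter G, Nonempty (LetterTower ℓ)) ?_ ?_ ?_ I ℓ
  · intro I J σ h ℓ
    obtain ⟨T⟩ := h fun i => ℓ (σ i)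
    exact ⟨T.reindex σ⟩
  · intro ℓ
    exact ⟨empty ℓ⟩
  · intro I _ h ℓ
    obtain ⟨T⟩ := h fun i => ℓ (some i)
    exact ⟨option ℓ T⟩

variable {I : Type} {ℓ : I → StableLetter G} (T : LetterTower ℓ)

theorem exists_lift {E : Type} [Group E] (f : G →* E) (e : I → E)
    (h : ∀ i s, e i * f ((ℓ i).α s) = f ((ℓ i).β s) * e i) :
    ∃ F : T.H →* E, (∀ g, F (T.ι g) = f g) ∧ ∀ i, F (T.ρ i) = e i := by
  obtain ⟨Θ, h1, h2⟩ := T.extend ⊤ (fun i s => by simp) (f.comp (Subgroup.subtype _)) e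
    fun i s _ _ => h i s
  have htop : (⊤ : Subgroup T.H) ≤ Subgroup.closure (T.ι '' (⊤ : Subgroup G) ∪ Set.range T.ρ) := by
    rw [← T.gen, Subgroup.coe_top, Set.image_univ]
  refine ⟨Θ.comp ((Subgroup.inclusion htop).comp Subgroup.topEquiv.symm.toMonoidHom),
    fun g => h1 _ ⟨g, trivial⟩ rfl, fun i => h2 _ i rfl⟩

theorem torOrd_eq (k : ℕ) (hk : k ≠ 0) :
    (∃ h : T.H, orderOf h = k) ↔ ∃ g : G, orderOf g = k := by
  constructor
  · rintro ⟨h, rfl⟩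
    obtain ⟨g, hg⟩ := T.conj h (orderOf_ne_zero_iff.1 hk)
    obtain ⟨c, hc⟩ := isConj_iff.1 hg
    refine ⟨g, ?_⟩
    rw [← orderOf_injective _ T.ι_inj, ← hc]
    exact orderOf_injective (MulAut.conj c).toMonoidHom (MulAut.conj c).injective h
  · rintro ⟨g, rfl⟩
    exact ⟨T.ι g, orderOf_injective _ T.ι_inj g⟩

end LetterTower

/-- Translations of the basis of the free group on an additive group. -/
def transl (A : Type) [AddCommGroup A] : Multiplicative A →* MulAut (FreeGroup A) where
  toFun a := FreeGroup.freeGroupCongr (Equiv.addLeft a.toAdd)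
  map_one' := by
    ext x
    simp
  map_mul' a b := by
    ext x
    simp [FreeGroup.map.comp, Function.comp_def]

/-- The group generated by `A` and a family of free generators indexed by `A`, on which `A`
acts by translations. -/
abbrev AffGrp (A : Type) [AddCommGroup A] : Type := FreeGroup A ⋊[transl A] Multiplicative A

/-- A group is torsion-free if its only element of finite order is the identity. -/
def TorFree (G : Type*) [Group G] : Prop := ∀ x : G, IsOfFinOrder x → x = 1

theorem torFree_of_isMulTorsionFree (G : Type*) [Group G] [IsMulTorsionFree G] : TorFree G :=
  fun _ hx => hx.eq_one'

theorem TorFree.semidirectProduct {N G : Type*} [Group N] [Group G] {φ : G →* MulAut N}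
    (hN : TorFree N) (hG : TorFree G) : TorFree (N ⋊[φ] G) := by
  intro a hf
  have h1 : a.right = 1 := hG _ ((SemidirectProduct.rightHom (φ := φ)).isOfFinOrder hf)
  have h2 : SemidirectProduct.inl a.left = a := by
    conv_rhs => rw [← SemidirectProduct.inl_left_mul_inr_right a, h1, map_one, mul_one]
  rw [← h2, SemidirectProduct.inl_injective.isOfFinOrder_iff] at hf
  rw [← h2, hN _ hf, map_one]

namespace AffGrp

open Classical in
/-- The retraction of a free group onto the subgroup generated by part of the basis. -/
noncomputable def retr {A : Type} (P : Set A) : FreeGroup A →* FreeGroup A :=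
  FreeGroup.lift fun v => if v ∈ P then FreeGroup.of v else 1

theorem retr_eq {A : Type} {P : Set A} {w : FreeGroup A}
    (hw : w ∈ Subgroup.closure (FreeGroup.of '' P)) :
    retr P w = w := by
  refine MonoidHom.eqOn_closure (f := retr P) (g := MonoidHom.id _) ?_ hw
  rintro _ ⟨v, hv, rfl⟩
  simp [retr, hv]

theorem retr_mem {A : Type} (P : Set A) (w : FreeGroup A) :
    retr P w ∈ Subgroup.closure (FreeGroup.of '' P) := by
  have : (retr P).range ≤ Subgroup.closure (FreeGroup.of '' P) := by
    rw [MonoidHom.range_eq_map, ← FreeGroup.closure_range_of, MonoidHom.map_closure,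
      Subgroup.closure_le]
    rintro _ ⟨_, ⟨v, rfl⟩, rfl⟩
    rw [retr, FreeGroup.lift_apply_of]
    split_ifs with h
    · exact Subgroup.subset_closure ⟨v, h, rfl⟩
    · exact one_mem _
  exact this ⟨w, rfl⟩

section

variable {A B : Type} [AddCommGroup A] [AddCommGroup B]

theorem torFree [IsAddTorsionFree A] : TorFree (AffGrp A) :=
  (torFree_of_isMulTorsionFree _).semidirectProduct (torFree_of_isMulTorsionFree _)

/-- The free generator with index `v`. -/
def T (v : A) : AffGrp A := SemidirectProduct.inl (FreeGroup.of v)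

/-- The translation by `a`. -/
def X (a : A) : AffGrp A := SemidirectProduct.inr (Multiplicative.ofAdd a)

theorem X_add (a b : A) : X (a + b) = X a * X b := by simp [X]

theorem X_neg (a : A) : X (-a) = (X a)⁻¹ := by simp [X]

theorem X_comm (a b : A) : X a * X b = X b * X a := by rw [← X_add, add_comm, X_add]

theorem conj_T (a v : A) : X a * T v * (X a)⁻¹ = T (a + v) := by
  have := SemidirectProduct.inl_aut (φ := transl A) (Multiplicative.ofAdd a) (FreeGroup.of v)
  rw [map_inv] at this
  rw [X, T, ← this]
  rfl

theorem T_eq (v : A) : T v = X v * T 0 * (X v)⁻¹ := by rw [conj_T, add_zero]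

/-- The homomorphism induced by an affine map. -/
def map (b : B) (φ : A →+ B) : AffGrp A →* AffGrp B :=
  SemidirectProduct.map (FreeGroup.map fun u => b + φ u) (AddMonoidHom.toMultiplicative φ)
    fun a => by
      ext u
      simp [transl, add_left_comm]

theorem map_T (b : B) (φ : A →+ B) (v : A) : map b φ (T v) = T (b + φ v) := by
  simp [map, T]

theorem map_X (b : B) (φ : A →+ B) (v : A) : map b φ (X v) = X (φ v) := by
  simp [map, X]

theorem map_inl (b : B) (φ : A →+ B) (w : FreeGroup A) :
    map b φ (SemidirectProduct.inl w) =
      SemidirectProduct.inl (FreeGroup.map (fun u => b + φ u) w) := by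
  simp [map]

theorem map_injective (b : B) (φ : A →+ B) (h : Function.Injective φ) :
    Function.Injective (map b φ) := by
  intro x y hxy
  have h1 := congrArg SemidirectProduct.left hxy
  have h2 := congrArg SemidirectProduct.right hxy
  rw [map, SemidirectProduct.map_left, SemidirectProduct.map_left] at h1
  rw [map, SemidirectProduct.map_right, SemidirectProduct.map_right] at h2
  exact SemidirectProduct.ext (FreeGroup.map_injective ((add_right_injective b).comp h) h1) (h h2)

/-- The subgroup generated by the free generators with index in `P`. -/
def tSub (P : Set A) : Subgroup (AffGrp A) := Subgroup.closure (T '' P)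

theorem tSub_eq (P : Set A) :
    tSub P = (Subgroup.closure (FreeGroup.of '' P)).map SemidirectProduct.inl := by
  rw [MonoidHom.map_closure, tSub, ← Set.image_comp]
  rfl

theorem map_mem_tSub (b : B) (φ : A →+ B) (h : Function.Injective φ) (P : Set B) (s : AffGrp A) :
    map b φ s ∈ tSub P ↔ s ∈ tSub ((fun u => b + φ u) ⁻¹' P) := by
  constructor
  · intro hs
    rw [tSub_eq] at hs ⊢
    obtain ⟨w', hw', hs⟩ := hs
    have h1 := congrArg SemidirectProduct.right hs
    rw [map, SemidirectProduct.map_right] at h1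
    have h2 : s.right = 1 := h (h1.symm.trans (map_zero φ).symm)
    have h3 : SemidirectProduct.inl s.left = s := by
      conv_rhs => rw [← SemidirectProduct.inl_left_mul_inr_right s, h2, map_one, mul_one]
    refine ⟨s.left, ?_, h3⟩
    rw [← h3, map_inl] at hs
    have h4 := SemidirectProduct.inl_injective hs
    have h5 := retr_eq hw'
    rw [h4] at h5
    have h6 : (retr P).comp (FreeGroup.map fun u => b + φ u) =
        (FreeGroup.map fun u => b + φ u).comp (retr ((fun u => b + φ u) ⁻¹' P)) := by
      ext v
      by_cases hv : b + φ v ∈ P <;> simp [retr, hv]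
    have h7 := FreeGroup.map_injective ((add_right_injective b).comp h)
      ((DFunLike.congr_fun h6 s.left).symm.trans h5)
    rw [← h7]
    exact retr_mem _ _
  · intro hs
    have : tSub ((fun u => b + φ u) ⁻¹' P) ≤ (tSub P).comap (map b φ) := by
      rw [tSub, Subgroup.closure_le]
      rintro _ ⟨v, hv, rfl⟩
      exact Subgroup.subset_closure ⟨_, hv, (map_T b φ v).symm⟩
    exact this hs

end

section

variable {κ : Type} [Fintype κ] [DecidableEq κ]

theorem X_mem {L : Subgroup (AffGrp (κ → ℤ))} (h : ∀ i, X (Pi.single i 1) ∈ L) (a : κ → ℤ) :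
    X a ∈ L := by
  let S : AddSubgroup (κ → ℤ) := {
    carrier := {a | X a ∈ L}
    zero_mem' := one_mem L
    add_mem' := fun {a b} ha hb => by
      change X (a + b) ∈ L
      rw [X_add]
      exact mul_mem ha hb
    neg_mem' := fun {a} ha => by
      change X (-a) ∈ L
      rw [X_neg]
      exact inv_mem ha }
  have h1 : a ∈ S := by
    rw [pi_eq_sum_univ' a]
    refine sum_mem fun i _ => zsmul_mem ?_ _
    exact h i
  exact h1

theorem closure_gen : Subgroup.closure
    (insert (T (0 : κ → ℤ)) (Set.range fun i : κ => X (Pi.single i (1 : ℤ)))) = ⊤ := by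
  set L := Subgroup.closure
    (insert (T (0 : κ → ℤ)) (Set.range fun i : κ => X (Pi.single i (1 : ℤ)))) with hL
  have hX : ∀ a, X a ∈ L :=
    X_mem fun i => Subgroup.subset_closure (Or.inr ⟨i, rfl⟩)
  have h0 : T 0 ∈ L := Subgroup.subset_closure (Or.inl rfl)
  have hT : ∀ a, T a ∈ L := fun a => by
    rw [T_eq]
    exact mul_mem (mul_mem (hX a) h0) (inv_mem (hX a))
  have hl : (⊤ : Subgroup _) ≤ L.comap SemidirectProduct.inl := by
    rw [← FreeGroup.closure_range_of, Subgroup.closure_le]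
    rintro _ ⟨v, rfl⟩
    exact hT v
  rw [eq_top_iff]
  rintro x -
  rw [← SemidirectProduct.inl_left_mul_inr_right x]
  exact mul_mem (hl trivial) (hX x.right.toAdd)

theorem exists_lift {E : Type*} [Group E] (t : E) (x : κ → E) (hx : ∀ i j, Commute (x i) (x j)) :
    ∃ F : AffGrp (κ → ℤ) →* E, F (T 0) = t ∧ ∀ i, F (X (Pi.single i 1)) = x i := by
  have hc : Pairwise fun i j => ∀ m n : Multiplicative ℤ,
      Commute (zpowersHom E (x i) m) (zpowersHom E (x j) n) := fun i j _ m n => by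
    simp only [zpowersHom_apply]
    exact (hx i j).zpow_zpow _ _
  let p : (κ → Multiplicative ℤ) →* E :=
    MonoidHom.noncommPiCoprod (fun i => zpowersHom E (x i)) hc
  let q : Multiplicative (κ → ℤ) →* E := p.comp
    { toFun := fun a i => Multiplicative.ofAdd (a.toAdd i)
      map_one' := rfl
      map_mul' := fun _ _ => rfl }
  let F : AffGrp (κ → ℤ) →* E := SemidirectProduct.lift
    (FreeGroup.lift fun v => q (Multiplicative.ofAdd v) * t * (q (Multiplicative.ofAdd v))⁻¹) q (by
      intro a
      ext v
      simp [transl, mul_assoc])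
  refine ⟨F, by simp [F, T], fun i => ?_⟩
  have : (fun j => Multiplicative.ofAdd ((Pi.single i 1 : κ → ℤ) j)) =
      Pi.mulSingle i (Multiplicative.ofAdd 1) := by
    ext j
    by_cases h : j = i
    · subst h
      simp
    · simp [h]
  simp only [F, X, SemidirectProduct.lift_inr, q, MonoidHom.comp_apply, MonoidHom.coe_mk,
    OneHom.coe_mk, toAdd_ofAdd, this, p]
  rw [MonoidHom.noncommPiCoprod_mulSingle]
  simp

end

end AffGrp

namespace Monoid.CoprodI

variable {ι : Type*} {M : ι → Type*} [∀ i, Group (M i)]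

/-- The product of a list of elements of the factors. -/
def listProd (l : List (Σ i, M i)) : CoprodI M := (l.map fun s => of s.2).prod

theorem listProd_append (l m : List (Σ i, M i)) : listProd (l ++ m) = listProd l * listProd m := by
  simp [listProd]

theorem listProd_flatten_replicate (l : List (Σ i, M i)) (n : ℕ) :
    listProd (List.replicate n l).flatten = listProd l ^ n := by
  induction n with
  | zero => simp [listProd]
  | succ n ih => rw [List.replicate_succ, List.flatten_cons, listProd_append, ih, pow_succ']

theorem listProd_ne_one {l : List (Σ i, M i)} (h1 : ∀ s ∈ l, s.2 ≠ 1)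
    (h2 : l.IsChain fun a b => a.1 ≠ b.1) (hne : l ≠ []) : listProd l ≠ 1 := by
  classical
  intro h
  have : (⟨l, h1, h2⟩ : Word M) = Word.empty := by
    apply Word.equiv.symm.injective
    change listProd l = _
    rw [h]
    exact Word.prod_empty.symm
  exact hne (congrArg Word.toList this)

theorem exists_conj_of_isOfFinOrder (x : CoprodI M) (hx : IsOfFinOrder x) :
    x = 1 ∨ ∃ (i : ι) (m : M i), IsConj x (of m) := by
  classical
  have key : ∀ n (l : List (Σ i, M i)), l.length = n → (∀ s ∈ l, s.2 ≠ 1) →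
      (l.IsChain fun a b => a.1 ≠ b.1) → IsOfFinOrder (listProd l) →
      listProd l = 1 ∨ ∃ (i : ι) (m : M i), IsConj (listProd l) (of m) := by
    intro n
    induction n using Nat.strong_induction_on with
    | _ n ih =>
    rintro (_ | ⟨⟨i, a⟩, l⟩) hn h1 h2 hf
    · exact Or.inl rfl
    rcases List.eq_nil_or_concat' l with rfl | ⟨m, ⟨j, b⟩, rfl⟩
    · refine Or.inr ⟨i, a, ?_⟩
      have : listProd [(⟨i, a⟩ : Σ i, M i)] = of a := by simp [listProd]
      rw [this]
    by_cases hij : j = i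
    · subst hij
      have hm : m.IsChain fun a b => a.1 ≠ b.1 := by
        rw [List.isChain_cons, List.isChain_append] at h2
        exact h2.2.1
      have hconj : IsConj (listProd (⟨j, a⟩ :: (m ++ [⟨j, b⟩]))) (of (b * a) * listProd m) := by
        rw [isConj_iff]
        refine ⟨of b, ?_⟩
        simp [listProd, mul_assoc]
      have hf' : IsOfFinOrder (of (b * a) * listProd m) := by
        obtain ⟨c, hc⟩ := isConj_iff.1 hconj
        rw [← hc]
        exact (MulAut.conj c).toMonoidHom.isOfFinOrder hf
      have fin : ∀ l' : List (Σ i, M i), listProd l' = of (b * a) * listProd m → l'.length < n →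
          (∀ s ∈ l', s.2 ≠ 1) → (l'.IsChain fun a b => a.1 ≠ b.1) →
          listProd (⟨j, a⟩ :: (m ++ [⟨j, b⟩])) = 1 ∨
            ∃ (i : ι) (m' : M i), IsConj (listProd (⟨j, a⟩ :: (m ++ [⟨j, b⟩]))) (of m') := by
        intro l' hl' hlen h1' h2'
        rw [← hl'] at hconj hf'
        rcases ih _ hlen l' rfl h1' h2' hf' with h | ⟨i, m', h⟩
        · left
          rw [h] at hconj
          exact isConj_one_left.1 hconj
        · exact Or.inr ⟨i, m', hconj.trans h⟩
      by_cases hba : b * a = 1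
      · refine fin m (by rw [hba, map_one, one_mul]) (by rw [← hn]; simp) ?_ hm
        intro s hs
        exact h1 s (by simp [hs])
      · refine fin (⟨j, b * a⟩ :: m) (by simp [listProd]) (by rw [← hn]; simp) ?_ ?_
        · intro s hs
          rcases List.mem_cons.1 hs with rfl | hs
          · exact hba
          · exact h1 s (by simp [hs])
        · rw [List.isChain_cons] at h2 ⊢
          refine ⟨fun y hy => ?_, hm⟩
          exact h2.1 y (by cases m <;> simp_all)
    · exfalso
      obtain ⟨k, hk, hk1⟩ := isOfFinOrder_iff_pow_eq_one.1 hf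
      rw [← listProd_flatten_replicate] at hk1
      refine listProd_ne_one ?_ (HNNExtension.isChain_flatten_replicate h2 ?_ k) ?_ hk1
      · intro s hs
        rw [List.mem_flatten] at hs
        obtain ⟨t, ht, hst⟩ := hs
        rw [List.eq_of_mem_replicate ht] at hst
        exact h1 s hst
      · intro p hp q hq
        have hp' : p = ⟨j, b⟩ := by
          rw [← List.cons_append, List.getLast?_append] at hp
          simpa using hp.symm
        have hq' : q = ⟨i, a⟩ := by simpa using hq.symm
        subst hp' hq'
        exact hij
      · simp [hk.ne']
  have hw : listProd (Word.equiv x).toList = x := Word.equiv.symm_apply_apply x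
  have := key _ (Word.equiv x).toList rfl (Word.equiv x).ne_one (Word.equiv x).chain_ne
    (by rwa [hw])
  rwa [hw] at this

theorem orderOf_of {i : ι} (x : M i) : orderOf (of x : CoprodI M) = orderOf x :=
  orderOf_injective _ (of_injective i) x

theorem exists_orderOf_eq (x : CoprodI M) (hx : IsOfFinOrder x) :
    x = 1 ∨ ∃ i, ∃ y : M i, orderOf y = orderOf x := by
  rcases exists_conj_of_isOfFinOrder x hx with h | ⟨i, y, h⟩
  · exact .inl h
  · obtain ⟨a, ha⟩ := isConj_iff.1 h
    refine .inr ⟨i, y, ?_⟩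
    rw [← orderOf_of, ← ha]
    exact orderOf_injective (MulAut.conj a).toMonoidHom (MulAut.conj a).injective x

end Monoid.CoprodI

/-- The cyclic group of order `n` (infinite for `n = 0`), written multiplicatively. -/
def Cyc (n : ℕ) : Type := Multiplicative (ZMod n)

namespace Cyc

instance (n : ℕ) : Group (Cyc n) := inferInstanceAs (Group (Multiplicative (ZMod n)))

/-- The generator. -/
def gen (n : ℕ) : Cyc n := Multiplicative.ofAdd (1 : ZMod n)

theorem exists_lift {E : Type*} [Group E] (n : ℕ) (x : E) (hx : x ^ n = 1) :
    ∃ f : Cyc n →* E, f (gen n) = x := by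
  have h : zmultiplesHom (Additive E) (Additive.ofMul x) n = 0 := by
    rw [zmultiplesHom_apply, natCast_zsmul, ← ofMul_pow, hx, ofMul_one]
  refine ⟨AddMonoidHom.toMultiplicativeLeft (ZMod.lift n ⟨_, h⟩), ?_⟩
  have h1 := ZMod.lift_coe n ⟨_, h⟩ 1
  rw [Int.cast_one] at h1
  change (ZMod.lift n ⟨_, h⟩ 1).toMul = x
  rw [h1, zmultiplesHom_apply, one_zsmul, toMul_ofMul]

theorem exists_eq_zpow {n : ℕ} (x : Cyc n) : ∃ k : ℤ, x = gen n ^ k := by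
  obtain ⟨k, hk⟩ := ZMod.intCast_surjective (Multiplicative.toAdd x)
  refine ⟨k, ?_⟩
  change Multiplicative.ofAdd (Multiplicative.toAdd x) = Multiplicative.ofAdd (1 : ZMod n) ^ k
  rw [← ofAdd_zsmul, zsmul_one, hk]

theorem gen_pow (n : ℕ) : gen n ^ n = 1 := by
  change Multiplicative.ofAdd (1 : ZMod n) ^ n = 1
  rw [← ofAdd_nsmul, nsmul_one, ZMod.natCast_self, ofAdd_zero]

theorem exists_orderOf_iff (n k : ℕ) :
    (∃ x : Cyc n, orderOf x = k) ↔ ∃ g : ZMod n, addOrderOf g = k := by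
  constructor
  · rintro ⟨x, rfl⟩
    exact ⟨Multiplicative.toAdd x, (orderOf_ofAdd_eq_addOrderOf (Multiplicative.toAdd x)).symm⟩
  · rintro ⟨g, rfl⟩
    exact ⟨Multiplicative.ofAdd g, orderOf_ofAdd_eq_addOrderOf g⟩

theorem torFree_zero : TorFree (Cyc 0) := torFree_of_isMulTorsionFree (Multiplicative ℤ)

end Cyc

/-- The `i`-th conjugate of `c` by powers of `d`. -/
def cConj {E : Type*} [Group E] (c d : E) (i : ℤ) : E := d ^ i * c * d ^ (-i)

/-- The `i`-th element `z_i`. -/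
def zElt {E : Type*} [Group E] (c d e : E) (i : ℤ) : E :=
  (cConj c d i)⁻¹ * e * cConj c d i * e⁻¹

theorem map_cConj {E F : Type*} [Group E] [Group F] (f : E →* F) (c d : E) (i : ℤ) :
    f (cConj c d i) = cConj (f c) (f d) i := by
  simp [cConj]

theorem map_zElt {E F : Type*} [Group E] [Group F] (f : E →* F) (c d e : E) (i : ℤ) :
    f (zElt c d e i) = zElt (f c) (f d) (f e) i := by
  simp [zElt, map_cConj]

theorem conj_hom_ext {S E : Type*} [Group S] [Group E] {X : Set S} (hX : Subgroup.closure X = ⊤)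
    {f g : S →* E} {e : E} (h : ∀ x ∈ X, e * f x = g x * e) (s : S) : e * f s = g s * e := by
  have : (MulAut.conj e).toMonoidHom.comp f = g := MonoidHom.eq_of_eqOn_dense hX fun x hx => by
    have := h x hx
    simp [this]
  rw [← this]
  simp

namespace TorsionGroup

variable (m : ℤ → ℕ)

/-- The free product of cyclic groups of orders `m i` and of two infinite cyclic groups. -/
abbrev Base : Type :=
  Monoid.CoprodI fun i : ℤ ⊕ Bool => Cyc (Sum.elim m (fun _ => 0) i)

/-- The generator of the `i`-th cyclic factor. -/
def gen (i : ℤ ⊕ Bool) : Base m := Monoid.CoprodI.of (i := i) (Cyc.gen _)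

theorem base_lift {E : Type*} [Group E] (x : ℤ ⊕ Bool → E) (hx : ∀ i, x (.inl i) ^ m i = 1) :
    ∃ f : Base m →* E, ∀ i, f (gen m i) = x i := by
  have : ∀ i : ℤ ⊕ Bool, ∃ f : Cyc (Sum.elim m (fun _ => 0) i) →* E, f (Cyc.gen _) = x i := by
    rintro (i | b)
    · exact Cyc.exists_lift _ _ (hx i)
    · exact Cyc.exists_lift _ _ (pow_zero _)
  choose f hf using this
  exact ⟨Monoid.CoprodI.lift f, fun i => by rw [gen, Monoid.CoprodI.lift_of, hf]⟩

theorem closure_gen : Subgroup.closure (Set.range (gen m)) = ⊤ := by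
  rw [eq_top_iff]
  rintro x -
  induction x using Monoid.CoprodI.induction_on with
  | one => exact one_mem _
  | of i x =>
    obtain ⟨k, rfl⟩ := x.exists_eq_zpow
    rw [map_zpow]
    have hi : gen m i ∈ Subgroup.closure (Set.range (gen m)) :=
      Subgroup.subset_closure (Set.mem_range_self i)
    exact zpow_mem hi k
  | mul a b ha hb => exact mul_mem ha hb

theorem gen_pow (i : ℤ) : gen m (.inl i) ^ m i = 1 := by
  rw [gen, ← map_pow]
  exact (congrArg _ (Cyc.gen_pow _)).trans (map_one _)

/-- The conjugates of `c`. -/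
def leftHom : FreeGroup ℤ →* Base m :=
  FreeGroup.lift fun i => cConj (gen m (.inr false)) (gen m (.inr true)) i

/-- The conjugates of `c`, multiplied by torsion elements. -/
def rightHom : FreeGroup ℤ →* Base m :=
  FreeGroup.lift fun i => cConj (gen m (.inr false)) (gen m (.inr true)) i * gen m (.inl i)

theorem exists_toAff : ∃ f : Base m →* AffGrp ℤ, f.comp (leftHom m) = SemidirectProduct.inl ∧
    f.comp (rightHom m) = SemidirectProduct.inl := by
  obtain ⟨f, hf⟩ := base_lift m (E := AffGrp ℤ)
    (Sum.elim (fun _ => 1) fun b => if b then AffGrp.X 1 else AffGrp.T 0) fun i => by simp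
  have hX : ∀ i : ℤ, (AffGrp.X (1 : ℤ)) ^ i = AffGrp.X i := fun i => by
    rw [AffGrp.X, ← map_zpow, ← ofAdd_zsmul, zsmul_one]
    rfl
  have h1 : ∀ i : ℤ, cConj (AffGrp.T (0 : ℤ)) (AffGrp.X 1) i = SemidirectProduct.inl (.of i) := by
    intro i
    rw [cConj, hX, hX, AffGrp.X_neg, AffGrp.conj_T, add_zero]
    rfl
  refine ⟨f, ?_, ?_⟩ <;> refine FreeGroup.ext_hom _ _ fun i => ?_
  · simp [leftHom, map_cConj, hf, h1]
  · simp [rightHom, map_cConj, hf, h1]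

theorem leftHom_injective : Function.Injective (leftHom m) := by
  obtain ⟨f, hf, -⟩ := exists_toAff m
  refine Function.Injective.of_comp (f := f) ?_
  rw [← MonoidHom.coe_comp, hf]
  exact SemidirectProduct.inl_injective

theorem rightHom_injective : Function.Injective (rightHom m) := by
  obtain ⟨f, -, hf⟩ := exists_toAff m
  refine Function.Injective.of_comp (f := f) ?_
  rw [← MonoidHom.coe_comp, hf]
  exact SemidirectProduct.inl_injective

/-- A group generated by three elements `c`, `d`, `e`, universal for `z_i ^ m i = 1`, and
whose torsion is that of the cyclic groups of orders `m i`. -/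
theorem exists_group : ∃ (D : Type) (_ : Group D) (c d e : D),
    Subgroup.closure {c, d, e} = ⊤ ∧ (∀ i, zElt c d e i ^ m i = 1) ∧
    (∀ k ≠ 0, (∃ h : D, orderOf h = k) ↔ ∃ i, ∃ g : ZMod (m i), addOrderOf g = k) ∧
    ∀ {E : Type} [Group E] (c' d' e' : E), (∀ i, zElt c' d' e' i ^ m i = 1) →
      ∃ f : D →* E, f c = c' ∧ f d = d' ∧ f e = e' := by
  let ℓ : Unit → StableLetter (Base m) := fun _ =>
    { S := FreeGroup ℤ
      α := leftHom m
      β := rightHom m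
      α_inj := leftHom_injective m
      β_inj := rightHom_injective m }
  obtain ⟨T⟩ := LetterTower.nonempty ℓ
  set c := T.ι (gen m (.inr false)) with hc
  set d := T.ι (gen m (.inr true)) with hd
  set e := T.ρ () with he
  have hz : ∀ i, zElt c d e i = T.ι (gen m (.inl i)) := by
    intro i
    have h : e * T.ι (leftHom m (FreeGroup.of i)) = T.ι (rightHom m (FreeGroup.of i)) * e :=
      T.rel () (FreeGroup.of i)
    simp only [leftHom, rightHom, FreeGroup.lift_apply_of, map_mul, map_cConj, ← hc, ← hd] at h
    rw [zElt, mul_assoc _ e, h]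
    group
  refine ⟨T.H, inferInstance, c, d, e, ?_, ?_, ?_, ?_⟩
  · rw [eq_top_iff, ← T.gen, Subgroup.closure_le]
    set L := Subgroup.closure {c, d, e} with hL
    have hcL : c ∈ L := Subgroup.subset_closure (by simp)
    have hdL : d ∈ L := Subgroup.subset_closure (by simp)
    have heL : e ∈ L := Subgroup.subset_closure (by simp)
    rintro _ (⟨x, rfl⟩ | ⟨i, rfl⟩)
    · have : (⊤ : Subgroup (Base m)) ≤ L.comap T.ι := by
        rw [← closure_gen, Subgroup.closure_le]
        rintro _ ⟨(i | (_ | _)), rfl⟩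
        · change T.ι _ ∈ L
          rw [← hz]
          have : cConj c d i ∈ L := mul_mem (mul_mem (zpow_mem hdL _) hcL) (zpow_mem hdL _)
          exact mul_mem (mul_mem (mul_mem (inv_mem this) heL) this) (inv_mem heL)
        · exact hcL
        · exact hdL
      exact this trivial
    · exact heL
  · intro i
    rw [hz, ← map_pow, gen_pow, map_one]
  · intro k hk
    rw [T.torOrd_eq k hk]
    constructor
    · rintro ⟨g, rfl⟩
      rcases Monoid.CoprodI.exists_orderOf_eq g (orderOf_ne_zero_iff.1 hk) with
        rfl | ⟨i | b, x, hx⟩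
      · exact ⟨0, 0, by simp⟩
      · exact ⟨i, (Cyc.exists_orderOf_iff _ _).1 ⟨x, hx⟩⟩
      · refine ⟨0, 0, ?_⟩
        have hx1 : x = 1 := Cyc.torFree_zero x (orderOf_ne_zero_iff.1 (hx.trans_ne hk))
        rw [addOrderOf_zero, ← hx]
        exact (orderOf_eq_one_iff.2 hx1).symm
    · rintro ⟨i, h⟩
      obtain ⟨x, hx⟩ := (Cyc.exists_orderOf_iff _ _).2 h
      exact ⟨Monoid.CoprodI.of (i := Sum.inl i) x, (Monoid.CoprodI.orderOf_of _).trans hx⟩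
  · intro E _ c' d' e' h
    obtain ⟨f, hf⟩ := base_lift m
      (Sum.elim (fun i => zElt c' d' e' i) fun b => if b then d' else c') h
    obtain ⟨F, hF, hF'⟩ := T.exists_lift f (fun _ => e') (by
      intro _
      refine conj_hom_ext (f := f.comp (leftHom m)) (g := f.comp (rightHom m))
        (FreeGroup.closure_range_of ℤ) ?_
      rintro _ ⟨i, rfl⟩
      simp [leftHom, rightHom, map_cConj, hf, zElt]
      group)
    refine ⟨F, ?_, ?_, hF' _⟩
    · rw [hc, hF, hf]
      simp
    · rw [hd, hF, hf]
      simp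

end TorsionGroup

theorem Commute.conj_zpow_eq {E : Type*} [Group E] {c d x : E} (h : x * c = d * c * d⁻¹ * x)
    (hd : Commute x d) (i : ℤ) : x ^ i * c * x ^ (-i) = cConj c d i := by
  have h1 : Commute (d⁻¹ * x) c := by
    rw [Commute, SemiconjBy, mul_assoc, h]
    group
  have h2 : Commute (d⁻¹ ^ i * x ^ i) c := by
    rw [← (hd.inv_right.symm).mul_zpow]
    exact h1.zpow_left i
  have h3 := h2.eq
  rw [cConj, zpow_neg, zpow_neg, mul_inv_eq_iff_eq_mul]
  rw [inv_zpow, mul_assoc, inv_mul_eq_iff_eq_mul] at h3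
  rw [h3]
  group

theorem Commute.conj_zElt {E : Type*} [Group E] {c d e x : E} (h : x * c = d * c * d⁻¹ * x)
    (hd : Commute x d) (he : Commute x e) (i j : ℤ) :
    x ^ i * zElt c d e j * x ^ (-i) = zElt c d e (i + j) := by
  have h1 : cConj c d (i + j) = x ^ i * cConj c d j * x ^ (-i) := by
    have hdd : Commute (x ^ i) (d ^ j) := (hd.zpow_right j).zpow_left i
    have := Commute.conj_zpow_eq h hd i
    rw [cConj, zpow_add, mul_assoc (d ^ i)]
    rw [cConj] at this ⊢
    have h2 : d ^ i * (d ^ j * c * d ^ (-j)) * (d ^ (-j))⁻¹ = d ^ i * (d ^ j * c) := by group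
    have e1 : d ^ i * (d ^ j * c) * d ^ (-(i + j)) = d ^ j * (d ^ i * c * d ^ (-i)) * d ^ (-j) := by
      group
    rw [e1, ← this]
    have h3 : x ^ (-i) * d ^ (-j) = d ^ (-j) * x ^ (-i) :=
      ((hd.zpow_right (-j)).zpow_left (-i)).eq
    calc d ^ j * (x ^ i * c * x ^ (-i)) * d ^ (-j)
        = (d ^ j * x ^ i) * c * (x ^ (-i) * d ^ (-j)) := by group
      _ = _ := by rw [← hdd.eq, h3]; group
  have hee : x ^ i * e * x ^ (-i) = e := by
    rw [(he.zpow_left i).eq, mul_assoc, ← zpow_add, add_neg_cancel, zpow_zero, mul_one]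
  have h4 : x ^ i * zElt c d e j * x ^ (-i) = (x ^ i * cConj c d j * x ^ (-i))⁻¹ *
      (x ^ i * e * x ^ (-i)) * (x ^ i * cConj c d j * x ^ (-i)) * (x ^ i * e * x ^ (-i))⁻¹ := by
    rw [zElt]
    group
  rw [h4, hee, ← h1, zElt]

/-- The defining relations of the control group. -/
structure CtrlRel {E : Type*} [Group E] (v : Fin 6 → E) : Prop where
  xy : v 4 * v 5 = v 5 * v 4
  xc : v 4 * v 0 = v 1 * v 0 * (v 1)⁻¹ * v 4
  xd : v 4 * v 1 = v 1 * v 4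
  xe : v 4 * v 2 = v 2 * v 4
  yc : v 5 * v 0 = v 0 * v 5
  yd : v 5 * v 1 = v 1 * v 5
  ye : v 5 * v 2 = v 2 * v 5
  yf : v 5 * v 3 = v 3 * zElt (v 0) (v 1) (v 2) 0 * v 5

namespace CtrlGrp

/-- The normal free subgroup. -/
abbrev Fib : Type := FreeGroup (Fin 3 ⊕ ℤ)

/-- The letters `c`, `d`, `e`. -/
def l (i : Fin 3) : Fib := .of (.inl i)

/-- The letters `f_i`. -/
def f (i : ℤ) : Fib := .of (.inr i)

/-- The homomorphism with prescribed values on the letters. -/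
def fibLift {E : Type*} [Group E] (u : Fin 3 → E) (v : ℤ → E) : Fib →* E :=
  FreeGroup.lift (Sum.elim u v)

section
variable {E : Type*} [Group E] (u : Fin 3 → E) (v : ℤ → E)

@[simp] theorem fibLift_l (i : Fin 3) : fibLift u v (l i) = u i := by simp [fibLift, l]

@[simp] theorem fibLift_f (i : ℤ) : fibLift u v (f i) = v i := by simp [fibLift, f]

theorem fib_ext {g h : Fib →* E} (h1 : ∀ i, g (l i) = h (l i)) (h2 : ∀ i, g (f i) = h (f i)) :
    g = h := by
  refine FreeGroup.ext_hom _ _ ?_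
  rintro (i | i)
  · exact h1 i
  · exact h2 i

end

/-- The elements `z_i` of the fibre. -/
def z (i : ℤ) : Fib := zElt (l 0) (l 1) (l 2) i

theorem fibLift_z {E : Type*} [Group E] (u : Fin 3 → E) (v : ℤ → E) (i : ℤ) :
    fibLift u v (z i) = zElt (u 0) (u 1) (u 2) i := by simp [z, map_zElt]

/-- The shift by `k`. -/
def shiftHom (k : ℤ) : Fib →* Fib :=
  fibLift ![cConj (l 0) (l 1) k, l 1, l 2] fun i => f (k + i)

theorem shiftHom_z (k i : ℤ) : shiftHom k (z i) = z (k + i) := by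
  rw [shiftHom, fibLift_z]
  simp [z, zElt, cConj, zpow_add]
  group

theorem shiftHom_shiftHom (j k : ℤ) (w : Fib) : shiftHom j (shiftHom k w) = shiftHom (j + k) w := by
  have : (shiftHom j).comp (shiftHom k) = shiftHom (j + k) := by
    refine fib_ext (fun i => ?_) fun i => ?_
    · fin_cases i <;> simp [shiftHom, map_cConj]
      simp [cConj]
      group
    · simp [shiftHom, add_assoc]
  exact DFunLike.congr_fun this w

theorem shiftHom_zero (w : Fib) : shiftHom 0 w = w := by
  have : shiftHom 0 = MonoidHom.id Fib := by
    refine fib_ext (fun i => ?_) fun i => ?_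
    · fin_cases i <;> simp [shiftHom, cConj]
    · simp [shiftHom]
  exact DFunLike.congr_fun this w

/-- The automorphism multiplying `f_i` by powers of `z_i`. -/
def twistHom (k : ℤ) : Fib →* Fib := fibLift l fun i => f i * z i ^ k

theorem twistHom_z (k i : ℤ) : twistHom k (z i) = z i := by
  rw [twistHom, fibLift_z, z]

theorem twistHom_twistHom (j k : ℤ) (w : Fib) : twistHom j (twistHom k w) = twistHom (j + k) w := by
  have : (twistHom j).comp (twistHom k) = twistHom (j + k) := by
    refine fib_ext (fun i => ?_) fun i => ?_
    · simp [twistHom]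
    · simp only [MonoidHom.comp_apply]
      conv_lhs => rw [twistHom, twistHom, fibLift_f, ← twistHom, map_mul, map_zpow, twistHom_z]
      simp [twistHom, zpow_add, mul_assoc]
  exact DFunLike.congr_fun this w

theorem twistHom_zero (w : Fib) : twistHom 0 w = w := by
  have : twistHom 0 = MonoidHom.id Fib := by
    refine fib_ext (fun i => ?_) fun i => ?_ <;> simp [twistHom]
  exact DFunLike.congr_fun this w

theorem shiftHom_twistHom (j k : ℤ) (w : Fib) :
    shiftHom j (twistHom k w) = twistHom k (shiftHom j w) := by
  have : (shiftHom j).comp (twistHom k) = (twistHom k).comp (shiftHom j) := by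
    refine fib_ext (fun i => ?_) fun i => ?_
    · fin_cases i <;> simp [shiftHom, twistHom, map_cConj]
    · have h := shiftHom_z j i
      simp only [shiftHom] at h
      simp [shiftHom, twistHom, h]
  exact DFunLike.congr_fun this w

/-- The action of `ℤ × ℤ` on the fibre. -/
def act : Multiplicative ℤ × Multiplicative ℤ →* MulAut Fib where
  toFun p :=
    { toFun w := shiftHom p.1.toAdd (twistHom p.2.toAdd w)
      invFun w := shiftHom (-p.1.toAdd) (twistHom (-p.2.toAdd) w)
      left_inv w := by
        simp only
        rw [← shiftHom_twistHom, shiftHom_shiftHom, twistHom_twistHom]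
        simp [shiftHom_zero, twistHom_zero]
      right_inv w := by
        simp only
        rw [← shiftHom_twistHom, shiftHom_shiftHom, twistHom_twistHom]
        simp [shiftHom_zero, twistHom_zero]
      map_mul' := by simp }
  map_one' := by
    ext w : 1
    simp [shiftHom_zero, twistHom_zero]
  map_mul' p q := by
    ext w : 1
    simp only [MulAut.mul_apply, MulEquiv.coe_mk, Equiv.coe_fn_mk]
    rw [← shiftHom_twistHom, shiftHom_shiftHom, twistHom_twistHom]
    simp

end CtrlGrp

/-- The control group. -/
abbrev CtrlGrp : Type := CtrlGrp.Fib ⋊[CtrlGrp.act] (Multiplicative ℤ × Multiplicative ℤ)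

namespace CtrlGrp

theorem torFree : TorFree CtrlGrp :=
  .semidirectProduct (torFree_of_isMulTorsionFree _) (torFree_of_isMulTorsionFree _)

/-- The inclusion of the fibre. -/
def inc : Fib →* CtrlGrp := SemidirectProduct.inl

/-- The element acting as the shift. -/
def x : CtrlGrp := SemidirectProduct.inr (Multiplicative.ofAdd 1, 1)

/-- The element acting as the twist. -/
def y : CtrlGrp := SemidirectProduct.inr (1, Multiplicative.ofAdd 1)

/-- The generators. -/
def gen : Fin 6 → CtrlGrp := ![inc (l 0), inc (l 1), inc (l 2), inc (f 0), x, y]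

theorem x_mul_inc (w : Fib) : x * inc w = inc (shiftHom 1 w) * x := by
  rw [← mul_inv_eq_iff_eq_mul, inc, x, ← map_inv, ← SemidirectProduct.inl_aut]
  simp [act, twistHom_zero]
  rfl

theorem y_mul_inc (w : Fib) : y * inc w = inc (twistHom 1 w) * y := by
  rw [← mul_inv_eq_iff_eq_mul, inc, y, ← map_inv, ← SemidirectProduct.inl_aut]
  simp [act, shiftHom_zero]
  rfl

theorem conj_x (i : ℤ) (w : Fib) : x ^ i * inc w * x ^ (-i) = inc (shiftHom i w) := by
  rw [zpow_neg, inc, x, ← map_zpow, ← map_inv, ← SemidirectProduct.inl_aut]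
  simp [act, twistHom_zero]
  rfl

theorem conj_xy (i : ℤ) (w : Fib) :
    (x * y) ^ i * inc w * (x * y) ^ (-i) = inc (shiftHom i (twistHom i w)) := by
  rw [zpow_neg, inc, x, y, ← map_mul, ← map_zpow, ← map_inv, ← SemidirectProduct.inl_aut]
  simp [act]
  rfl

theorem gen_rel : CtrlRel gen := by
  constructor
  · simp only [gen, x, y]
    simp [← map_mul]
  all_goals simp only [gen, Matrix.cons_val, x_mul_inc, y_mul_inc, ← map_zElt, ← map_mul,
    ← map_inv, mul_left_inj]
  all_goals simp [shiftHom, twistHom, z, cConj]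

theorem closure_gen : Subgroup.closure (Set.range gen) = ⊤ := by
  rw [eq_top_iff]
  set L := Subgroup.closure (Set.range gen) with hL
  have hg : ∀ i, gen i ∈ L := fun i => Subgroup.subset_closure ⟨i, rfl⟩
  have hx : x ∈ L := hg 4
  have hy : y ∈ L := hg 5
  have hinc : ∀ w, inc w ∈ L := by
    intro w
    induction w using FreeGroup.induction_on with
    | C1 => simp
    | of a =>
      rcases a with i | i
      · fin_cases i
        exacts [hg 0, hg 1, hg 2]
      · have h := conj_x i (f 0)
        rw [shiftHom, fibLift_f, add_zero] at h
        change inc (f i) ∈ L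
        rw [← h]
        exact mul_mem (mul_mem (zpow_mem hx _) (hg 3)) (zpow_mem hx _)
    | inv_of a ha => rw [map_inv]; exact inv_mem ha
    | mul a b ha hb => rw [map_mul]; exact mul_mem ha hb
  rintro w -
  rw [← SemidirectProduct.inl_left_mul_inr_right w]
  refine mul_mem (hinc _) ?_
  obtain ⟨a, b⟩ := w.right
  have : (SemidirectProduct.inr (a, b) : CtrlGrp) = x ^ a.toAdd * y ^ b.toAdd := by
    rw [x, y, ← map_zpow, ← map_zpow, ← map_mul]
    congr 1
    ext <;> simp
  rw [this]
  exact mul_mem (zpow_mem hx _) (zpow_mem hy _)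

theorem exists_lift {E : Type*} [Group E] {v : Fin 6 → E} (h : CtrlRel v) :
    ∃ F : CtrlGrp →* E, ∀ i, F (gen i) = v i := by
  have hxy : Commute (v 4) (v 5) := h.xy
  let f1 : Fib →* E := fibLift ![v 0, v 1, v 2] fun i => v 4 ^ i * v 3 * v 4 ^ (-i)
  let f2 : Multiplicative ℤ × Multiplicative ℤ →* E :=
    MonoidHom.noncommCoprod (zpowersHom E (v 4)) (zpowersHom E (v 5)) fun a b => by
      simpa using (hxy.zpow_left _).zpow_right _
  have hz : ∀ i, f1 (z i) = zElt (v 0) (v 1) (v 2) i := fun i => by simp [f1, fibLift_z]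
  have hf2 : ∀ a b, f2 (a, b) = v 4 ^ a.toAdd * v 5 ^ b.toAdd := fun a b => by
    simp [f2, MonoidHom.noncommCoprod_apply]
  have hs : ∀ i w, f1 (shiftHom i w) = v 4 ^ i * f1 w * v 4 ^ (-i) := by
    intro i w
    have hd : Commute (v 4) (v 1) := h.xd
    have he : Commute (v 4) (v 2) := h.xe
    have hc := Commute.conj_zpow_eq h.xc hd i
    have hd' := hd.zpow_left i
    have he' := he.zpow_left i
    have hf : ∀ j, v 4 ^ (i + j) * v 3 * v 4 ^ (-(i + j)) =
        v 4 ^ i * (v 4 ^ j * v 3 * v 4 ^ (-j)) * (v 4 ^ i)⁻¹ := fun j => by group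
    rw [zpow_neg] at hc ⊢
    generalize v 4 ^ i = u at hc hd' he' hf
    have : f1.comp (shiftHom i) = (MulAut.conj u).toMonoidHom.comp f1 := by
      refine fib_ext (fun j => ?_) fun j => ?_
      · fin_cases j
        · simpa [f1, shiftHom, map_cConj] using hc.symm
        · simp [f1, shiftHom, hd'.eq]
        · simp [f1, shiftHom, he'.eq]
      · simp only [f1, MonoidHom.comp_apply, shiftHom, fibLift_f]
        exact hf j
    exact DFunLike.congr_fun this w
  have ht : ∀ w, f1 (twistHom 1 w) = v 5 * f1 w * (v 5)⁻¹ := by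
    intro w
    have : f1.comp (twistHom 1) = (MulAut.conj (v 5)).toMonoidHom.comp f1 := by
      refine fib_ext (fun j => ?_) fun j => ?_
      · fin_cases j
        · simp [f1, twistHom, h.yc]
        · simp [f1, twistHom, h.yd]
        · simp [f1, twistHom, h.ye]
      · have hj : f1 (f j) = v 4 ^ j * v 3 * v 4 ^ (-j) := by simp [f1]
        have hzj := Commute.conj_zElt h.xc h.xd h.xe j 0
        rw [add_zero] at hzj
        have hc : v 5 * v 4 ^ j = v 4 ^ j * v 5 := ((hxy.zpow_left j).eq).symm
        have hc' : v 4 ^ (-j) * (v 5)⁻¹ = (v 5)⁻¹ * v 4 ^ (-j) :=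
          ((hxy.inv_right).zpow_left (-j)).eq
        have h3 : v 5 * v 3 * (v 5)⁻¹ = v 3 * zElt (v 0) (v 1) (v 2) 0 := by
          rw [h.yf]
          group
        change f1 (fibLift l (fun i => f i * z i ^ (1 : ℤ)) (f j)) = v 5 * (f1 (f j)) * (v 5)⁻¹
        rw [fibLift_f, map_mul, map_zpow, hz, hj, zpow_one, ← hzj]
        calc _ = v 4 ^ j * (v 3 * zElt (v 0) (v 1) (v 2) 0) * v 4 ^ (-j) := by group
          _ = v 4 ^ j * (v 5 * v 3 * (v 5)⁻¹) * v 4 ^ (-j) := by rw [h3]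
          _ = (v 4 ^ j * v 5) * v 3 * ((v 5)⁻¹ * v 4 ^ (-j)) := by group
          _ = _ := by rw [← hc, ← hc']; group
    simpa using DFunLike.congr_fun this w
  have ht' : ∀ (i : ℤ) w, f1 (twistHom i w) = v 5 ^ i * f1 w * v 5 ^ (-i) := by
    intro i
    induction i using Int.induction_on with
    | zero => simp [twistHom_zero]
    | succ i ih =>
      intro w
      rw [← twistHom_twistHom, ih, ht]
      group
    | pred i ih =>
      intro w
      have := ht (twistHom (-i - 1) w)
      rw [twistHom_twistHom, show 1 + (-(i : ℤ) - 1) = -i by ring, ih] at this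
      have h2 : f1 (twistHom (-i - 1) w) =
          (v 5)⁻¹ * (v 5 ^ (-(i : ℤ)) * f1 w * v 5 ^ (- -(i : ℤ))) * v 5 := by
        rw [this]
        group
      rw [h2]
      group
  refine ⟨SemidirectProduct.lift f1 f2 ?_, ?_⟩
  · rintro ⟨a, b⟩
    refine MonoidHom.ext fun w => ?_
    change f1 (shiftHom a.toAdd (twistHom b.toAdd w)) = f2 (a, b) * f1 w * (f2 (a, b))⁻¹
    rw [hs, ht', hf2]
    group
  · intro i
    fin_cases i
    all_goals first
      | exact (SemidirectProduct.lift_inl _ _ _ _).trans (by simp [f1])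
      | exact (SemidirectProduct.lift_inr _ _ _ _).trans (by simp [hf2])

end CtrlGrp

/-- If `f` and `g` agree on a generating set up to conjugation by `e`, they do so everywhere. -/
theorem conj_closure_hom_ext {H E : Type*} [Group H] [Group E] {Y : Set H}
    {f g : Subgroup.closure Y →* E} {e : E}
    (h : ∀ y : Subgroup.closure Y, (y : H) ∈ Y → e * f y = g y * e) (s : Subgroup.closure Y) :
    e * f s = g s * e :=
  conj_hom_ext (Subgroup.closure_closure_coe_preimage (k := Y)) h s

/-- The relations between the images of `B` and `D`, the stable letters and the last letter. -/
structure TwistRel {B D I E : Type} [Group B] [Group D] [Group E] (ℓ : I → StableLetter B)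
    {L : Subgroup B} (π : L →* D) (a : B →* E) (b : D →* E) (ρ : I → E) (k : E) : Prop where
  comm : ∀ x y, Commute (a x) (b y)
  rel : ∀ i s, ρ i * a ((ℓ i).α s) = a ((ℓ i).β s) * ρ i
  twist : ∀ x : L, k * a x = a x * b (π x) * k
  comm_letter : ∀ i, k * ρ i = ρ i * k

theorem exists_twist {B D I : Type} [Group B] [Group D] [Finite I] (ℓ : I → StableLetter B)
    (L : Subgroup B) (hL : ∀ i, (ℓ i).Compatible L) (π : L →* D)
    (hα : ∀ i s h, π ⟨(ℓ i).α s, h⟩ = 1) (hβ : ∀ i s h, π ⟨(ℓ i).β s, h⟩ = 1) :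
    ∃ (Q : Type) (_ : Group Q) (a : B →* Q) (b : D →* Q) (ρ : I → Q) (k : Q),
      TwistRel ℓ π a b ρ k ∧
      Subgroup.closure (Set.range a ∪ Set.range b ∪ Set.range ρ ∪ {k}) = ⊤ ∧
      (∀ n ≠ 0, (∃ q : Q, orderOf q = n) ↔ ∃ g : B × D, orderOf g = n) ∧
      ∀ {E : Type} [Group E] (a' : B →* E) (b' : D →* E) (ρ' : I → E) (k' : E),
        TwistRel ℓ π a' b' ρ' k' →
        ∃ F : Q →* E, (∀ x, F (a x) = a' x) ∧ (∀ y, F (b y) = b' y) ∧ (∀ i, F (ρ i) = ρ' i) ∧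
          F k = k' := by
  let ℓ' : I → StableLetter (B × D) := fun i =>
    (ℓ i).map (MonoidHom.inl B D) (fun x y h => congrArg Prod.fst h)
  obtain ⟨T⟩ := LetterTower.nonempty ℓ'
  let L' : Subgroup (B × D) := L.prod ⊥
  have hL' : ∀ i, (ℓ' i).Compatible L' := by
    intro i s
    change (ℓ i).α s ∈ L ∧ (1 : D) = 1 ↔ (ℓ i).β s ∈ L ∧ (1 : D) = 1
    exact and_congr_left' (hL i s)
  let pr : L' →* L :=
    ((MonoidHom.fst B D).comp L'.subtype).codRestrict L fun x => (Subgroup.mem_prod.1 x.2).1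
  let τ : L' →* T.H := T.ι.comp ((L.subtype.comp pr).prod (π.comp pr))
  have hτ : ∀ x : L', τ x = T.ι ((x : B × D).1, π ⟨(x : B × D).1, (Subgroup.mem_prod.1 x.2).1⟩) :=
    fun x => rfl
  have hcond : ∀ i s (hα : (ℓ' i).α s ∈ L') (hβ : (ℓ' i).β s ∈ L'),
      T.ρ i * τ ⟨_, hα⟩ = τ ⟨_, hβ⟩ * T.ρ i := by
    intro i s h1 h2
    have := T.rel i s
    rw [hτ, hτ]
    change T.ρ i * T.ι ((ℓ i).α s, π ⟨(ℓ i).α s, _⟩) = T.ι ((ℓ i).β s, π ⟨(ℓ i).β s, _⟩) * T.ρ i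
    exact (congrArg (fun d => T.ρ i * T.ι ((ℓ i).α s, d)) (hα i s _)).trans
      (this.trans (congrArg (fun d => T.ι ((ℓ i).β s, d) * T.ρ i) (hβ i s _)).symm)
  obtain ⟨Θ, hΘ1, hΘ2⟩ := T.extend L' hL' τ T.ρ hcond
  obtain ⟨θ, hθ1, hθ2⟩ := T.exists_lift
    (T.ι.comp ((MonoidHom.inl B D).comp (MonoidHom.fst B D))) T.ρ (fun i s => T.rel i s)
  have hcomp : θ.comp Θ = Subgroup.subtype _ := by
    refine MonoidHom.eq_of_eqOn_dense (Subgroup.closure_closure_coe_preimage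
      (k := T.ι '' L' ∪ Set.range T.ρ)) ?_
    rintro ⟨y, hy⟩ hy'
    rcases hy' with ⟨g, hg, hgy⟩ | ⟨i, hi⟩
    · have e1 := hΘ1 ⟨y, hy⟩ ⟨g, hg⟩ hgy.symm
      change θ (Θ _) = y
      rw [e1, hτ, hθ1]
      change T.ι (g.1, 1) = y
      obtain ⟨g1, g2⟩ := g
      obtain rfl : g2 = 1 := (Subgroup.mem_prod.1 hg).2
      exact hgy
    · have e1 := hΘ2 ⟨y, hy⟩ i hi.symm
      change θ (Θ _) = y
      rw [e1, hθ2]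
      exact hi
  have hΘinj : Function.Injective Θ := by
    refine Function.Injective.of_comp (f := θ) ?_
    rw [← MonoidHom.coe_comp, hcomp]
    exact Subgroup.subtype_injective _
  let ℓ₂ : Unit → StableLetter T.H := fun _ =>
    { S := Subgroup.closure (T.ι '' L' ∪ Set.range T.ρ)
      α := Subgroup.subtype _
      β := Θ
      α_inj := Subgroup.subtype_injective _
      β_inj := hΘinj }
  obtain ⟨T₂⟩ := LetterTower.nonempty ℓ₂
  have hrel2 : ∀ s : Subgroup.closure (T.ι '' L' ∪ Set.range T.ρ),
      T₂.ρ () * T₂.ι s = T₂.ι (Θ s) * T₂.ρ () := fun s => T₂.rel () s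
  have hmemL : ∀ x : L, ((x : B), (1 : D)) ∈ L' := fun x => Subgroup.mem_prod.2 ⟨x.2, rfl⟩
  refine ⟨T₂.H, inferInstance, T₂.ι.comp (T.ι.comp (MonoidHom.inl B D)),
    T₂.ι.comp (T.ι.comp (MonoidHom.inr B D)), fun i => T₂.ι (T.ρ i), T₂.ρ (), ⟨?_, ?_, ?_, ?_⟩,
    ?_, ?_, ?_⟩
  · intro x y
    exact (MonoidHom.commute_inl_inr x y).map (T₂.ι.comp T.ι)
  · intro i s
    have := congrArg T₂.ι (T.rel i s)
    rw [map_mul, map_mul] at this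
    exact this
  · intro x
    have hmem : T.ι ((x : B), (1 : D)) ∈ Subgroup.closure (T.ι '' L' ∪ Set.range T.ρ) :=
      Subgroup.subset_closure (.inl ⟨_, hmemL x, rfl⟩)
    have h1 := hrel2 ⟨_, hmem⟩
    rw [hΘ1 _ ⟨_, hmemL x⟩ rfl, hτ] at h1
    refine h1.trans ?_
    congr 1
    change _ = T₂.ι (T.ι (x, 1)) * T₂.ι (T.ι (1, π x))
    rw [← map_mul, ← map_mul]
    simp
  · intro i
    have hmem : T.ρ i ∈ Subgroup.closure (T.ι '' L' ∪ Set.range T.ρ) :=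
      Subgroup.subset_closure (.inr ⟨i, rfl⟩)
    have h1 := hrel2 ⟨_, hmem⟩
    rw [hΘ2 _ i rfl] at h1
    exact h1
  · rw [eq_top_iff, ← T₂.gen, Subgroup.closure_le]
    set C := Subgroup.closure (Set.range (T₂.ι.comp (T.ι.comp (MonoidHom.inl B D))) ∪
      Set.range (T₂.ι.comp (T.ι.comp (MonoidHom.inr B D))) ∪ Set.range (fun i => T₂.ι (T.ρ i)) ∪
      {T₂.ρ ()}) with hC
    rintro _ (⟨x, rfl⟩ | ⟨i, rfl⟩)
    · have : (⊤ : Subgroup T.H) ≤ C.comap T₂.ι := by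
        rw [← T.gen, Subgroup.closure_le]
        rintro _ (⟨⟨x, y⟩, rfl⟩ | ⟨i, rfl⟩)
        · change T₂.ι (T.ι (x, y)) ∈ C
          have : (x, y) = MonoidHom.inl B D x * MonoidHom.inr B D y := by simp
          rw [this, map_mul, map_mul]
          exact mul_mem (Subgroup.subset_closure (.inl (.inl (.inl ⟨x, rfl⟩))))
            (Subgroup.subset_closure (.inl (.inl (.inr ⟨y, rfl⟩))))
        · exact Subgroup.subset_closure (.inl (.inr ⟨i, rfl⟩))
      exact this trivial
    · exact Subgroup.subset_closure (.inr rfl)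
  · intro n hn
    rw [T₂.torOrd_eq n hn, T.torOrd_eq n hn]
  · intro E _ a' b' ρ' k' h
    obtain ⟨F₁, hF1, hF1'⟩ := T.exists_lift (MonoidHom.noncommCoprod a' b' h.comm) ρ' (by
      intro i s
      change ρ' i * (a' ((ℓ i).α s) * b' 1) = a' ((ℓ i).β s) * b' 1 * ρ' i
      rw [map_one, mul_one, mul_one]
      exact h.rel i s)
    have hF1a : ∀ x y, F₁ (T.ι (x, y)) = a' x * b' y := fun x y => by
      rw [hF1, MonoidHom.noncommCoprod_apply]
    have key : ∀ s : Subgroup.closure (T.ι '' L' ∪ Set.range T.ρ),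
        k' * F₁ s = F₁ (Θ s) * k' := by
      intro s
      refine conj_closure_hom_ext (f := F₁.comp (Subgroup.subtype _)) (g := F₁.comp Θ) ?_ s
      rintro ⟨y, hy⟩ (⟨g, hg, hgy⟩ | ⟨i, hi⟩)
      · have e1 := hΘ1 ⟨y, hy⟩ ⟨g, hg⟩ hgy.symm
        change k' * F₁ y = F₁ (Θ _) * k'
        rw [e1, hτ, hF1a, ← show T.ι g = y from hgy]
        obtain ⟨g1, g2⟩ := g
        obtain rfl : g2 = 1 := (Subgroup.mem_prod.1 hg).2
        rw [hF1a, map_one, mul_one]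
        exact h.twist ⟨g1, (Subgroup.mem_prod.1 hg).1⟩
      · have e1 := hΘ2 ⟨y, hy⟩ i hi.symm
        change k' * F₁ y = F₁ (Θ _) * k'
        rw [e1, ← show T.ρ i = y from hi, hF1']
        exact h.comm_letter i
    obtain ⟨F, hF, hF'⟩ := T₂.exists_lift F₁ (fun _ => k') (fun _ s => key s)
    refine ⟨F, fun x => ?_, fun y => ?_, fun i => ?_, hF' ()⟩
    · change F (T₂.ι (T.ι (x, 1))) = _
      rw [hF, hF1a, map_one, mul_one]
    · change F (T₂.ι (T.ι (1, y))) = _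
      rw [hF, hF1a, map_one, one_mul]
    · rw [hF, hF1']

/-- A partial affine bijection between two subsets of `κ → ℤ`. -/
structure AffRule (κ : Type) where
  /-- the index set of the parameters -/
  dim : Type
  [fin : Fintype dim]
  [dec : DecidableEq dim]
  /-- the base point of the source -/
  b : κ → ℤ
  /-- the base point of the target -/
  c : κ → ℤ
  /-- the linear part of the source -/
  φ : (dim → ℤ) →+ (κ → ℤ)
  /-- the linear part of the target -/
  ψ : (dim → ℤ) →+ (κ → ℤ)
  inj : Function.Injective φ
  inj' : Function.Injective ψ

attribute [instance] AffRule.fin AffRule.dec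

/-- A finite system of affine rules, with a final point, an initial point and two coordinates
used for the input. -/
structure AffSystem (κ R : Type) where
  /-- the rules -/
  rules : R → AffRule κ
  /-- the final point -/
  vfin : κ → ℤ
  /-- the initial point for input zero -/
  v0 : κ → ℤ
  /-- the coordinate of the first input -/
  α : κ
  /-- the coordinate of the second input -/
  s : κ

namespace AffSystem

variable {κ R : Type} (S : AffSystem κ R)

/-- A single application of a rule. -/
def Step (u v : κ → ℤ) : Prop :=
  ∃ r w, u = (S.rules r).b + (S.rules r).φ w ∧ v = (S.rules r).c + (S.rules r).ψ w

/-- The points connected to the final one. -/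
def conn : Set (κ → ℤ) := {u | Relation.EqvGen S.Step S.vfin u}

theorem conn_iff (r : R) (w : (S.rules r).dim → ℤ) :
    (S.rules r).b + (S.rules r).φ w ∈ S.conn ↔ (S.rules r).c + (S.rules r).ψ w ∈ S.conn := by
  have h : Relation.EqvGen S.Step _ _ := .rel _ _ ⟨r, w, rfl, rfl⟩
  exact ⟨fun h1 => h1.trans _ _ _ h, fun h1 => h1.trans _ _ _ (h.symm _ _)⟩

variable [DecidableEq κ]

/-- The initial point for given inputs. -/
def input (E a : ℤ) : κ → ℤ := S.v0 + Pi.single S.α a + Pi.single S.s E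

/-- The linear part of the test letters. -/
def scale : (Unit → ℤ) →+ (κ → ℤ) where
  toFun w := Pi.single S.α (3 * w ())
  map_zero' := by simp
  map_add' w w' := by rw [← Pi.single_add, Pi.add_apply, mul_add]

theorem scale_injective : Function.Injective S.scale := by
  intro w w' h
  have h1 := congrFun h S.α
  simp only [scale, AddMonoidHom.coe_mk, ZeroHom.coe_mk, Pi.single_eq_same] at h1
  funext u
  change w () = w' ()
  omega

theorem input_add_scale (E a : ℤ) (w : Unit → ℤ) :
    S.input E a + S.scale w = S.input E (3 * w () + a) := by
  simp only [input, scale, AddMonoidHom.coe_mk, ZeroHom.coe_mk, add_comm (3 * w ()), Pi.single_add]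
  abel

end AffSystem

section Words

variable {κ : Type} [Fintype κ] [DecidableEq κ]

theorem AffGrp.exists_word (k : AffGrp (κ → ℤ)) : ∃ w : FreeGroup (Option κ),
    FreeGroup.lift (fun o => o.elim (AffGrp.T 0) fun i => AffGrp.X (Pi.single i 1)) w = k := by
  set f : FreeGroup (Option κ) →* AffGrp (κ → ℤ) :=
    FreeGroup.lift (fun o => o.elim (AffGrp.T 0) fun i => AffGrp.X (Pi.single i 1)) with hf
  have : (⊤ : Subgroup (AffGrp (κ → ℤ))) ≤ f.range := by
    rw [← AffGrp.closure_gen, Subgroup.closure_le]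
    rintro _ (rfl | ⟨i, rfl⟩)
    · exact ⟨.of none, by simp [hf]⟩
    · exact ⟨.of (some i), by simp [hf]⟩
  exact this (Subgroup.mem_top k)

/-- The value of a word for `k` at the given images of the generators. -/
noncomputable def AffGrp.eval {E : Type} [Group E] (t : E) (x : κ → E) (k : AffGrp (κ → ℤ)) : E :=
  FreeGroup.lift (fun o => o.elim t x) (AffGrp.exists_word k).choose

theorem AffGrp.map_eval {E F : Type} [Group E] [Group F] (f : E →* F) (t : E) (x : κ → E)
    (k : AffGrp (κ → ℤ)) : f (AffGrp.eval t x k) = AffGrp.eval (f t) (fun i => f (x i)) k := by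
  have : f.comp (FreeGroup.lift (fun o => Option.elim o t x)) =
      FreeGroup.lift (fun o => Option.elim o (f t) fun i => f (x i)) := by
    refine FreeGroup.ext_hom _ _ ?_
    rintro (_ | i) <;> simp
  exact DFunLike.congr_fun this _

theorem AffGrp.map_eq_eval {E : Type} [Group E] (f : AffGrp (κ → ℤ) →* E) (k : AffGrp (κ → ℤ)) :
    f k = AffGrp.eval (f (AffGrp.T 0)) (fun i => f (AffGrp.X (Pi.single i 1))) k := by
  rw [← AffGrp.map_eval, AffGrp.eval, (AffGrp.exists_word k).choose_spec]

end Words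

/-- The letters of the presentation. -/
inductive PresGen (κ R : Type) where
  | t
  | x (i : κ)
  | ctrl (i : Fin 6)
  | tor (i : Fin 3)
  | rule (r : R)
  | test (j : Fin 3)
  | k
  | g

instance (κ R : Type) [Finite κ] [Finite R] : Finite (PresGen κ R) := by
  refine Finite.of_surjective (α := Option κ ⊕ Fin 6 ⊕ Fin 3 ⊕ R ⊕ Fin 3 ⊕ Bool)
    (Sum.elim (fun o => o.elim .t .x) (Sum.elim .ctrl (Sum.elim .tor (Sum.elim .rule (Sum.elim .test
      fun b => bif b then .k else .g))))) ?_
  rintro (_ | i | i | i | r | j | _ | _)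
  exacts [⟨.inl none, rfl⟩, ⟨.inl (some i), rfl⟩, ⟨.inr (.inl i), rfl⟩, ⟨.inr (.inr (.inl i)), rfl⟩,
    ⟨.inr (.inr (.inr (.inl r))), rfl⟩, ⟨.inr (.inr (.inr (.inr (.inl j)))), rfl⟩,
    ⟨.inr (.inr (.inr (.inr (.inr true)))), rfl⟩, ⟨.inr (.inr (.inr (.inr (.inr false)))), rfl⟩]

/-- The index set of the relations. -/
inductive PresRel {κ R : Type} (S : AffSystem κ R) where
  | xx (i j : κ)
  | ctrl (i : Fin 8)
  | affCtrl (i : Option κ) (j : Fin 6)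
  | affTor (i : Option κ) (j : Fin 3)
  | ctrlTor (i : Fin 6) (j : Fin 3)
  | ruleT (r : R)
  | ruleX (p : Σ r, (S.rules r).dim)
  | testT (j : Fin 3)
  | testX (j : Fin 3)
  | kT
  | kRule (r : R)
  | kTest (j : Fin 3)
  | kCtrl (j : Fin 3)

instance {κ R : Type} (S : AffSystem κ R) [Finite κ] [Finite R] : Finite (PresRel S) := by
  refine Finite.of_surjective (α := (κ × κ) ⊕ Fin 8 ⊕ (Option κ × Fin 6) ⊕ (Option κ × Fin 3) ⊕
      (Fin 6 × Fin 3) ⊕ Option R ⊕ (Σ r, (S.rules r).dim) ⊕ (Fin 4 × Fin 3) ⊕ R)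
    (Sum.elim (fun p => .xx p.1 p.2) (Sum.elim .ctrl (Sum.elim (fun p => .affCtrl p.1 p.2)
      (Sum.elim (fun p => .affTor p.1 p.2) (Sum.elim (fun p => .ctrlTor p.1 p.2)
      (Sum.elim (fun o => o.elim .kT .ruleT) (Sum.elim .ruleX
      (Sum.elim (fun p => ![.testT p.2, .testX p.2, .kTest p.2, .kCtrl p.2] p.1) .kRule)))))))) ?_
  rintro (⟨i, j⟩ | i | ⟨i, j⟩ | ⟨i, j⟩ | ⟨i, j⟩ | r | p | j | j | _ | r | j | j)
  exacts [⟨.inl (i, j), rfl⟩, ⟨.inr (.inl i), rfl⟩, ⟨.inr (.inr (.inl (i, j))), rfl⟩,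
    ⟨.inr (.inr (.inr (.inl (i, j)))), rfl⟩, ⟨.inr (.inr (.inr (.inr (.inl (i, j))))), rfl⟩,
    ⟨.inr (.inr (.inr (.inr (.inr (.inl (some r)))))), rfl⟩,
    ⟨.inr (.inr (.inr (.inr (.inr (.inr (.inl p)))))), rfl⟩,
    ⟨.inr (.inr (.inr (.inr (.inr (.inr (.inr (.inl (0, j)))))))), rfl⟩,
    ⟨.inr (.inr (.inr (.inr (.inr (.inr (.inr (.inl (1, j)))))))), rfl⟩,
    ⟨.inr (.inr (.inr (.inr (.inr (.inl none))))), rfl⟩,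
    ⟨.inr (.inr (.inr (.inr (.inr (.inr (.inr (.inr r))))))), rfl⟩,
    ⟨.inr (.inr (.inr (.inr (.inr (.inr (.inr (.inl (2, j)))))))), rfl⟩,
    ⟨.inr (.inr (.inr (.inr (.inr (.inr (.inr (.inl (3, j)))))))), rfl⟩]

/-- The value of a test letter on `T 0`. -/
def testT {E : Type} [Group E] (v : Fin 6 → E) : Fin 3 → E :=
  ![v 3, zElt (v 0) (v 1) (v 2) 0, v 3]

/-- The value of a test letter on `X 1`. -/
def testX {E : Type} [Group E] (v : Fin 6 → E) : Fin 3 → E := ![v 4 * v 5, v 4, v 4]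

theorem map_testT {E F : Type} [Group E] [Group F] (f : E →* F) (v : Fin 6 → E) (j : Fin 3) :
    f (testT v j) = testT (fun i => f (v i)) j := by
  fin_cases j <;> simp [testT, map_zElt]

theorem map_testX {E F : Type} [Group E] [Group F] (f : E →* F) (v : Fin 6 → E) (j : Fin 3) :
    f (testX v j) = testX (fun i => f (v i)) j := by
  fin_cases j <;> simp [testX]

namespace PresRel

variable {κ R : Type} [Fintype κ] [DecidableEq κ] {S : AffSystem κ R}

section
variable {E : Type} [Group E] (e : PresGen κ R → E)

/-- The value of an element of the affine group. -/
noncomputable def aff (k : AffGrp (κ → ℤ)) : E := AffGrp.eval (e .t) (fun i => e (.x i)) k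

/-- The two sides of a relation. -/
noncomputable def sides : PresRel S → E × E
  | xx i j => (e (.x i) * e (.x j), e (.x j) * e (.x i))
  | ctrl i =>
    let v i := e (.ctrl i)
    ![(v 4 * v 5, v 5 * v 4), (v 4 * v 0, v 1 * v 0 * (v 1)⁻¹ * v 4), (v 4 * v 1, v 1 * v 4),
      (v 4 * v 2, v 2 * v 4), (v 5 * v 0, v 0 * v 5), (v 5 * v 1, v 1 * v 5),
      (v 5 * v 2, v 2 * v 5), (v 5 * v 3, v 3 * zElt (v 0) (v 1) (v 2) 0 * v 5)] i
  | affCtrl i j =>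
    (e (i.elim .t .x) * e (.ctrl j), e (.ctrl j) * e (i.elim .t .x))
  | affTor i j =>
    (e (i.elim .t .x) * e (.tor j), e (.tor j) * e (i.elim .t .x))
  | ctrlTor i j => (e (.ctrl i) * e (.tor j), e (.tor j) * e (.ctrl i))
  | ruleT r =>
    (e (.rule r) * aff e (AffGrp.T (S.rules r).b),
      aff e (AffGrp.T (S.rules r).c) * e (.rule r))
  | ruleX ⟨r, i⟩ => (e (.rule r) * aff e (AffGrp.X ((S.rules r).φ (Pi.single i 1))),
      aff e (AffGrp.X ((S.rules r).ψ (Pi.single i 1))) * e (.rule r))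
  | testT j =>
    let u := e .g * aff e (AffGrp.T (S.v0 + Pi.single S.α (j : ℤ))) * (e .g)⁻¹
    (e (.test j) * u, u * _root_.testT (fun i => e (.ctrl i)) j * e (.test j))
  | testX j =>
    let u := aff e (AffGrp.X (S.scale (Pi.single () 1)))
    (e (.test j) * u, u * _root_.testX (fun i => e (.ctrl i)) j * e (.test j))
  | kT => (e .k * aff e (AffGrp.T S.vfin), aff e (AffGrp.T S.vfin) * e .k)
  | kRule r => (e .k * e (.rule r), e (.rule r) * e .k)
  | kTest j => (e .k * e (.test j), e (.test j) * e .k)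
  | kCtrl j =>
    (e .k * e (.ctrl (j.castLE (by decide))),
      e (.ctrl (j.castLE (by decide))) * e (.tor j) * e .k)

end

theorem map_aff {E F : Type} [Group E] [Group F] (f : E →* F) (e : PresGen κ R → E)
    (k : AffGrp (κ → ℤ)) : f (aff e k) = aff (f ∘ e) k := AffGrp.map_eval f _ _ _

theorem map_sides {E F : Type} [Group E] [Group F] (f : E →* F) (e : PresGen κ R → E)
    (p : PresRel S) : (f (sides e p).1, f (sides e p).2) = sides (f ∘ e) p := by
  cases p with
  | ctrl i => fin_cases i <;> simp [sides, map_zElt]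
  | ruleX p => simp [sides, map_aff]
  | _ => simp [sides, map_aff, map_testT, map_testX]

end PresRel

/-- All relations hold, and `g` is the given power. -/
structure AffSystem.Holds {κ R : Type} [Fintype κ] [DecidableEq κ] (S : AffSystem κ R) (n : ℕ)
    {E : Type} [Group E] (e : PresGen κ R → E) : Prop where
  rel : ∀ p : PresRel S, (p.sides e).1 = (p.sides e).2
  pow : e .g = e (.x S.s) ^ n

theorem TorFree.prod {G H : Type*} [Group G] [Group H] (hG : TorFree G) (hH : TorFree H) :
    TorFree (G × H) := fun _ hx =>
  Prod.ext (hG _ ((MonoidHom.fst G H).isOfFinOrder hx)) (hH _ ((MonoidHom.snd G H).isOfFinOrder hx))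

theorem exists_orderOf_prod {G H : Type*} [Group G] [Group H] (hG : TorFree G) {n : ℕ}
    (hn : n ≠ 0) : (∃ g : G × H, orderOf g = n) ↔ ∃ h : H, orderOf h = n := by
  constructor
  · rintro ⟨⟨g, h⟩, rfl⟩
    have h1 : g = 1 := hG _ ((MonoidHom.fst G H).isOfFinOrder (orderOf_ne_zero_iff.1 hn))
    exact ⟨h, by simp [Prod.orderOf, h1]⟩
  · rintro ⟨h, rfl⟩
    exact ⟨(1, h), by simp [Prod.orderOf]⟩

theorem commute_of_closure {G H E : Type*} [Group G] [Group H] [Group E] {X : Set G} {Y : Set H}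
    (hX : Subgroup.closure X = ⊤) (hY : Subgroup.closure Y = ⊤) (f : G →* E) (g : H →* E)
    (h : ∀ x ∈ X, ∀ y ∈ Y, Commute (f x) (g y)) (x : G) (y : H) : Commute (f x) (g y) := by
  have h1 : ∀ x ∈ X, ∀ y, Commute (f x) (g y) := fun x hx y =>
    conj_hom_ext hY (f := g) (g := g) (e := f x) (fun y hy => h x hx y hy) y
  exact (conj_hom_ext hX (f := f) (g := f) (e := g y) (fun x hx => (h1 x hx y).symm) x).symm

namespace CtrlGrp

theorem inc_injective : Function.Injective inc := SemidirectProduct.inl_injective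

/-- The values of the test letters. -/
def tw (j : Fin 3) (u : ℤ) : Fib := ![f u * z u ^ u, z u, f u] j

theorem exists_chi (j : Fin 3) : ∃ χ : AffGrp (Unit → ℤ) →* CtrlGrp,
    χ (AffGrp.T 0) = testT gen j ∧ χ (AffGrp.X (Pi.single () 1)) = testX gen j ∧
      ∀ u, χ (AffGrp.T u) = inc (tw j (u ())) := by
  obtain ⟨χ, h1, h2⟩ := AffGrp.exists_lift (κ := Unit) (testT gen j) (fun _ => testX gen j)
    fun _ _ => Commute.refl _
  refine ⟨χ, h1, h2 _, fun u => ?_⟩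
  have hu : AffGrp.X u = AffGrp.X (Pi.single () 1 : Unit → ℤ) ^ u () := by
    rw [AffGrp.X, AffGrp.X, ← map_zpow, ← ofAdd_zsmul]
    congr 2
    ext
    simp
  rw [AffGrp.T_eq, hu, map_mul, map_mul, map_inv, map_zpow, h1, h2, ← zpow_neg]
  generalize u () = i
  fin_cases j
  · change (x * y) ^ i * inc (f 0) * (x * y) ^ (-i) = inc (f i * z i ^ i)
    rw [conj_xy, twistHom, fibLift_f, map_mul, map_zpow, shiftHom_z, shiftHom, fibLift_f, add_zero]
  · change x ^ i * zElt (inc (l 0)) (inc (l 1)) (inc (l 2)) 0 * x ^ (-i) = inc (z i)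
    rw [← map_zElt, conj_x]
    exact congrArg inc ((shiftHom_z i 0).trans (by rw [add_zero]))
  · change x ^ i * inc (f 0) * x ^ (-i) = inc (f i)
    rw [conj_x, shiftHom, fibLift_f, add_zero]

/-- The homomorphism of a test letter. -/
noncomputable def chi (j : Fin 3) : AffGrp (Unit → ℤ) →* CtrlGrp := (exists_chi j).choose

theorem chi_T_zero (j : Fin 3) : chi j (AffGrp.T 0) = testT gen j := (exists_chi j).choose_spec.1

theorem chi_X (j : Fin 3) : chi j (AffGrp.X (Pi.single () 1)) = testX gen j :=
  (exists_chi j).choose_spec.2.1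

theorem chi_T (j : Fin 3) (u) : chi j (AffGrp.T u) = inc (tw j (u ())) :=
  (exists_chi j).choose_spec.2.2 u

/-- The homomorphism from the fibre killing the letters `f_i`, defined on the range. -/
noncomputable def retr {D : Type} [Group D] (u : Fin 3 → D) : inc.range →* D :=
  (fibLift u 1).comp (MonoidHom.ofInjective inc_injective).symm.toMonoidHom

theorem retr_inc {D : Type} [Group D] (u : Fin 3 → D) (w : Fib) (h : inc w ∈ inc.range) :
    retr u ⟨inc w, h⟩ = fibLift u 1 w := by
  change fibLift u 1 ((MonoidHom.ofInjective inc_injective).symm _) = _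
  congr 1
  rw [MulEquiv.symm_apply_eq]
  rfl

end CtrlGrp

namespace AffSystem

variable {κ R : Type} [DecidableEq κ] (S : AffSystem κ R)

/-- The system verifies the divisibility conditions for the orders `m i`. -/
structure Computes (n : ℕ) (m : ℤ → ℕ) : Prop where
  test0 : ∀ u, S.input n (3 * u) ∈ S.conn → (m u : ℤ) ∣ u
  test1 : ∀ u, S.input n (3 * u + 1) ∈ S.conn → m u = 1
  enough : ∀ u, m u = 0 ∨ (m u = 1 ∧ S.input n (3 * u + 1) ∈ S.conn) ∨
    ((m u : ℤ) = u ∧ S.input n (3 * u) ∈ S.conn ∧ S.input n (3 * u + 2) ∈ S.conn)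

/-- The stable letters. -/
noncomputable def letter (n : ℕ) : R ⊕ Fin 3 → StableLetter (AffGrp (κ → ℤ) × CtrlGrp)
  | .inl r =>
    { S := AffGrp ((S.rules r).dim → ℤ)
      α := (MonoidHom.inl _ _).comp (AffGrp.map (S.rules r).b (S.rules r).φ)
      β := (MonoidHom.inl _ _).comp (AffGrp.map (S.rules r).c (S.rules r).ψ)
      α_inj := fun _ _ h => AffGrp.map_injective _ _ (S.rules r).inj (congrArg Prod.fst h)
      β_inj := fun _ _ h => AffGrp.map_injective _ _ (S.rules r).inj' (congrArg Prod.fst h) }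
  | .inr j =>
    { S := AffGrp (Unit → ℤ)
      α := (MonoidHom.inl _ _).comp (AffGrp.map (S.input n j) S.scale)
      β := (AffGrp.map (S.input n j) S.scale).prod (CtrlGrp.chi j)
      α_inj := fun _ _ h => AffGrp.map_injective _ _ S.scale_injective (congrArg Prod.fst h)
      β_inj := fun _ _ h => AffGrp.map_injective _ _ S.scale_injective (congrArg Prod.fst h) }

/-- The generators of the controlled part of the fibre. -/
def fibSet (n : ℕ) : Set CtrlGrp.Fib :=
  Set.range CtrlGrp.l ∪ {w | ∃ (j : Fin 3) (u : ℤ), S.input n (3 * u + (j : ℕ)) ∈ S.conn ∧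
    w = CtrlGrp.tw j u}

/-- The subgroup on which the last letter acts. -/
def baseSub (n : ℕ) : Subgroup (AffGrp (κ → ℤ) × CtrlGrp) :=
  (AffGrp.tSub S.conn).prod ((Subgroup.closure (S.fibSet n)).map CtrlGrp.inc)

theorem chi_mem (n : ℕ) (j : Fin 3) {L : Subgroup CtrlGrp}
    (hL : ∀ u : ℤ, S.input n (3 * u + (j : ℕ)) ∈ S.conn → CtrlGrp.inc (CtrlGrp.tw j u) ∈ L)
    (s : AffGrp (Unit → ℤ)) (hs : AffGrp.map (S.input n j) S.scale s ∈ AffGrp.tSub S.conn) :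
    CtrlGrp.chi j s ∈ L := by
  rw [AffGrp.map_mem_tSub _ _ S.scale_injective] at hs
  have : AffGrp.tSub ((fun u => S.input n j + S.scale u) ⁻¹' S.conn) ≤ L.comap (CtrlGrp.chi j) := by
    rw [AffGrp.tSub, Subgroup.closure_le]
    rintro _ ⟨u, hu, rfl⟩
    rw [Set.mem_preimage, input_add_scale] at hu
    change CtrlGrp.chi j _ ∈ L
    rw [CtrlGrp.chi_T]
    exact hL _ hu
  exact this hs

theorem compatible (n : ℕ) (i : R ⊕ Fin 3) : (S.letter n i).Compatible (S.baseSub n) := by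
  rcases i with r | j
  · intro s
    change _ ∧ _ ↔ _ ∧ _
    refine and_congr ?_ Iff.rfl
    have key : ∀ s, AffGrp.map (S.rules r).b (S.rules r).φ s ∈ AffGrp.tSub S.conn ↔
        AffGrp.map (S.rules r).c (S.rules r).ψ s ∈ AffGrp.tSub S.conn := by
      intro s
      have : (fun u => (S.rules r).b + (S.rules r).φ u) ⁻¹' S.conn =
        (fun u => (S.rules r).c + (S.rules r).ψ u) ⁻¹' S.conn := Set.ext fun w => S.conn_iff r w
      rw [AffGrp.map_mem_tSub _ _ (S.rules r).inj, AffGrp.map_mem_tSub _ _ (S.rules r).inj', this]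
    exact key s
  · intro s
    change _ ∧ _ ↔ _ ∧ _
    refine and_congr_right fun h => iff_of_true (one_mem _) ?_
    refine S.chi_mem n j (fun u hu => ?_) s h
    exact ⟨_, Subgroup.subset_closure (.inr ⟨j, u, hu, rfl⟩), rfl⟩

/-- The homomorphism defining the action of the last letter. -/
noncomputable def twist (n : ℕ) {D : Type} [Group D] (u : Fin 3 → D) : S.baseSub n →* D :=
  (CtrlGrp.retr u).comp (((MonoidHom.snd _ _).comp (Subgroup.subtype _)).codRestrict _ fun x => by
    obtain ⟨w, -, hw⟩ := (Subgroup.mem_prod.1 x.2).2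
    exact ⟨w, hw⟩)

theorem twist_eq (n : ℕ) {D : Type} [Group D] (u : Fin 3 → D) (x : S.baseSub n) (w : CtrlGrp.Fib)
    (h : (x : AffGrp (κ → ℤ) × CtrlGrp).2 = CtrlGrp.inc w) :
    S.twist n u x = CtrlGrp.fibLift u 1 w := by
  rw [← CtrlGrp.retr_inc u w ⟨w, rfl⟩]
  exact congrArg (CtrlGrp.retr u) (Subtype.ext h)

theorem twist_α (n : ℕ) {D : Type} [Group D] (u : Fin 3 → D) (i : R ⊕ Fin 3) (s) (h) :
    S.twist n u ⟨(S.letter n i).α s, h⟩ = 1 := by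
  rw [S.twist_eq n u _ 1, map_one]
  rw [map_one]
  rcases i with r | j <;> rfl

variable {n : ℕ} {m : ℤ → ℕ} (hS : S.Computes n m) {D : Type} [Group D] (u : Fin 3 → D)
  (hu : ∀ i, zElt (u 0) (u 1) (u 2) i ^ m i = 1)

include hS hu

theorem fibLift_tw (j : Fin 3) (i : ℤ) (h : S.input n (3 * i + (j : ℕ)) ∈ S.conn) :
    CtrlGrp.fibLift u 1 (CtrlGrp.tw j i) = 1 := by
  fin_cases j
  · obtain ⟨k, hk⟩ := hS.test0 i (by simpa using h)
    have := hu i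
    simp only [CtrlGrp.tw, Fin.zero_eta, Matrix.cons_val_zero, map_mul, map_zpow,
      CtrlGrp.fibLift_f, CtrlGrp.fibLift_z, Pi.one_apply, one_mul]
    nth_rw 2 [hk]
    rw [zpow_mul, zpow_natCast, this, one_zpow]
  · have h1 := hS.test1 i h
    have := hu i
    rw [h1, pow_one] at this
    exact (CtrlGrp.fibLift_z _ _ _).trans this
  · exact CtrlGrp.fibLift_f _ _ _

theorem twist_β (i : R ⊕ Fin 3) (s) (h) : S.twist n u ⟨(S.letter n i).β s, h⟩ = 1 := by
  rcases i with r | j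
  · rw [S.twist_eq n u _ 1, map_one]
    rw [map_one]
    rfl
  · obtain ⟨w, hw, hw'⟩ := S.chi_mem n j (L := (CtrlGrp.fibLift u 1).ker.map CtrlGrp.inc)
      (fun i hi => ⟨_, S.fibLift_tw hS u hu j i hi, rfl⟩) s (Subgroup.mem_prod.1 h).1
    rw [S.twist_eq n u _ w hw'.symm]
    exact hw

end AffSystem

namespace AffSystem

variable {κ R : Type} [DecidableEq κ] (S : AffSystem κ R)

/-- The images of the letters of the presentation. -/
def model {D Q : Type} [Group D] [Group Q] (n : ℕ) (u : Fin 3 → D)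
    (a : AffGrp (κ → ℤ) × CtrlGrp →* Q) (b : D →* Q) (ρ : R ⊕ Fin 3 → Q) (k : Q) :
    PresGen κ R → Q
  | .t => a (AffGrp.T 0, 1)
  | .x i => a (AffGrp.X (Pi.single i 1), 1)
  | .ctrl i => a (1, CtrlGrp.gen i)
  | .tor i => b (u i)
  | .rule r => ρ (.inl r)
  | .test j => ρ (.inr j)
  | .k => k
  | .g => a (AffGrp.X (Pi.single S.s (n : ℤ)), 1)

variable {S}

theorem single_natCast (s : κ) (n : ℕ) :
    AffGrp.X (Pi.single s (n : ℤ) : κ → ℤ) = AffGrp.X (Pi.single s 1) ^ n := by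
  rw [AffGrp.X, AffGrp.X, ← map_pow, ← ofAdd_nsmul, ← Pi.single_smul]
  simp

theorem conj_single (n : ℕ) (j : Fin 3) :
    AffGrp.X (Pi.single S.s (n : ℤ)) * AffGrp.T (S.v0 + Pi.single S.α ((j : ℕ) : ℤ)) *
      (AffGrp.X (Pi.single S.s (n : ℤ)))⁻¹ = AffGrp.T (S.input n (j : ℕ)) := by
  rw [AffGrp.conj_T, input]
  congr 1
  abel

variable [Fintype κ]

theorem holds_model {D Q : Type} [Group D] [Group Q] {n : ℕ} {u : Fin 3 → D}
    {a : AffGrp (κ → ℤ) × CtrlGrp →* Q} {b : D →* Q} {ρ : R ⊕ Fin 3 → Q} {k : Q}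
    (h : TwistRel (S.letter n) (S.twist n u) a b ρ k) :
    S.Holds n (S.model n u a b ρ k) := by
  set e := S.model n u a b ρ k with he
  have haff : ∀ y, PresRel.aff e y = a (y, 1) := fun y =>
    (AffGrp.map_eq_eval (a.comp (MonoidHom.inl _ _)) y).symm
  have hx : ∀ i : Option κ, ∃ y, e (i.elim .t .x) = a (y, 1) := by
    rintro (_ | i) <;> exact ⟨_, rfl⟩
  refine ⟨fun p => ?_, ?_⟩
  · cases p with
    | xx i j =>
      change a _ * a _ = a _ * a _
      rw [← map_mul, ← map_mul, Prod.mk_mul_mk, AffGrp.X_comm, Prod.mk_mul_mk]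
    | ctrl i =>
      have hr := CtrlGrp.gen_rel
      let f := a.comp (MonoidHom.inr _ _)
      have hv : ∀ j, e (.ctrl j) = f (CtrlGrp.gen j) := fun _ => rfl
      simp only [PresRel.sides, hv, ← map_zElt, ← map_mul, ← map_inv]
      fin_cases i
      exacts [congrArg f hr.xy, congrArg f hr.xc, congrArg f hr.xd, congrArg f hr.xe,
        congrArg f hr.yc, congrArg f hr.yd, congrArg f hr.ye, congrArg f hr.yf]
    | affCtrl i j =>
      obtain ⟨y, hy⟩ := hx i
      change e _ * a (1, _) = a (1, _) * e _
      rw [hy]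
      exact ((MonoidHom.commute_inl_inr _ _).map a).eq
    | affTor i j =>
      obtain ⟨y, hy⟩ := hx i
      change e _ * b _ = b _ * e _
      rw [hy]
      exact h.comm _ _
    | ctrlTor i j => exact h.comm _ _
    | ruleT r =>
      have := h.rel (.inl r) (AffGrp.T (0 : (S.rules r).dim → ℤ))
      change ρ _ * a (AffGrp.map _ _ _, 1) = a (AffGrp.map _ _ _, 1) * ρ _ at this
      rw [AffGrp.map_T, AffGrp.map_T, map_zero, map_zero, add_zero, add_zero] at this
      change ρ _ * PresRel.aff e _ = PresRel.aff e _ * ρ _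
      rw [haff, haff, this]
    | ruleX p =>
      have := h.rel (.inl p.1) (AffGrp.X (Pi.single p.2 1 : (S.rules p.1).dim → ℤ))
      change ρ _ * a (AffGrp.map _ _ _, 1) = a (AffGrp.map _ _ _, 1) * ρ _ at this
      rw [AffGrp.map_X, AffGrp.map_X] at this
      change ρ _ * PresRel.aff e _ = PresRel.aff e _ * ρ _
      rw [haff, haff, this]
    | testT j =>
      have := h.rel (.inr j) (AffGrp.T (0 : Unit → ℤ))
      change ρ _ * a (AffGrp.map _ _ _, 1) = a (AffGrp.map _ _ _, CtrlGrp.chi j _) * ρ _ at this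
      rw [AffGrp.map_T, map_zero, add_zero, CtrlGrp.chi_T_zero] at this
      change ρ _ * (a _ * PresRel.aff e _ * (a _)⁻¹) =
        a _ * PresRel.aff e _ * (a _)⁻¹ * testT (fun i => a.comp (MonoidHom.inr _ _) _) j * ρ _
      rw [haff, ← map_testT, MonoidHom.comp_apply, MonoidHom.inr_apply, ← map_inv, ← map_mul,
        ← map_mul, ← map_mul]
      simpa [conj_single] using this
    | testX j =>
      have := h.rel (.inr j) (AffGrp.X (Pi.single () 1 : Unit → ℤ))
      change ρ _ * a (AffGrp.map _ _ _, 1) = a (AffGrp.map _ _ _, CtrlGrp.chi j _) * ρ _ at this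
      rw [AffGrp.map_X, CtrlGrp.chi_X] at this
      change ρ _ * PresRel.aff e _ =
        PresRel.aff e _ * testX (fun i => a.comp (MonoidHom.inr _ _) _) j * ρ _
      rw [haff, ← map_testX, MonoidHom.comp_apply, MonoidHom.inr_apply, ← map_mul]
      simpa using this
    | kT =>
      have hm : (AffGrp.T S.vfin, 1) ∈ S.baseSub n := by
        refine Subgroup.mem_prod.2 ⟨Subgroup.subset_closure ⟨_, ?_, rfl⟩, one_mem _⟩
        exact Relation.EqvGen.refl _
      have := h.twist ⟨_, hm⟩
      rw [S.twist_eq n u _ 1 (map_one _).symm, map_one, map_one, mul_one] at this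
      change k * PresRel.aff e _ = PresRel.aff e _ * k
      rw [haff, this]
    | kRule r => exact h.comm_letter _
    | kTest j => exact h.comm_letter _
    | kCtrl j =>
      have hj : CtrlGrp.gen (j.castLE (by decide)) = CtrlGrp.inc (CtrlGrp.l j) := by
        fin_cases j <;> rfl
      have hm : ((1 : AffGrp (κ → ℤ)), CtrlGrp.inc (CtrlGrp.l j)) ∈ S.baseSub n :=
        Subgroup.mem_prod.2 ⟨one_mem _, _, Subgroup.subset_closure (.inl ⟨j, rfl⟩), rfl⟩
      have := h.twist ⟨_, hm⟩
      rw [S.twist_eq n u _ _ rfl, CtrlGrp.fibLift_l] at this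
      change k * a (1, CtrlGrp.gen _) = a (1, CtrlGrp.gen _) * b (u j) * k
      rw [hj]
      exact this
  · change a _ = a (_, 1) ^ n
    rw [← map_pow, single_natCast, Prod.pow_mk, one_pow]

theorem closure_model {D Q : Type} [Group D] [Group Q] {n : ℕ} {u : Fin 3 → D}
    {a : AffGrp (κ → ℤ) × CtrlGrp →* Q} {b : D →* Q} {ρ : R ⊕ Fin 3 → Q} {k : Q}
    (hu : Subgroup.closure (Set.range u) = ⊤)
    (h : Subgroup.closure (Set.range a ∪ Set.range b ∪ Set.range ρ ∪ {k}) = ⊤) :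
    Subgroup.closure (Set.range (S.model n u a b ρ k)) = ⊤ := by
  set L := Subgroup.closure (Set.range (S.model n u a b ρ k)) with hL
  have hg : ∀ p, S.model n u a b ρ k p ∈ L := fun p => Subgroup.subset_closure ⟨p, rfl⟩
  have h1 : ∀ x, a (x, 1) ∈ L := by
    have : (⊤ : Subgroup (AffGrp (κ → ℤ))) ≤ L.comap (a.comp (MonoidHom.inl _ _)) := by
      rw [← AffGrp.closure_gen, Subgroup.closure_le]
      rintro _ (rfl | ⟨i, rfl⟩)
      exacts [hg .t, hg (.x i)]
    exact fun x => this (Subgroup.mem_top x)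
  have h2 : ∀ x, a (1, x) ∈ L := by
    have : (⊤ : Subgroup CtrlGrp) ≤ L.comap (a.comp (MonoidHom.inr _ _)) := by
      rw [← CtrlGrp.closure_gen, Subgroup.closure_le]
      rintro _ ⟨i, rfl⟩
      exact hg (.ctrl i)
    exact fun x => this (Subgroup.mem_top x)
  have h3 : ∀ x, b x ∈ L := by
    have : (⊤ : Subgroup D) ≤ L.comap b := by
      rw [← hu, Subgroup.closure_le]
      rintro _ ⟨i, rfl⟩
      exact hg (.tor i)
    exact fun x => this (Subgroup.mem_top x)
  rw [eq_top_iff, ← h, Subgroup.closure_le]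
  rintro _ (((⟨⟨x, y⟩, rfl⟩ | ⟨y, rfl⟩) | ⟨r | j, rfl⟩) | rfl)
  · have := mul_mem (h1 x) (h2 y)
    rwa [← map_mul, Prod.mk_mul_mk, mul_one, one_mul] at this
  exacts [h3 y, hg (.rule r), hg (.test j), hg .k]

end AffSystem

namespace AffSystem.Holds

open CtrlGrp (inc tw fibLift)

variable {κ R : Type} [Fintype κ] [DecidableEq κ] {S : AffSystem κ R} {n : ℕ} {m : ℤ → ℕ}
  {E : Type} [Group E] {e : PresGen κ R → E}

theorem ctrlRel (h : S.Holds n e) : CtrlRel fun i => e (.ctrl i) :=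
  ⟨h.rel (.ctrl 0), h.rel (.ctrl 1), h.rel (.ctrl 2), h.rel (.ctrl 3), h.rel (.ctrl 4),
    h.rel (.ctrl 5), h.rel (.ctrl 6), h.rel (.ctrl 7)⟩

theorem exists_homs (h : S.Holds n e) : ∃ (FK : AffGrp (κ → ℤ) →* E) (FN : CtrlGrp →* E),
    (∀ y, PresRel.aff e y = FK y) ∧ (FK (AffGrp.T 0) = e .t) ∧
    (∀ i, FK (AffGrp.X (Pi.single i 1)) = e (.x i)) ∧ (∀ i, FN (CtrlGrp.gen i) = e (.ctrl i)) ∧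
    ∀ x y, Commute (FK x) (FN y) := by
  obtain ⟨FK, ht, hx⟩ := AffGrp.exists_lift (e .t) (fun i => e (.x i)) fun i j => h.rel (.xx i j)
  obtain ⟨FN, hv⟩ := CtrlGrp.exists_lift h.ctrlRel
  refine ⟨FK, FN, fun y => ?_, ht, hx, hv,
    commute_of_closure AffGrp.closure_gen CtrlGrp.closure_gen _ _ ?_⟩
  · rw [AffGrp.map_eq_eval, ht]
    simp only [hx]
    rfl
  · rintro _ (rfl | ⟨i, rfl⟩) _ ⟨j, rfl⟩
    · rw [ht, hv]
      exact h.rel (.affCtrl none j)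
    · rw [hx, hv]
      exact h.rel (.affCtrl (some i) j)

section

variable {FK : AffGrp (κ → ℤ) →* E} {FN : CtrlGrp →* E} (h : S.Holds n e)
  (haff : ∀ y, PresRel.aff e y = FK y) (hv : ∀ i, FN (CtrlGrp.gen i) = e (.ctrl i))

include h haff

theorem rule_rel (r : R) (s) : e (.rule r) * FK (AffGrp.map (S.rules r).b (S.rules r).φ s) =
    FK (AffGrp.map (S.rules r).c (S.rules r).ψ s) * e (.rule r) := by
  refine conj_hom_ext AffGrp.closure_gen (f := FK.comp (AffGrp.map (S.rules r).b (S.rules r).φ))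
    (g := FK.comp (AffGrp.map (S.rules r).c (S.rules r).ψ)) ?_ s
  rintro _ (rfl | ⟨i, rfl⟩)
  · have := h.rel (.ruleT r)
    simp only [PresRel.sides, haff] at this
    simpa [AffGrp.map_T] using this
  · have := h.rel (.ruleX ⟨r, i⟩)
    simp only [PresRel.sides, haff] at this
    simpa [AffGrp.map_X] using this

theorem commute_T {v : κ → ℤ} (hv : v ∈ S.conn) : Commute (e .k) (FK (AffGrp.T v)) := by
  have key : ∀ {u v}, Relation.EqvGen S.Step u v →
      (Commute (e .k) (FK (AffGrp.T u)) ↔ Commute (e .k) (FK (AffGrp.T v))) := by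
    intro u v huv
    induction huv with
    | rel u v huv =>
      obtain ⟨r, w, rfl, rfl⟩ := huv
      have h1 := h.rule_rel haff r (AffGrp.T w)
      have h2 : Commute (e .k) (e (.rule r)) := h.rel (.kRule r)
      rw [AffGrp.map_T, AffGrp.map_T] at h1
      refine ⟨fun h3 => ?_, fun h3 => ?_⟩
      · rw [eq_mul_inv_of_mul_eq h1.symm]
        exact (h2.mul_right h3).mul_right h2.inv_right
      · rw [eq_inv_mul_of_mul_eq h1]
        exact h2.inv_right.mul_right (h3.mul_right h2)
    | refl u => rfl
    | symm u v _ ih => exact ih.symm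
    | trans u v w _ _ ih1 ih2 => exact ih1.trans ih2
  refine (key hv).1 ?_
  have := h.rel .kT
  simp only [PresRel.sides, haff] at this
  exact this

include hv

variable (hc : ∀ x y, Commute (FK x) (FN y))

theorem test_rel (hX : ∀ i, FK (AffGrp.X (Pi.single i 1)) = e (.x i)) (j : Fin 3) (s) :
    e (.test j) * FK (AffGrp.map (S.input n (j : ℕ)) S.scale s) =
      FK.noncommCoprod FN hc (AffGrp.map (S.input n (j : ℕ)) S.scale s, CtrlGrp.chi j s) *
        e (.test j) := by
  have hg : e .g = FK (AffGrp.X (Pi.single S.s (n : ℤ))) := by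
    rw [h.pow, single_natCast, map_pow, hX]
  refine conj_hom_ext AffGrp.closure_gen (f := FK.comp (AffGrp.map (S.input n (j : ℕ)) S.scale))
    (g := (FK.noncommCoprod FN hc).comp ((AffGrp.map (S.input n (j : ℕ)) S.scale).prod
      (CtrlGrp.chi j))) ?_ s
  rintro _ (rfl | ⟨i, rfl⟩)
  · have := h.rel (.testT j)
    simp only [PresRel.sides, haff, hg, ← map_inv, ← map_mul, conj_single, ← hv] at this
    rw [← map_testT] at this
    simpa [AffGrp.map_T, CtrlGrp.chi_T_zero] using this
  · obtain rfl : i = () := rfl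
    have := h.rel (.testX j)
    simp only [PresRel.sides, haff, ← hv] at this
    rw [← map_testX] at this
    simpa [AffGrp.map_X, CtrlGrp.chi_X] using this

include hc

theorem commute_tw (hX : ∀ i, FK (AffGrp.X (Pi.single i 1)) = e (.x i)) (j : Fin 3) (i : ℤ)
    (hi : S.input n (3 * i + (j : ℕ)) ∈ S.conn) : Commute (e .k) (FN (inc (tw j i))) := by
  have h1 := h.test_rel haff hv hc hX j (AffGrp.T fun _ => i)
  rw [AffGrp.map_T, input_add_scale, CtrlGrp.chi_T, MonoidHom.noncommCoprod_apply, mul_assoc] at h1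
  have h2 : Commute (e .k) (e (.test j)) := h.rel (.kTest j)
  have h3 := h.commute_T haff hi
  have h4 := eq_mul_inv_of_mul_eq (eq_inv_mul_of_mul_eq h1.symm)
  refine Eq.subst (motive := Commute (e .k)) h4.symm ?_
  exact (h3.inv_right.mul_right (h2.mul_right h3)).mul_right h2.inv_right

end

theorem exists_twistRel (h : S.Holds n e) (hS : S.Computes n m) {D : Type} [Group D]
    {u : Fin 3 → D} (hu : ∀ i, zElt (u 0) (u 1) (u 2) i ^ m i = 1)
    (hcl : Subgroup.closure (Set.range u) = ⊤)
    (hD : ∀ u' : Fin 3 → E, (∀ i, zElt (u' 0) (u' 1) (u' 2) i ^ m i = 1) →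
      ∃ f : D →* E, ∀ i, f (u i) = u' i) :
    ∃ a b ρ, TwistRel (S.letter n) (S.twist n u) a b ρ (e .k) ∧ S.model n u a b ρ (e .k) = e := by
  obtain ⟨FK, FN, haff, ht, hx, hv, hc⟩ := h.exists_homs
  set tor : Fin 3 → E := fun i => e (.tor i) with htor
  have hNt : ∀ y i, Commute (FN y) (tor i) := fun y i =>
    conj_hom_ext CtrlGrp.closure_gen (f := (MonoidHom.id E).comp FN) (g := FN) (e := tor i)
      (by
        rintro _ ⟨j, rfl⟩
        change tor i * FN _ = _
        rw [hv]
        exact (h.rel (.ctrlTor j i)).symm) y |>.symm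
  have hKt : ∀ y i, Commute (FK y) (tor i) := fun y i =>
    conj_hom_ext AffGrp.closure_gen (f := FK) (g := FK) (e := tor i)
      (by
        rintro _ (rfl | ⟨j, rfl⟩)
        · rw [ht]
          exact (h.rel (.affTor none i)).symm
        · rw [hx]
          exact (h.rel (.affTor (some j) i)).symm) y |>.symm
  have hNf : ∀ y w, Commute (FN y) (fibLift tor 1 w) := by
    intro y w
    have : fibLift tor 1 w ∈ Subgroup.centralizer {FN y} := by
      have hr : (fibLift tor (1 : ℤ → E)).range ≤ Subgroup.centralizer {FN y} := by
        rw [CtrlGrp.fibLift, FreeGroup.range_lift_eq_closure, Subgroup.closure_le]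
        rintro _ ⟨i | i, rfl⟩
        · exact Subgroup.mem_centralizer_singleton_iff.2 (hNt y i).eq.symm
        · exact one_mem _
      exact hr ⟨w, rfl⟩
    exact (Subgroup.mem_centralizer_singleton_iff.1 this).symm
  let P : CtrlGrp.Fib →* E := (FN.noncommCoprod (fibLift tor 1) hNf).comp (inc.prod (.id _))
  have hP : ∀ w, P w = FN (inc w) * fibLift tor 1 w := fun w => rfl
  let C : CtrlGrp.Fib →* E := (MulAut.conj (e .k)).toMonoidHom.comp (FN.comp inc)
  have hC : ∀ w, C w = e .k * FN (inc w) * (e .k)⁻¹ := fun w => rfl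
  have hCl : ∀ i, C (CtrlGrp.l i) = P (CtrlGrp.l i) := by
    intro i
    have := h.rel (.kCtrl i)
    simp only [PresRel.sides, ← hv] at this
    have hi : CtrlGrp.gen (i.castLE (by decide)) = CtrlGrp.inc (CtrlGrp.l i) := by
      fin_cases i <;> rfl
    rw [hi] at this
    rw [hC, hP, this, CtrlGrp.fibLift_l, mul_inv_cancel_right]
  have hCz : ∀ i, C (CtrlGrp.z i) = P (CtrlGrp.z i) := by
    intro i
    simp only [CtrlGrp.z, map_zElt, hCl]
  have hCt : ∀ (j : Fin 3) (i : ℤ), S.input n (3 * i + (j : ℕ)) ∈ S.conn →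
      C (tw j i) = FN (inc (tw j i)) := by
    intro j i hi
    rw [hC, (h.commute_tw haff hv hc hx j i hi).eq, mul_inv_cancel_right]
  have hz : ∀ i, zElt (tor 0) (tor 1) (tor 2) i ^ m i = 1 := by
    intro i
    rw [← CtrlGrp.fibLift_z tor 1]
    rcases hS.enough i with h0 | ⟨h1, h2⟩ | ⟨h1, h2, h3⟩
    · rw [h0, pow_zero]
    · have := (hCt 1 i h2).symm.trans (hCz i)
      rw [hP] at this
      rw [h1, pow_one]
      exact left_eq_mul.1 this
    · have h4 := hCt 0 i (by simpa using h2)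
      have h5 : C (CtrlGrp.f i) = FN (inc (CtrlGrp.f i)) := hCt 2 i h3
      have h6 : tw 0 i = CtrlGrp.f i * CtrlGrp.z i ^ i := rfl
      rw [h6, map_mul, map_mul, map_mul, h5, mul_left_cancel_iff, map_zpow, hCz, ← map_zpow, hP,
        mul_eq_left, map_zpow] at h4
      rw [← zpow_natCast, h1]
      exact h4
  obtain ⟨FD, hFD⟩ := hD tor hz
  have hFD' : ∀ w, fibLift tor 1 w = FD (fibLift u 1 w) := by
    have : fibLift tor 1 = FD.comp (fibLift u 1) := CtrlGrp.fib_ext (by simp [hFD]) (by simp)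
    exact fun w => DFunLike.congr_fun this w
  have hCP : Subgroup.closure (S.fibSet n) ≤ C.eqLocus P := by
    rw [Subgroup.closure_le]
    rintro _ (⟨i, rfl⟩ | ⟨j, i, hi, rfl⟩)
    · exact hCl i
    · change C _ = P _
      rw [hCt j i hi, hP, hFD', S.fibLift_tw hS u hu j i hi, map_one, mul_one]
  have hkT : AffGrp.tSub S.conn ≤ (Subgroup.centralizer {e .k}).comap FK := by
    rw [AffGrp.tSub, Subgroup.closure_le]
    rintro _ ⟨v, hv, rfl⟩
    exact Subgroup.mem_centralizer_singleton_iff.2 (h.commute_T haff hv).eq.symm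
  have hcD : ∀ x y, Commute (FK.noncommCoprod FN hc x) (FD y) := by
    rintro ⟨x, x'⟩ y
    refine Commute.mul_left ?_ ?_
    · refine commute_of_closure (Subgroup.closure_univ) hcl FK FD ?_ x y
      rintro x - _ ⟨i, rfl⟩
      rw [hFD]
      exact hKt x i
    · refine commute_of_closure (Subgroup.closure_univ) hcl FN FD ?_ x' y
      rintro x - _ ⟨i, rfl⟩
      rw [hFD]
      exact hNt x i
  refine ⟨FK.noncommCoprod FN hc, FD, Sum.elim (fun r => e (.rule r)) fun j => e (.test j),
    ⟨hcD, ?_, ?_, ?_⟩, ?_⟩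
  · rintro (r | j) s
    · have := h.rule_rel haff r s
      change e _ * (FK _ * FN 1) = FK _ * FN 1 * e _
      rw [map_one, mul_one, mul_one]
      exact this
    · have := h.test_rel haff hv hc hx j s
      change e _ * (FK _ * FN 1) = FK.noncommCoprod FN hc _ * e _
      rw [map_one, mul_one]
      exact this
  · rintro ⟨⟨x, y⟩, hxy⟩
    obtain ⟨hx, w, hw, rfl⟩ := Subgroup.mem_prod.1 hxy
    rw [S.twist_eq n u _ w rfl, ← hFD']
    have h1 := hCP hw
    change e .k * FN (inc w) * (e .k)⁻¹ = P w at h1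
    have h2 := Subgroup.mem_centralizer_singleton_iff.1 (hkT hx)
    change e .k * (FK x * FN (inc w)) = FK x * FN (inc w) * fibLift tor 1 w * e .k
    rw [mul_assoc (FK x), ← hP, ← h1, ← mul_assoc, ← h2]
    group
  · rintro (r | j)
    exacts [h.rel (.kRule r), h.rel (.kTest j)]
  · funext p
    cases p with
    | t => exact (congrArg₂ _ ht (map_one _)).trans (mul_one _)
    | x i => exact (congrArg₂ _ (hx i) (map_one _)).trans (mul_one _)
    | ctrl i => exact (congrArg₂ _ (map_one _) (hv i)).trans (one_mul _)
    | tor i => exact hFD i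
    | rule r => rfl
    | test j => rfl
    | k => rfl
    | g =>
      rw [h.pow, ← hx, ← map_pow, ← single_natCast]
      exact (congrArg _ (map_one _)).trans (mul_one _)

end AffSystem.Holds

/-- A group with the prescribed torsion satisfying the relations universally. -/
theorem AffSystem.exists_model {κ R : Type} [Fintype κ] [DecidableEq κ] [Finite R]
    (S : AffSystem κ R) {n : ℕ} {m : ℤ → ℕ} (hS : S.Computes n m) :
    ∃ (Q : Type) (_ : Group Q) (γ : PresGen κ R → Q), S.Holds n γ ∧
      Subgroup.closure (Set.range γ) = ⊤ ∧
      (∀ k ≠ 0, (∃ q : Q, orderOf q = k) ↔ ∃ i, ∃ g : ZMod (m i), addOrderOf g = k) ∧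
      ∀ {E : Type} [Group E] (e : PresGen κ R → E), S.Holds n e →
        ∃ F : Q →* E, ∀ p, F (γ p) = e p := by
  obtain ⟨D, _, c, d, e, hcl, hz, hord, hD⟩ := TorsionGroup.exists_group m
  set u : Fin 3 → D := ![c, d, e] with hu
  have hcl' : Subgroup.closure (Set.range u) = ⊤ := by
    rw [← hcl, hu]
    congr 1
    ext
    simp [eq_comm]
    tauto
  obtain ⟨Q, _, a, b, ρ, k, hrel, hQ, hQord, hF⟩ := exists_twist (S.letter n) (S.baseSub n)
    (S.compatible n) (S.twist n u) (fun i s h => S.twist_α n u i s h)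
    (fun i s h => S.twist_β hS u hz i s h)
  refine ⟨Q, _, S.model n u a b ρ k, holds_model hrel, closure_model hcl' hQ, fun k hk => ?_,
    fun e' he => ?_⟩
  · rw [hQord k hk, exists_orderOf_prod (AffGrp.torFree.prod CtrlGrp.torFree) hk, hord k hk]
  · obtain ⟨a', b', ρ', h1, h2⟩ := he.exists_twistRel hS hz hcl' fun u' hu' => by
      obtain ⟨f, h0, h1, h2⟩ := hD (u' 0) (u' 1) (u' 2) hu'
      refine ⟨f, fun i => ?_⟩
      fin_cases i
      exacts [h0, h1, h2]
    obtain ⟨F, f1, f2, f3, f4⟩ := hF a' b' ρ' _ h1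
    refine ⟨F, fun p => ?_⟩
    rw [← h2]
    cases p with
    | tor i => exact f2 _
    | rule r => exact f3 _
    | test j => exact f3 _
    | k => exact f4
    | _ => exact f1 _

theorem lift_mk_replicate {m : ℕ} {G : Type*} [Group G] (f : Fin m → G) (i : Fin m) (n : ℕ)
    (w : Word m) : FreeGroup.lift f (FreeGroup.mk (List.replicate n (i, true) ++ w)) =
      f i ^ n * FreeGroup.lift f (FreeGroup.mk w) := by
  simp [FreeGroup.lift_mk]

namespace AffSystem

variable {κ R : Type} [Fintype κ] [DecidableEq κ] [Finite R] (S : AffSystem κ R)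

/-- The numbering of the letters. -/
noncomputable def letterEquiv (κ R : Type) [Finite κ] [Finite R] :
    PresGen κ R ≃ Fin (Nat.card (PresGen κ R)) := Finite.equivFin _

/-- The relator words that do not depend on the input. -/
noncomputable def words : List (Word (Nat.card (PresGen κ R))) :=
  letI := Fintype.ofFinite (PresRel S)
  (Finset.univ : Finset (PresRel S)).toList.map fun p =>
    let q := p.sides fun a => FreeGroup.of (letterEquiv κ R a)
    (q.1 * q.2⁻¹).toWord

/-- The finite presentation for the exponent `n`. -/
noncomputable def pres (n : ℕ) : FinPres :=
  ⟨Nat.card (PresGen κ R), (List.replicate n (letterEquiv κ R (.x S.s), true) ++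
    [(letterEquiv κ R .g, false)]) :: S.words⟩

variable {S}

theorem lift_eq_one_iff {n : ℕ} {E : Type} [Group E] (e : PresGen κ R → E) :
    (∀ r ∈ (S.pres n).rels, FreeGroup.lift (e ∘ (letterEquiv κ R).symm) r = 1) ↔
      S.Holds n e := by
  set f := FreeGroup.lift (e ∘ (letterEquiv κ R).symm) with hf
  have hside : ∀ p : PresRel S, (f (p.sides fun a => FreeGroup.of (letterEquiv κ R a)).1,
      f (p.sides fun a => FreeGroup.of (letterEquiv κ R a)).2) = p.sides e := by
    intro p
    rw [PresRel.map_sides]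
    congr 1
    funext a
    simp [hf]
  have hs1 := fun p => congrArg Prod.fst (hside p)
  have hs2 := fun p => congrArg Prod.snd (hside p)
  simp only at hs1 hs2
  have hp : f (FreeGroup.mk (List.replicate n (letterEquiv κ R (.x S.s), true) ++
      [(letterEquiv κ R .g, false)])) = e (.x S.s) ^ n * (e .g)⁻¹ := by
    rw [hf, lift_mk_replicate]
    simp [FreeGroup.lift_mk]
  have hmem : ∀ r, r ∈ (S.pres n).rels ↔
      r = FreeGroup.mk (List.replicate n (letterEquiv κ R (.x S.s), true) ++
        [(letterEquiv κ R .g, false)]) ∨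
      ∃ p : PresRel S, r = (p.sides fun a => FreeGroup.of (letterEquiv κ R a)).1 *
        (p.sides fun a => FreeGroup.of (letterEquiv κ R a)).2⁻¹ := by
    intro r
    constructor
    · rintro ⟨w, hw, rfl⟩
      rcases List.mem_cons.1 hw with rfl | hw
      · exact .inl rfl
      · obtain ⟨p, -, rfl⟩ := List.mem_map.1 hw
        exact .inr ⟨p, FreeGroup.mk_toWord⟩
    · rintro (rfl | ⟨p, rfl⟩)
      · exact ⟨_, List.mem_cons_self, rfl⟩
      · exact ⟨_, List.mem_cons_of_mem _ (List.mem_map.2 ⟨p, by simp, rfl⟩),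
          FreeGroup.mk_toWord.symm⟩
  simp only [hmem]
  constructor
  · intro h
    refine ⟨fun p => ?_, ?_⟩
    · have := h _ (.inr ⟨p, rfl⟩)
      rwa [map_mul, map_inv, mul_inv_eq_one, hs1,
        hs2] at this
    · have := h _ (.inl rfl)
      rwa [hp, mul_inv_eq_one, eq_comm] at this
  · rintro h r (rfl | ⟨p, rfl⟩)
    · rw [hp, h.pow, mul_inv_cancel]
    · rw [map_mul, map_inv, mul_inv_eq_one, hs1,
        hs2, h.rel]

theorem exists_orderOf_pres {n : ℕ} {m : ℤ → ℕ} (hS : S.Computes n m) {k : ℕ} (hk : k ≠ 0) :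
    (∃ q : (S.pres n).Grp, orderOf q = k) ↔ ∃ i, ∃ g : ZMod (m i), addOrderOf g = k := by
  obtain ⟨Q, _, γ, hγ, hcl, hord, huniv⟩ := S.exists_model hS
  rw [← hord k hk]
  let Ψ : (S.pres n).Grp →* Q := PresentedGroup.toGroup ((lift_eq_one_iff γ).2 hγ)
  have hΨ : ∀ a, Ψ (PresentedGroup.of (letterEquiv κ R a)) = γ a := by
    intro a
    refine (PresentedGroup.toGroup.of ((lift_eq_one_iff γ).2 hγ)).trans ?_
    simp
  have hΦ : S.Holds n fun a => (PresentedGroup.of (letterEquiv κ R a) : (S.pres n).Grp) := by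
    refine (lift_eq_one_iff _).1 fun r hr => ?_
    have : FreeGroup.lift ((fun a => (PresentedGroup.of (letterEquiv κ R a) : (S.pres n).Grp)) ∘
        (letterEquiv κ R).symm) = PresentedGroup.mk _ := by
      refine FreeGroup.ext_hom _ _ fun i => ?_
      simp [PresentedGroup.of]
      rfl
    rw [this]
    exact PresentedGroup.one_of_mem hr
  obtain ⟨Φ, hΦ⟩ := huniv _ hΦ
  have h1 : Φ.comp Ψ = .id _ := by
    refine PresentedGroup.ext fun i => ?_
    obtain ⟨a, rfl⟩ := (letterEquiv κ R).surjective i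
    change Φ (Ψ _) = _
    rw [hΨ, hΦ]
    rfl
  have h2 : Ψ.comp Φ = .id _ := by
    refine MonoidHom.eq_of_eqOn_dense hcl ?_
    rintro _ ⟨a, rfl⟩
    change Ψ (Φ _) = _
    rw [hΦ, hΨ]
    rfl
  let e : (S.pres n).Grp ≃* Q := Ψ.toMulEquiv Φ h1 h2
  refine ⟨fun ⟨q, hq⟩ => ⟨e q, by rw [e.orderOf_eq, hq]⟩,
    fun ⟨q, hq⟩ => ⟨e.symm q, by rw [e.symm.orderOf_eq, hq]⟩⟩

theorem encode_append {A : Type} [Encodable A] (x : A) (n : ℕ) (t : List A) :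
    Encodable.encode (List.replicate n x ++ t) =
      Nat.rec (Encodable.encode t) (fun _ r => (Nat.pair (Encodable.encode x) r).succ) n := by
  induction n with
  | zero => rfl
  | succ n ih => rw [List.replicate_succ, List.cons_append, Encodable.encode_list_cons, ih]

variable (S) in
theorem computable_encode_pres {E : ℕ → ℕ} (hE : Computable E) :
    Computable fun N => Encodable.encode (S.pres (E N)) := by
  have : ∀ n, Encodable.encode (S.pres n) = Nat.pair (Nat.card (PresGen κ R)) (Nat.pair
      (Nat.rec (Encodable.encode [(letterEquiv κ R .g, false)])
        (fun _ r => (Nat.pair (Encodable.encode (letterEquiv κ R (.x S.s), true)) r).succ) n)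
      (Encodable.encode S.words)).succ := by
    intro n
    rw [pres, Encodable.encode_sigma_val, Encodable.encode_list_cons, encode_append]
    rfl
  have h : Primrec fun n => Encodable.encode (S.pres n) := by
    simp only [this]
    refine Primrec₂.natPair.comp (Primrec.const _) (Primrec.succ.comp
      (Primrec₂.natPair.comp ?_ (Primrec.const _)))
    exact Primrec.nat_rec₁ _ (Primrec.succ.comp (Primrec₂.natPair.comp (Primrec.const _)
      Primrec.snd))
  exact h.to_comp.comp hE

end AffSystem

section Primes

theorem primrecPred_prime : PrimrecPred Nat.Prime := by
  have h1 : PrimrecRel fun x y : ℕ => x < 2 ∨ ¬ y % x = 0 :=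
    (Primrec.nat_lt.comp .fst (.const 2)).or
      (Primrec.eq.comp (Primrec.nat_mod.comp .snd .fst) (.const 0)).not
  have h2 : PrimrecPred fun n => 2 ≤ n ∧ ∀ x < n, x < 2 ∨ ¬ n % x = 0 :=
    (Primrec.nat_le.comp (.const 2) .id).and (h1.forall_lt.comp .id .id)
  refine h2.of_eq fun n => ?_
  rw [Nat.prime_def_lt']
  refine and_congr_right fun _ => ⟨fun h m hm hmn hd => ?_, fun h x hx => ?_⟩
  · have := h m hmn
    have := Nat.mod_eq_zero_of_dvd hd
    omega
  · by_cases h2 : x < 2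
    · exact .inl h2
    · exact .inr fun h0 => h x (by omega) hx (Nat.dvd_of_mod_eq_zero h0)

theorem primrec_count_prime : Primrec (Nat.count Nat.Prime) := by
  have : Primrec fun n => Nat.rec (motive := fun _ => ℕ) 0
      (fun k r => r + if Nat.Prime k then 1 else 0) n :=
    Primrec.nat_rec₁ _ (Primrec.nat_add.comp .snd
      (Primrec.ite (primrecPred_prime.comp .fst) (.const 1) (.const 0)))
  refine this.of_eq fun n => ?_
  induction n with
  | zero => simp
  | succ n ih => rw [Nat.count_succ, ← ih]

theorem computable_nth_prime : Computable (Nat.nth Nat.Prime) := by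
  have h : PrimrecRel fun j n : ℕ => Nat.Prime n ∧ Nat.count Nat.Prime n = j :=
    (primrecPred_prime.comp .snd).and (Primrec.eq.comp (primrec_count_prime.comp .snd) .fst)
  have h2 : Partrec fun j => Nat.rfind fun n =>
      Part.some (decide (Nat.Prime n ∧ Nat.count Nat.Prime n = j)) :=
    Partrec.rfind (p := fun j n => Part.some (decide (Nat.Prime n ∧ Nat.count Nat.Prime n = j)))
      (Computable.partrec h.decide.to_comp)
  refine h2.of_eq fun j => ?_
  obtain ⟨n, hn, -⟩ := Nat.rfind_min'
    (p := fun n => decide (Nat.Prime n ∧ Nat.count Nat.Prime n = j)) (m := Nat.nth Nat.Prime j)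
    (decide_eq_true ⟨Nat.prime_nth_prime j,
      Nat.count_nth_of_infinite Nat.infinite_setOfPred_prime j⟩)
  have h1 := Nat.rfind_spec hn
  have h3 : Nat.Prime n ∧ Nat.count Nat.Prime n = j := by simpa using h1
  have h4 : n = Nat.nth Nat.Prime j := by rw [← h3.2, Nat.nth_count h3.1]
  exact Part.eq_some_iff.2 (h4 ▸ hn)

end Primes

/-- The condition recognised by the machine. -/
def Passes (a N : ℕ) : Prop :=
  a % 3 = 1 → Nat.Prime (a / 3) → Nat.count Nat.Prime (a / 3) ∈ W N

theorem rePred_passes : REPred fun p : ℕ × ℕ => Passes p.1 p.2 := by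
  have hd : PrimrecPred fun a : ℕ => a % 3 = 1 ∧ Nat.Prime (a / 3) :=
    (Primrec.eq.comp (Primrec.nat_mod.comp .id (.const 3)) (.const 1)).and
      (primrecPred_prime.comp (Primrec.nat_div.comp .id (.const 3)))
  have h : Partrec fun p : ℕ × ℕ => cond (decide (p.1 % 3 = 1 ∧ Nat.Prime (p.1 / 3)))
      ((Denumerable.ofNat Nat.Partrec.Code p.2).eval (Nat.count Nat.Prime (p.1 / 3)))
      (Part.some 0) := by
    refine Partrec.cond (hd.decide.to_comp.comp .fst) ?_ (Computable.const 0).partrec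
    exact Nat.Partrec.Code.eval_part.comp ((Computable.ofNat _).comp .snd)
      (primrec_count_prime.to_comp.comp (Primrec.nat_div.comp .fst (.const 3)).to_comp)
  refine h.dom_re.of_eq fun p => ?_
  by_cases hp : p.1 % 3 = 1 ∧ Nat.Prime (p.1 / 3)
  · rw [decide_eq_true hp]
    exact ⟨fun h _ _ => h, fun h => h hp.1 hp.2⟩
  · rw [decide_eq_false hp]
    exact ⟨fun _ h1 h2 => (hp ⟨h1, h2⟩).elim, fun _ => trivial⟩

open Classical in
/-- The orders of the cyclic factors. -/
noncomputable def torsionOrder (N : ℕ) (i : ℤ) : ℕ :=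
  if i < 0 then 0 else
    if Nat.Prime i.toNat ∧ Nat.count Nat.Prime i.toNat ∉ W N then i.toNat else 1

theorem torsionOrder_of_neg (N : ℕ) {i : ℤ} (h : i < 0) : torsionOrder N i = 0 := if_pos h

theorem torsionOrder_prime {N : ℕ} {i : ℤ} (h0 : 0 ≤ i) (h : Nat.Prime i.toNat)
    (h' : Nat.count Nat.Prime i.toNat ∉ W N) : torsionOrder N i = i.toNat := by
  rw [torsionOrder, if_neg h0.not_gt, if_pos ⟨h, h'⟩]

theorem torsionOrder_of_imp {N : ℕ} {i : ℤ} (h0 : 0 ≤ i)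
    (h : Nat.Prime i.toNat → Nat.count Nat.Prime i.toNat ∈ W N) : torsionOrder N i = 1 := by
  rw [torsionOrder, if_neg h0.not_gt, if_neg]
  exact fun ⟨h1, h2⟩ => h2 (h h1)

theorem exists_addOrderOf_torsionOrder (N : ℕ) {k : ℕ} (hk : 2 ≤ k) :
    (∃ i, ∃ g : ZMod (torsionOrder N i), addOrderOf g = k) ↔
      ∃ j, j ∉ W N ∧ k = Nat.nth Nat.Prime j := by
  constructor
  · rintro ⟨i, g, hg⟩
    have h1 : torsionOrder N i ≠ 1 := fun h => by
      have : Subsingleton (ZMod (torsionOrder N i)) := by rw [h]; infer_instance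
      rw [Subsingleton.elim g 0, addOrderOf_zero] at hg
      omega
    have h0 : torsionOrder N i ≠ 0 := fun h => by
      have : IsAddTorsionFree (ZMod (torsionOrder N i)) := by
        rw [h]; exact inferInstanceAs (IsAddTorsionFree ℤ)
      have hf : IsOfFinAddOrder g := addOrderOf_pos_iff.1 (by omega)
      rw [hf.eq_zero', addOrderOf_zero] at hg
      omega
    have hi : 0 ≤ i := not_lt.1 fun h => h0 (torsionOrder_of_neg N h)
    by_cases h : Nat.Prime i.toNat → Nat.count Nat.Prime i.toNat ∈ W N
    · exact absurd (torsionOrder_of_imp hi h) h1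
    · push Not at h
      have h2 : addOrderOf g ∣ torsionOrder N i :=
        addOrderOf_dvd_of_nsmul_eq_zero (by simp)
      rw [hg, torsionOrder_prime hi h.1 h.2] at h2
      refine ⟨_, h.2, ?_⟩
      rw [Nat.nth_count h.1]
      exact (h.1.eq_one_or_self_of_dvd k h2).resolve_left (by omega)
  · rintro ⟨j, hj, rfl⟩
    refine ⟨(Nat.nth Nat.Prime j : ℕ), ?_⟩
    rw [torsionOrder_prime (by positivity) (by simp)
      (by simpa [Nat.count_nth_of_infinite Nat.infinite_setOfPred_prime] using hj)]
    exact ⟨1, by rw [ZMod.addOrderOf_one, Int.toNat_natCast]⟩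

namespace AffSystem

variable {κ R : Type} [DecidableEq κ] {S : AffSystem κ R} {n N : ℕ}

theorem computes_torsionOrder
    (h : ∀ a : ℤ, S.input n a ∈ S.conn ↔ 0 ≤ a ∧ Passes a.toNat N) :
    S.Computes n (torsionOrder N) := by
  refine ⟨fun u hu => ?_, fun u hu => ?_, fun u => ?_⟩
  · have h0 : 0 ≤ u := by have := ((h _).1 hu).1; omega
    by_cases hp : Nat.Prime u.toNat → Nat.count Nat.Prime u.toNat ∈ W N
    · simp [torsionOrder_of_imp h0 hp]
    · push Not at hp
      rw [torsionOrder_prime h0 hp.1 hp.2, Int.toNat_of_nonneg h0]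
  · obtain ⟨h1, h2⟩ := (h _).1 hu
    have h0 : 0 ≤ u := by omega
    refine torsionOrder_of_imp h0 fun hp => ?_
    have h3 : (3 * u + 1).toNat / 3 = u.toNat := by omega
    have := h2 (by omega)
    rw [h3] at this
    exact this hp
  · rcases lt_or_ge u 0 with h0 | h0
    · exact .inl (torsionOrder_of_neg N h0)
    · by_cases hp : Nat.Prime u.toNat → Nat.count Nat.Prime u.toNat ∈ W N
      · refine .inr (.inl ⟨torsionOrder_of_imp h0 hp, (h _).2 ⟨by omega, fun _ => ?_⟩⟩)
        rwa [show (3 * u + 1).toNat / 3 = u.toNat by omega]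
      · push Not at hp
        refine .inr (.inr ⟨?_, (h _).2 ⟨by omega, fun h1 => by omega⟩,
          (h _).2 ⟨by omega, fun h1 => by omega⟩⟩)
        rw [torsionOrder_prime h0 hp.1 hp.2, Int.toNat_of_nonneg h0]

theorem torOrd_pres [Fintype κ] [Finite R]
    (h : ∀ a : ℤ, S.input n a ∈ S.conn ↔ 0 ≤ a ∧ Passes a.toNat N) :
    TorOrd (S.pres n).Grp = {p | ∃ j, j ∉ W N ∧ p = Nat.nth Nat.Prime j} := by
  ext k
  constructor
  · rintro ⟨hk, hq⟩
    exact (exists_addOrderOf_torsionOrder N hk).1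
      ((exists_orderOf_pres (computes_torsionOrder h) (by omega)).1 hq)
  · rintro ⟨j, hj, rfl⟩
    have hk := (Nat.prime_nth_prime j).two_le
    exact ⟨hk, (exists_orderOf_pres (computes_torsionOrder h) (by omega)).2
      ((exists_addOrderOf_torsionOrder N hk).2 ⟨j, hj, rfl⟩)⟩

end AffSystem

theorem not_partrec_of_not_computablePred {n : ℕ} {A : Set ℕ}
    (hA : A = {p | ∃ j, j ∉ W n ∧ p = Nat.nth Nat.Prime j})
    (hn : ¬ ComputablePred (· ∈ W n)) :
    ¬ ∃ g : ℕ →. ℕ, Nat.Partrec g ∧ ∀ x, (g x).Dom ↔ x ∈ A := by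
  rintro ⟨g, hg, hgA⟩
  refine hn (ComputablePred.computable_iff_re_compl_re'.2 ⟨?_, ?_⟩)
  · exact (Nat.Partrec.Code.eval_part.comp (.const _) .id).dom_re
  · refine ((Partrec.nat_iff.2 hg).comp computable_nth_prime).dom_re.of_eq fun j => ?_
    rw [hgA, hA]
    refine ⟨fun ⟨i, hi, hij⟩ => ?_, fun hj => ⟨j, hj, rfl⟩⟩
    rwa [Nat.nth_injective Nat.infinite_setOfPred_prime hij]

/-- A machine with integer registers: a state reads a register modulo five and replaces it by an
affine function of the quotient. -/
structure RegMachine (Q K : Type) where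
  /-- the register used by a state, and the next state and coefficients for every residue -/
  instr : Q → Option (K × (ℤ → Q × ℤ × ℤ))
  ne_zero : ∀ q k f r, instr q = some (k, f) → (f r).2.1 ≠ 0

namespace RegMachine

open StateTransition Function

variable {Q K : Type} [DecidableEq K] (M : RegMachine Q K)

/-- The new registers. -/
def act (k : K) (p : Q × ℤ × ℤ) (Z : K → ℤ) : K → ℤ :=
  update Z k (p.2.1 * (Z k / 5) + p.2.2)

/-- One step of the machine. -/
def step (c : Q × (K → ℤ)) : Option (Q × (K → ℤ)) :=
  (M.instr c.1).map fun i => ((i.2 (c.2 i.1 % 5)).1, act i.1 (i.2 (c.2 i.1 % 5)) c.2)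

variable {M} in
theorem step_of_instr {q : Q} {k f} (h : M.instr q = some (k, f)) (Z : K → ℤ) :
    M.step (q, Z) = some ((f (Z k % 5)).1, act k (f (Z k % 5)) Z) := by
  simp [step, h]

/-- The point with given state, counter and registers. -/
def pt (q a : ℤ) (Z : K → ℤ) : Option (Option K) → ℤ := fun o => o.elim q fun p => p.elim a Z

omit [DecidableEq K] in
theorem pt_add (q a q' a' : ℤ) (Z Z' : K → ℤ) :
    pt q a Z + pt q' a' Z' = pt (q + q') (a + a') (Z + Z') := by
  funext o; rcases o with _ | _ | k <;> rfl

omit [DecidableEq K] in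
theorem pt_inj {q a q' a' : ℤ} {Z Z' : K → ℤ} (h : pt q a Z = pt q' a' Z') :
    q = q' ∧ a = a' ∧ Z = Z' :=
  ⟨congrFun h none, congrFun h (some none), funext fun k => congrFun h (some (some k))⟩

/-- Scaling of the registers. -/
def regHom (e : K → ℤ) : (K → ℤ) →+ (Option (Option K) → ℤ) where
  toFun w := pt 0 0 (e * w)
  map_zero' := by rw [mul_zero]; funext o; rcases o with _ | _ | k <;> rfl
  map_add' w w' := by rw [pt_add, mul_add, add_zero]

/-- Scaling of the registers, keeping the counter. -/
def countHom (e : K → ℤ) : (Option K → ℤ) →+ (Option (Option K) → ℤ) where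
  toFun w := pt 0 (w none) (e * fun k => w (some k))
  map_zero' := by funext o; rcases o with _ | _ | k <;> simp [pt]
  map_add' w w' := by
    rw [pt_add, ← mul_add, add_zero]
    rfl

omit [DecidableEq K] in
theorem regHom_injective {e : K → ℤ} (he : ∀ k, e k ≠ 0) : Injective (regHom e) := by
  intro w w' h
  funext k
  exact mul_left_cancel₀ (he k) (congrFun (pt_inj h).2.2 k)

omit [DecidableEq K] in
theorem countHom_injective {e : K → ℤ} (he : ∀ k, e k ≠ 0) : Injective (countHom e) := by
  intro w w' h
  funext o
  cases o with
  | none => exact (pt_inj h).2.1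
  | some k => exact mul_left_cancel₀ (he k) (congrFun (pt_inj h).2.2 k)

/-- The scaling factor in a single register. -/
def coeff (k : K) (c : ℤ) : K → ℤ := update 1 k c

theorem coeff_ne_zero {k : K} {c : ℤ} (hc : c ≠ 0) (j : K) : coeff k c j ≠ 0 := by
  by_cases h : j = k
  · subst h; simpa [coeff]
  · simp [coeff, h]

theorem single_add_coeff (k : K) (c d : ℤ) (w : K → ℤ) :
    Pi.single k d + coeff k c * w = update w k (c * w k + d) := by
  funext j
  by_cases h : j = k
  · subst h; simp [coeff, add_comm]
  · simp [coeff, h]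

/-- Pushing the digit four. -/
def push (k : K) (Z : K → ℤ) : K → ℤ := update Z k (5 * Z k + 4)

theorem push_injective (k : K) : Injective (push k) := by
  intro Z Z' h
  funext j
  have h1 := congrFun h j
  by_cases hj : j = k
  · subst hj
    simp only [push, update_self] at h1
    omega
  · simpa [push, hj] using h1

variable [Fintype K] (ι : Q → ℤ) (k₀ : K) (q₀ : Q)

/-- The rule loading the machine. -/
def loadRule : AffRule (Option (Option K)) where
  dim := Option K
  b := pt (-1) 0 0
  c := pt (-1) (-1) (Pi.single k₀ 4)
  φ := countHom 1
  ψ := countHom (coeff k₀ 5)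
  inj := countHom_injective (by simp)
  inj' := countHom_injective (coeff_ne_zero (by norm_num))

/-- The rule starting the machine. -/
def startRule : AffRule (Option (Option K)) where
  dim := K
  b := pt (-1) 0 0
  c := pt (ι q₀) 0 0
  φ := regHom 1
  ψ := regHom 1
  inj := regHom_injective (by simp)
  inj' := regHom_injective (by simp)

/-- The rule executing an instruction. -/
def stepRule (q : Q) (k : K) (r : ℤ) (p : Q × ℤ × ℤ) (hp : p.2.1 ≠ 0) :
    AffRule (Option (Option K)) where
  dim := K
  b := pt (ι q) 0 (Pi.single k r)
  c := pt (ι p.1) 0 (Pi.single k p.2.2)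
  φ := regHom (coeff k 5)
  ψ := regHom (coeff k p.2.1)
  inj := regHom_injective (coeff_ne_zero (by norm_num))
  inj' := regHom_injective (coeff_ne_zero hp)

variable (T : Set Q) (qf : Q) (Zf : K → ℤ)

/-- The relation defined by a rule. -/
def _root_.AffRule.Rel {κ : Type} (r : AffRule κ) (u v : κ → ℤ) : Prop :=
  ∃ w, u = r.b + r.φ w ∧ v = r.c + r.ψ w

theorem rel_loadRule {u v} : (loadRule k₀).Rel u v ↔
    ∃ a Z, u = pt (-1) a Z ∧ v = pt (-1) (a - 1) (push k₀ Z) := by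
  have h (w : Option K → ℤ) : (loadRule k₀).b + (loadRule k₀).φ w =
      pt (-1) (w none) (fun k => w (some k)) ∧ (loadRule k₀).c + (loadRule k₀).ψ w =
      pt (-1) (w none - 1) (push k₀ fun k => w (some k)) := by
    constructor
    · exact (pt_add _ _ _ _ _ _).trans (by simp)
    · refine (pt_add _ _ _ _ _ _).trans ?_
      rw [single_add_coeff, push, add_zero, neg_add_eq_sub]
  constructor
  · rintro ⟨w, rfl, rfl⟩
    exact ⟨_, _, h w⟩
  · rintro ⟨a, Z, rfl, rfl⟩
    exact ⟨_, (h fun o => o.elim a Z).1.symm, (h fun o => o.elim a Z).2.symm⟩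

theorem rel_startRule {u v} : (startRule ι q₀).Rel u v ↔
    ∃ Z : K → ℤ, u = pt (-1) 0 Z ∧ v = pt (ι q₀) 0 Z := by
  have h (w : K → ℤ) : (startRule ι q₀).b + (startRule ι q₀).φ w = pt (-1) 0 w ∧
      (startRule ι q₀).c + (startRule ι q₀).ψ w = pt (ι q₀) 0 w :=
    ⟨(pt_add _ _ _ _ _ _).trans (by simp), (pt_add _ _ _ _ _ _).trans (by simp)⟩
  constructor
  · rintro ⟨w, rfl, rfl⟩
    exact ⟨_, h w⟩
  · rintro ⟨Z, rfl, rfl⟩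
    exact ⟨Z, (h _).1.symm, (h _).2.symm⟩

theorem rel_stepRule {q : Q} {k : K} {r : ℤ} (h0 : 0 ≤ r) (h5 : r < 5) {p : Q × ℤ × ℤ}
    (hp : p.2.1 ≠ 0) {u v} : (stepRule ι q k r p hp).Rel u v ↔
      ∃ Z : K → ℤ, Z k % 5 = r ∧ u = pt (ι q) 0 Z ∧ v = pt (ι p.1) 0 (act k p Z) := by
  have h (w : K → ℤ) : (stepRule ι q k r p hp).b + (stepRule ι q k r p hp).φ w =
      pt (ι q) 0 (update w k (5 * w k + r)) ∧
      (stepRule ι q k r p hp).c + (stepRule ι q k r p hp).ψ w =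
      pt (ι p.1) 0 (update w k (p.2.1 * w k + p.2.2)) := by
    constructor <;>
    · refine (pt_add _ _ _ _ _ _).trans ?_
      rw [single_add_coeff, add_zero, add_zero]
  constructor
  · rintro ⟨(w : K → ℤ), rfl, rfl⟩
    refine ⟨_, ?_, (h w).1, (h w).2.trans ?_⟩
    · rw [update_self]; omega
    · rw [act, update_self, update_idem, show (5 * w k + r) / 5 = w k by omega]
  · rintro ⟨Z, hZ, rfl, rfl⟩
    obtain ⟨h1, h2⟩ := h (update Z k (Z k / 5))
    rw [update_self, update_idem] at h1 h2
    refine ⟨_, (h1.trans ?_).symm, (h2.trans ?_).symm⟩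
    · rw [show 5 * (Z k / 5) + r = Z k by omega, update_eq_self]
    · rw [act]

/-- The rules of a machine with states restricted to `T`. -/
noncomputable def toRule (o : Option (Option (T × Fin 5))) : AffRule (Option (Option K)) :=
  o.elim (loadRule k₀) fun p => p.elim (startRule ι q₀) fun x =>
    if h : (M.instr x.1).isSome then
      stepRule ι x.1 ((M.instr x.1).get h).1 x.2 (((M.instr x.1).get h).2 (x.2 : ℕ))
        (M.ne_zero _ _ _ _ (Option.some_get h).symm)
    else startRule ι q₀

/-- The affine system of a machine with states restricted to `T`. -/
noncomputable def toAff : AffSystem (Option (Option K)) (Option (Option (T × Fin 5))) where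
  rules := M.toRule ι k₀ q₀ T
  vfin := pt (ι qf) 0 Zf
  v0 := pt (-1) 0 0
  α := some none
  s := some (some k₀)

theorem toAff_step {u v} : (M.toAff ι k₀ q₀ T qf Zf).Step u v ↔
    (∃ a Z, u = pt (-1) a Z ∧ v = pt (-1) (a - 1) (push k₀ Z)) ∨
    (∃ Z, u = pt (-1) 0 Z ∧ v = pt (ι q₀) 0 Z) ∨
    ∃ q ∈ T, ∃ Z c, M.step (q, Z) = some c ∧ u = pt (ι q) 0 Z ∧ v = pt (ι c.1) 0 c.2 := by
  have key : (M.toAff ι k₀ q₀ T qf Zf).Step u v ↔ ∃ o, (M.toRule ι k₀ q₀ T o).Rel u v := Iff.rfl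
  rw [key]
  constructor
  · rintro ⟨_ | _ | ⟨⟨q, hq⟩, r⟩, h⟩
    · exact .inl ((rel_loadRule k₀).1 h)
    · exact .inr (.inl ((rel_startRule ι q₀).1 h))
    · rcases hi : M.instr q with _ | ⟨k, f⟩
      · simp only [toRule, Option.elim, hi, Option.isSome_none, Bool.false_eq_true,
          dite_false] at h
        exact .inr (.inl ((rel_startRule ι q₀).1 h))
      · simp only [toRule, Option.elim, hi, Option.isSome_some, dite_true, Option.get_some] at h
        obtain ⟨Z, hZ, hu, hv⟩ := (rel_stepRule ι (by omega) (by omega) _).1 h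
        refine .inr (.inr ⟨q, hq, Z, _, step_of_instr hi Z, hu, ?_⟩)
        rw [hZ]
        exact hv
  · rintro (h | h | ⟨q, hq, Z, c, hc, hu, hv⟩)
    · exact ⟨none, (rel_loadRule k₀).2 h⟩
    · exact ⟨some none, (rel_startRule ι q₀).2 h⟩
    · rcases hi : M.instr q with _ | ⟨k, f⟩
      · simp [step, hi] at hc
      · rw [step_of_instr hi, Option.some.injEq] at hc
        subst hc
        have hr : ((Z k % 5).toNat : ℤ) = Z k % 5 := Int.toNat_of_nonneg (by omega)
        refine ⟨some (some (⟨q, hq⟩, ⟨(Z k % 5).toNat, by omega⟩)), ?_⟩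
        simp only [toRule, Option.elim, hi, Option.isSome_some, dite_true, Option.get_some, hr]
        exact (rel_stepRule ι (by omega) (by omega) _).2 ⟨Z, rfl, hu, hv⟩

/-- The points from which the final configuration is reached. -/
def Good : Set (Option (Option K) → ℤ) :=
  {u | (∃ q ∈ T, ∃ Z, u = pt (ι q) 0 Z ∧ Reaches M.step (q, Z) (qf, Zf)) ∨
    ∃ Z Z' a, ∃ i j : ℕ, u = pt (-1) a Z ∧ Reaches M.step (q₀, Z') (qf, Zf) ∧ a + j = i ∧
      (push k₀)^[i] Z = (push k₀)^[j] Z'}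

variable {M ι k₀ q₀ T qf Zf}

omit [DecidableEq K] [Fintype K] in
theorem pt_neg_one_ne (hι : ∀ q, 0 ≤ ι q) {q : Q} {a a' : ℤ} {Z Z' : K → ℤ} :
    pt (-1) a Z ≠ pt (ι q) a' Z' := fun h => by
  have := hι q
  have := (pt_inj h).1
  omega

omit [Fintype K] in
theorem pt_neg_one_mem_good (hι : ∀ q, 0 ≤ ι q) {a : ℤ} {Z : K → ℤ} :
    pt (-1) a Z ∈ M.Good ι k₀ q₀ T qf Zf ↔ ∃ Z', ∃ i j : ℕ,
      Reaches M.step (q₀, Z') (qf, Zf) ∧ a + j = i ∧ (push k₀)^[i] Z = (push k₀)^[j] Z' := by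
  constructor
  · rintro (⟨q, _, Z', h, _⟩ | ⟨Z', Z'', a', i, j, h, h1⟩)
    · exact (pt_neg_one_ne hι h).elim
    · obtain ⟨-, rfl, rfl⟩ := pt_inj h
      exact ⟨_, i, j, h1⟩
  · rintro ⟨Z', i, j, h⟩
    exact .inr ⟨_, _, _, i, j, rfl, h⟩

omit [Fintype K] in
theorem pt_mem_good (hι : ∀ q, 0 ≤ ι q) (hinj : Set.InjOn ι T) {q : Q} (hq : q ∈ T) {Z : K → ℤ} :
    pt (ι q) 0 Z ∈ M.Good ι k₀ q₀ T qf Zf ↔ Reaches M.step (q, Z) (qf, Zf) := by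
  constructor
  · rintro (⟨q', hq', Z', h, h1⟩ | ⟨Z', Z'', a', i, j, h, h1⟩)
    · obtain ⟨h2, -, rfl⟩ := pt_inj h
      rwa [hinj hq hq' h2]
    · exact (pt_neg_one_ne hι h.symm).elim
  · exact fun h => .inl ⟨_, hq, _, rfl, h⟩

omit [Fintype K] in
theorem reaches_of_step (hf : M.instr qf = none) {c c'} (h : M.step c = some c') :
    Reaches M.step c (qf, Zf) ↔ Reaches M.step c' (qf, Zf) := by
  constructor
  · intro h1
    rcases h1.cases_head with rfl | ⟨d, h2, h3⟩
    · simp [step, hf] at h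
    · rw [Option.mem_def, h, Option.some.injEq] at h2
      rwa [h2]
  · exact .head h

theorem good_of_step (hι : ∀ q, 0 ≤ ι q) (hinj : Set.InjOn ι T) (hf : M.instr qf = none)
    (h0 : q₀ ∈ T) (hT : ∀ q ∈ T, ∀ Z c, M.step (q, Z) = some c → c.1 ∈ T) {u v}
    (h : (M.toAff ι k₀ q₀ T qf Zf).Step u v) :
    u ∈ M.Good ι k₀ q₀ T qf Zf ↔ v ∈ M.Good ι k₀ q₀ T qf Zf := by
  rcases (M.toAff_step ..).1 h with ⟨a, Z, rfl, rfl⟩ | ⟨Z, rfl, rfl⟩ | ⟨q, hq, Z, c, hc, rfl, rfl⟩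
  · rw [pt_neg_one_mem_good hι, pt_neg_one_mem_good hι]
    constructor
    · rintro ⟨Z', i, j, h1, h2, h3⟩
      refine ⟨Z', i, j + 1, h1, by push_cast; omega, ?_⟩
      rw [← iterate_succ_apply, iterate_succ_apply', iterate_succ_apply', h3]
    · rintro ⟨Z', i, j, h1, h2, h3⟩
      exact ⟨Z', i + 1, j, h1, by push_cast; omega, h3⟩
  · rw [pt_neg_one_mem_good hι, pt_mem_good hι hinj h0]
    constructor
    · rintro ⟨Z', i, j, h1, h2, h3⟩
      obtain rfl : j = i := by omega
      rwa [(push_injective k₀).iterate j h3]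
    · exact fun h => ⟨Z, 0, 0, h, rfl, rfl⟩
  · rw [pt_mem_good hι hinj hq, pt_mem_good hι hinj (hT q hq Z c hc)]
    exact reaches_of_step hf hc

theorem conn_subset_good (hι : ∀ q, 0 ≤ ι q) (hinj : Set.InjOn ι T) (hf : M.instr qf = none)
    (h0 : q₀ ∈ T) (hfT : qf ∈ T) (hT : ∀ q ∈ T, ∀ Z c, M.step (q, Z) = some c → c.1 ∈ T) :
    (M.toAff ι k₀ q₀ T qf Zf).conn ⊆ M.Good ι k₀ q₀ T qf Zf := by
  intro u hu
  have h : ∀ x y, Relation.EqvGen (M.toAff ι k₀ q₀ T qf Zf).Step x y →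
      (x ∈ M.Good ι k₀ q₀ T qf Zf ↔ y ∈ M.Good ι k₀ q₀ T qf Zf) := by
    intro x y hxy
    induction hxy with
    | rel x y h => exact good_of_step hι hinj hf h0 hT h
    | refl x => exact Iff.rfl
    | symm x y _ ih => exact ih.symm
    | trans x y z _ _ ih1 ih2 => exact ih1.trans ih2
  exact (h _ _ hu).1 ((pt_mem_good hι hinj hfT).2 .refl)

theorem mem_conn_of_step {u v} (h : (M.toAff ι k₀ q₀ T qf Zf).Step u v)
    (hv : v ∈ (M.toAff ι k₀ q₀ T qf Zf).conn) : u ∈ (M.toAff ι k₀ q₀ T qf Zf).conn :=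
  Relation.EqvGen.trans _ _ _ hv (.symm _ _ (.rel _ _ h))

theorem mem_conn_of_reaches (hT : ∀ q ∈ T, ∀ Z c, M.step (q, Z) = some c → c.1 ∈ T) {c}
    (hc : c.1 ∈ T) (h : Reaches M.step c (qf, Zf)) :
    pt (ι c.1) 0 c.2 ∈ (M.toAff ι k₀ q₀ T qf Zf).conn := by
  induction h using Relation.ReflTransGen.head_induction_on with
  | refl => exact .refl _
  | head h _ ih =>
    exact mem_conn_of_step ((M.toAff_step ..).2 (.inr (.inr ⟨_, hc, _, _, h, rfl, rfl⟩)))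
      (ih (hT _ hc _ _ h))

theorem pt_neg_one_mem_conn (a : ℕ) (Z : K → ℤ)
    (h : pt (ι q₀) 0 ((push k₀)^[a] Z) ∈ (M.toAff ι k₀ q₀ T qf Zf).conn) :
    pt (-1) a Z ∈ (M.toAff ι k₀ q₀ T qf Zf).conn := by
  induction a generalizing Z with
  | zero => exact mem_conn_of_step ((M.toAff_step ..).2 (.inr (.inl ⟨_, rfl, rfl⟩))) h
  | succ a ih =>
    refine mem_conn_of_step ((M.toAff_step ..).2 (.inl ⟨_, _, rfl, ?_⟩)) (ih (push k₀ Z) h)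
    rw [Nat.cast_succ, add_sub_cancel_right]

theorem toAff_input (E a : ℤ) :
    (M.toAff ι k₀ q₀ T qf Zf).input E a = pt (-1) a (Pi.single k₀ E) := by
  funext o
  rcases o with _ | _ | k
  · simp [AffSystem.input, toAff, pt]
  · simp [AffSystem.input, toAff, pt]
  · by_cases h : k = k₀
    · subst h; simp [AffSystem.input, toAff, pt]
    · simp [AffSystem.input, toAff, pt, h]

omit [Fintype K] in
theorem push_iterate_single (i : ℕ) (E : ℤ) :
    (push k₀)^[i] (Pi.single k₀ E) = Pi.single k₀ ((fun x => 5 * x + 4)^[i] E) := by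
  induction i with
  | zero => rfl
  | succ i ih =>
    rw [iterate_succ_apply', iterate_succ_apply', ih, push, Pi.single_eq_same]
    exact update_idem ..

theorem input_mem_conn (hι : ∀ q, 0 ≤ ι q) (hinj : Set.InjOn ι T) (hf : M.instr qf = none)
    (h0 : q₀ ∈ T) (hfT : qf ∈ T) (hT : ∀ q ∈ T, ∀ Z c, M.step (q, Z) = some c → c.1 ∈ T)
    {E : ℤ} (hE : E % 5 ≠ 4) (a : ℤ) : (M.toAff ι k₀ q₀ T qf Zf).input E a ∈
      (M.toAff ι k₀ q₀ T qf Zf).conn ↔ 0 ≤ a ∧ Reaches M.step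
        (q₀, Pi.single k₀ ((fun x => 5 * x + 4)^[a.toNat] E)) (qf, Zf) := by
  rw [toAff_input, ← push_iterate_single]
  constructor
  · intro h
    obtain ⟨Z', i, j, h1, h2, h3⟩ :=
      (pt_neg_one_mem_good hι).1 (conn_subset_good hι hinj hf h0 hfT hT h)
    rcases le_or_gt 0 a with ha | ha
    · obtain rfl : i = j + a.toNat := by omega
      rw [iterate_add_apply] at h3
      exact ⟨ha, by rwa [(push_injective k₀).iterate j h3]⟩
    · obtain ⟨b, rfl⟩ : ∃ b, j = i + (b + 1) := ⟨j - i - 1, by omega⟩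
      rw [iterate_add_apply] at h3
      have h4 := congrFun ((push_injective k₀).iterate i h3) k₀
      rw [iterate_succ_apply', push, Pi.single_eq_same, update_self] at h4
      omega
  · rintro ⟨ha, h⟩
    rw [← Int.toNat_of_nonneg ha]
    exact pt_neg_one_mem_conn _ _ (mem_conn_of_reaches hT h0 h)

end RegMachine

namespace StackCode

open Turing Turing.PartrecToTM2 Function StateTransition

/-- The digit of a stack symbol. -/
def dig : Γ' → ℤ
  | .consₗ => 1
  | .cons => 2
  | .bit0 => 3
  | .bit1 => 4

/-- The symbol of a residue. -/
def sym (r : ℤ) : Option Γ' :=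
  if r = 1 then some .consₗ else if r = 2 then some .cons else if r = 3 then some .bit0 else
    if r = 4 then some .bit1 else none

/-- The integer coding a stack. -/
def enc : List Γ' → ℤ
  | [] => 0
  | a :: L => 5 * enc L + dig a

theorem dig_bounds (a : Γ') : 0 < dig a ∧ dig a < 5 := by
  cases a <;> simp [dig]

theorem sym_dig (a : Γ') : sym (dig a) = some a := by
  cases a <;> simp [dig, sym]

theorem sym_enc (L : List Γ') : sym (enc L % 5) = L.head? := by
  cases L with
  | nil => simp [enc, sym]
  | cons a L =>
    have := dig_bounds a
    rw [enc, show (5 * enc L + dig a) % 5 = dig a by omega, sym_dig, List.head?_cons]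

theorem enc_tail (L : List Γ') :
    (if enc L % 5 = 0 then (5 : ℤ) else 1) * (enc L / 5) + 0 = enc L.tail := by
  cases L with
  | nil => simp [enc]
  | cons a L =>
    have := dig_bounds a
    rw [enc, if_neg (by omega), List.tail_cons]
    omega

variable {K Λ σ : Type} [DecidableEq K] [Inhabited K]

/-- The instructions of the register machine simulating the given program. -/
def stmtInstr (M : Λ → TM2.Stmt (fun _ : K => Γ') Λ σ) (v : σ) :
    TM2.Stmt (fun _ : K => Γ') Λ σ →
      K × (ℤ → (Option (TM2.Stmt (fun _ : K => Γ') Λ σ) × σ) × ℤ × ℤ)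
  | .push k f q => (k, fun r => ((some q, v), 25, 5 * r + dig (f v)))
  | .peek k f q => (k, fun r => ((some q, f v (sym r)), 5, r))
  | .pop k f q => (k, fun r => ((some q, f v (sym r)), if r = 0 then 5 else 1, 0))
  | .load a q => (default, fun r => ((some q, a v), 5, r))
  | .branch f q₁ q₂ => (default, fun r => ((some (cond (f v) q₁ q₂), v), 5, r))
  | .goto f => (default, fun r => ((some (M (f v)), v), 5, r))
  | .halt => (default, fun r => ((none, v), 5, r))

/-- The register machine simulating the given program. -/
def machine (M : Λ → TM2.Stmt (fun _ : K => Γ') Λ σ) :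
    RegMachine (Option (TM2.Stmt (fun _ : K => Γ') Λ σ) × σ) K where
  instr q := q.1.map (stmtInstr M q.2)
  ne_zero := by
    rintro ⟨_ | s, v⟩ k f r h
    · simp at h
    · simp only [Option.map_some, Option.some.injEq] at h
      cases s <;> (simp only [stmtInstr, Prod.mk.injEq] at h; obtain ⟨-, rfl⟩ := h) <;>
        simp only [ne_eq, OfNat.ofNat_ne_zero, not_false_eq_true]
      split_ifs <;> simp

variable {M : Λ → TM2.Stmt (fun _ : K => Γ') Λ σ}

theorem step_machine (s : TM2.Stmt (fun _ : K => Γ') Λ σ) (v : σ) (Z : K → ℤ) :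
    (machine M).step ((some s, v), Z) =
      some (((stmtInstr M v s).2 (Z (stmtInstr M v s).1 % 5)).1,
        RegMachine.act (stmtInstr M v s).1 ((stmtInstr M v s).2 (Z (stmtInstr M v s).1 % 5)) Z) :=
  rfl

/-- The configuration of the register machine coding a configuration. -/
def code (M : Λ → TM2.Stmt (fun _ : K => Γ') Λ σ) (c : TM2.Cfg (fun _ : K => Γ') Λ σ) :
    (Option (TM2.Stmt (fun _ : K => Γ') Λ σ) × σ) × (K → ℤ) :=
  ((c.l.map M, c.var), fun k => enc (c.stk k))

omit [Inhabited K] in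
theorem act_id {Q : Type} (k : K) (q : Q) (Z : K → ℤ) {r : ℤ} (hr : r = Z k % 5) :
    RegMachine.act k (q, 5, r) Z = Z := by
  rw [hr, RegMachine.act, show 5 * (Z k / 5) + Z k % 5 = Z k by omega, update_eq_self]

omit [Inhabited K] in
theorem update_enc (S : K → List Γ') (k : K) (L : List Γ') :
    update (fun k => enc (S k)) k (enc L) = fun j => enc (update S k L j) := by
  funext j
  by_cases h : j = k
  · subst h; simp
  · simp [h]

theorem reaches_stepAux (s : TM2.Stmt (fun _ : K => Γ') Λ σ) (v : σ) (S : K → List Γ') :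
    Reaches₁ (machine M).step ((some s, v), fun k => enc (S k)) (code M (TM2.stepAux s v S)) := by
  induction s generalizing v S with
  | push k f q ih =>
    refine .head ?_ (ih v (update S k (f v :: S k)))
    rw [Option.mem_def, step_machine, ← update_enc]
    simp only [stmtInstr, RegMachine.act, enc]
    rw [show 25 * (enc (S k) / 5) + (5 * (enc (S k) % 5) + dig (f v)) = 5 * enc (S k) + dig (f v)
      by omega]
  | peek k f q ih =>
    refine .head ?_ (ih (f v (S k).head?) S)
    rw [Option.mem_def, step_machine]
    simp only [stmtInstr, sym_enc]
    exact congrArg some (Prod.ext rfl (act_id _ _ (fun k => enc (S k)) rfl))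
  | pop k f q ih =>
    refine .head ?_ (ih (f v (S k).head?) (update S k (S k).tail))
    rw [Option.mem_def, step_machine, ← update_enc]
    simp only [stmtInstr, RegMachine.act, sym_enc, enc_tail]
  | load a q ih =>
    refine .head ?_ (ih (a v) S)
    rw [Option.mem_def, step_machine]
    simp only [stmtInstr]
    exact congrArg some (Prod.ext rfl (act_id _ _ (fun k => enc (S k)) rfl))
  | branch f q₁ q₂ ih₁ ih₂ =>
    rw [TM2.stepAux]
    refine .head (b := ((some (cond (f v) q₁ q₂), v), fun k => enc (S k))) ?_ ?_
    · rw [Option.mem_def, step_machine]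
      simp only [stmtInstr]
      exact congrArg some (Prod.ext rfl (act_id _ _ (fun k => enc (S k)) rfl))
    · cases f v
      · exact ih₂ v S
      · exact ih₁ v S
  | goto f =>
    refine .single ?_
    rw [Option.mem_def, step_machine]
    simp only [stmtInstr]
    exact congrArg some (Prod.ext rfl (act_id _ _ (fun k => enc (S k)) rfl))
  | halt =>
    refine .single ?_
    rw [Option.mem_def, step_machine]
    simp only [stmtInstr]
    exact congrArg some (Prod.ext rfl (act_id _ _ (fun k => enc (S k)) rfl))

theorem eval_machine (c : TM2.Cfg (fun _ : K => Γ') Λ σ) :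
    eval (machine M).step (code M c) = code M <$> eval (TM2.step M) c := by
  refine tr_eval' _ _ (code M) (fun_respects.2 ?_) c
  rintro ⟨_ | l, v, S⟩
  · rfl
  · exact reaches_stepAux (M l) v S

/-- The states of the machine which can occur. -/
def states (M : Λ → TM2.Stmt (fun _ : K => Γ') Λ σ) (T : Finset Λ) :
    Set (Option (TM2.Stmt (fun _ : K => Γ') Λ σ) × σ) := {q | q.1 ∈ TM2.stmts M T}

omit [DecidableEq K] [Inhabited K] in
theorem finite_states [Finite σ] (T : Finset Λ) : (states M T).Finite := by
  have : states M T = (TM2.stmts M T : Set _) ×ˢ Set.univ := by ext; simp [states]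
  rw [this]
  exact (Finset.finite_toSet _).prod Set.finite_univ

omit [DecidableEq K] [Inhabited K] in
theorem some_mem_stmts {T : Finset Λ} {l : Λ} (h : l ∈ T) : some (M l) ∈ TM2.stmts M T := by
  classical
  simp only [TM2.stmts, Finset.mem_insertNone, Finset.mem_biUnion, Option.mem_def,
    Option.some.injEq, forall_eq']
  exact ⟨l, h, TM2.stmts₁_self⟩

theorem step_mem_states [Inhabited Λ] {T : Finset Λ} (hT : TM2.Supports M T) :
    ∀ q ∈ states M T, ∀ Z c, (machine M).step (q, Z) = some c → c.1 ∈ states M T := by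
  classical
  rintro ⟨_ | s, v⟩ hs Z c h
  · simp [RegMachine.step, machine] at h
  · rw [step_machine, Option.some.injEq] at h
    subst h
    have key : ∀ q, q ∈ TM2.stmts₁ s → some q ∈ TM2.stmts M T := fun q hq =>
      TM2.stmts_trans hq hs
    have hsup := TM2.stmts_supportsStmt hT hs
    cases s with
    | goto f => exact some_mem_stmts (hsup v)
    | halt => exact Finset.none_mem_insertNone
    | branch f q₁ q₂ =>
      refine key _ ?_
      rw [TM2.stmts₁]
      cases f v <;> simp [TM2.stmts₁_self]
    | _ =>
      refine key _ ?_
      rw [TM2.stmts₁]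
      exact Finset.mem_insert_of_mem TM2.stmts₁_self

end StackCode

section Unary

/-- The number with binary expansion `1 ⋯ 1`. -/
def ones (k : ℕ) : ℕ := (fun x => 2 * x + 1)^[k] 0

theorem ones_succ (k : ℕ) : ones (k + 1) = 2 * ones k + 1 :=
  Function.iterate_succ_apply' _ _ _

theorem le_ones (k : ℕ) : k ≤ ones k := by
  induction k with
  | zero => exact Nat.zero_le _
  | succ k ih => rw [ones_succ]; omega

theorem ones_injective : Function.Injective ones :=
  (strictMono_nat_of_lt_succ fun k => by rw [ones_succ]; omega).injective

theorem primrec_ones : Primrec ones :=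
  Primrec.nat_iterate .id (.const 0)
    (Primrec.succ.comp (Primrec.nat_mul.comp (.const 2) .snd)).to₂

/-- A left inverse of `ones`. -/
def size (x : ℕ) : ℕ := Nat.findGreatest (fun k => ones k = x) x

theorem size_ones (k : ℕ) : size (ones k) = k :=
  ones_injective (Nat.findGreatest_spec (P := fun j => ones j = ones k) (le_ones k) rfl)

theorem primrec_size : Primrec size :=
  Primrec.nat_findGreatest .id (Primrec.eq.comp (primrec_ones.comp .snd) .fst)

end Unary

namespace StackCode

open Turing Turing.PartrecToTM2 Function StateTransition

theorem trNat_ones (k : ℕ) : trNat (ones k) = List.replicate k .bit1 := by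
  have h (m : Num) : trNum m.bit1 = .bit1 :: trNum m := by
    cases m <;> rfl
  induction k with
  | zero => exact trNat_zero
  | succ k ih =>
    rw [List.replicate_succ, ← ih, trNat, trNat, ← h, ones_succ]
    congr 1
    push_cast
    rw [two_mul, Num.bit1_of_bit1]

theorem enc_replicate (k : ℕ) (L : List Γ') :
    enc (List.replicate k .bit1 ++ L) = (fun x => 5 * x + 4)^[k] (enc L) := by
  induction k with
  | zero => rfl
  | succ k ih =>
    rw [iterate_succ_apply', ← ih]
    rfl

theorem enc_elim (L : List Γ') :
    (fun k => enc (K'.elim L [] [] [] k)) = Pi.single K'.main (enc L) := by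
  funext k
  cases k <;> simp only [K'.elim, enc] <;> simp

/-- The integer coding a stack with contents determined by `N`. -/
def param (N : ℕ) : ℕ := 5 * (fun x => 5 * x + 4)^[N] 2 + 2

theorem primrec_param : Primrec param :=
  Primrec.nat_add.comp (Primrec.nat_mul.comp (.const 5)
    (Primrec.nat_iterate .id (.const 2) (Primrec.nat_add.comp
      (Primrec.nat_mul.comp (.const 5) .snd) (.const 4)).to₂)) (.const 2)

theorem enc_trList (a N : ℕ) :
    enc (trList [ones a, ones N]) = (fun x => 5 * x + 4)^[a] (param N : ℤ) := by
  have h (x : ℕ) : (((fun x => 5 * x + 4)^[N] x : ℕ) : ℤ) = (fun x => 5 * x + 4)^[N] (x : ℤ) :=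
    (Semiconj.iterate_right (f := ((↑) : ℕ → ℤ)) (fun x => by push_cast; rfl) N) x
  rw [trList, trNat_ones, enc_replicate, enc, trList, trNat_ones, enc_replicate, param]
  push_cast
  rw [h]
  rfl

instance : Fintype K' := ⟨{.main, .rev, .aux, .stack}, by rintro ⟨⟩ <;> simp⟩

theorem mem_map_assert {α β : Type} (f : List ℕ → α) (g : α → β) (p : Prop) :
    g (f [0]) ∈ g <$> f <$> (pure : ℕ → List ℕ) <$>
      (Part.assert p fun _ => Part.some ()).map (fun _ => 0) ↔ p := by
  by_cases h : p
  · simp [h, Part.assert_pos, pure]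
  · simp [h, Part.assert_neg]

theorem exists_affSystem {P : ℕ → ℕ → Prop} (hP : REPred fun p : ℕ × ℕ => P p.1 p.2) :
    ∃ (κ R : Type) (_ : Fintype κ) (_ : DecidableEq κ) (_ : Finite R) (S : AffSystem κ R)
      (E : ℕ → ℕ), Computable E ∧
        ∀ (N : ℕ) (a : ℤ), S.input (E N) a ∈ S.conn ↔ 0 ≤ a ∧ P a.toNat N := by
  have hf : Partrec fun v : List.Vector ℕ 2 =>
      (Part.assert (P (size v.head) (size v.tail.head)) fun _ => Part.some ()).map fun _ => 0 :=
    (hP.comp ((primrec_size.comp .vector_head).pair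
      (primrec_size.comp (Primrec.vector_head.comp .vector_tail))).to_comp).map
      (Computable.const 0).to₂
  obtain ⟨c, hc⟩ := ToPartrec.Code.exists_code (Nat.Partrec'.of_part hf)
  let _ : Inhabited Λ' := ⟨trNormal c .halt⟩
  have hsup : TM2.Supports tr (codeSupp c .halt) := tr_supports c .halt
  obtain ⟨ι, hι⟩ := Set.countable_iff_exists_injOn.1
    (finite_states (M := tr) (codeSupp c .halt)).countable
  set T := states tr (codeSupp c .halt)
  refine ⟨_, _, inferInstance, inferInstance, ?_, (machine tr).toAff (fun q => ι q) K'.main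
    (some (tr (trNormal c .halt)), none) T (none, none) (code tr (halt [0])).2, param,
    primrec_param.to_comp, fun N a => ?_⟩
  · have : Finite T := finite_states (M := tr) (codeSupp c .halt)
    infer_instance
  rw [RegMachine.input_mem_conn (fun q => Int.natCast_nonneg _)
    (fun q hq q' hq' h => hι hq hq' (Int.ofNat_inj.1 h)) rfl (some_mem_stmts hsup.1)
    Finset.none_mem_insertNone (step_mem_states hsup) (by rw [param]; push_cast; omega)]
  refine and_congr_right fun _ => ?_
  have hv := hc (ones a.toNat ::ᵥ ones N ::ᵥ .nil)
  have he : code tr (init c [ones a.toNat, ones N]) =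
      ((some (tr (trNormal c .halt)), none),
        Pi.single K'.main ((fun x => 5 * x + 4)^[a.toNat] (param N : ℤ))) := by
    rw [← enc_trList, ← enc_elim]
    rfl
  have h1 := eval_machine (M := tr) (init c [ones a.toNat, ones N])
  rw [PartrecToTM2.tr_eval, he] at h1
  have h2 : code tr (halt [0]) = ((none, none), (code tr (halt [0])).2) := rfl
  rw [← h2]
  have h3 : (machine tr).step (code tr (halt [0])) = none := rfl
  rw [← and_iff_left (a := Reaches _ _ _) h3, ← mem_eval]
  refine (iff_of_eq (congrArg (_ ∈ ·) (h1.trans (congrArg (fun p => _ <$> _ <$> p) hv)))).trans ?_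
  refine (mem_map_assert (halt : List ℕ → _) _ _).trans ?_
  change P (size (ones _)) (size (ones _)) ↔ _
  rw [size_ones, size_ones]

end StackCode

/-- Lemma 6.13 (Chiodo): there is a uniform procedure that, on input `n`, constructs a
finite presentation `Q_n` whose presented group has `TorOrd` equal to
`{p_j | j ∉ W_n}`, where `p_j` is the `j`-th prime. In particular, if `W_n` is
non-recursive then `TorOrd` of the presented group of `Q_n` is not recursively
enumerable. -/
theorem uniform_presentation_with_prescribed_torsion :
    ∃ F : ℕ → ℕ, Computable F ∧
      (∀ n : ℕ, ∃ Q : FinPres, F n = Encodable.encode Q ∧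
        TorOrd Q.Grp = {p | ∃ j, j ∉ W n ∧ p = Nat.nth Nat.Prime j}) ∧
      (∀ n : ℕ, ∀ Q : FinPres, F n = Encodable.encode Q →
        ¬ ComputablePred (· ∈ W n) →
        ¬ ∃ g : ℕ →. ℕ, Nat.Partrec g ∧ ∀ x : ℕ, (g x).Dom ↔ x ∈ TorOrd Q.Grp) := by
  obtain ⟨κ, R, _, _, _, S, E, hE, hS⟩ := StackCode.exists_affSystem rePred_passes
  refine ⟨_, S.computable_encode_pres hE, fun n => ⟨_, rfl, S.torOrd_pres (hS n)⟩, ?_⟩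
  intro n Q hQ
  rw [← Encodable.encode_injective hQ]
  exact not_partrec_of_not_computablePred (S.torOrd_pres (hS n))
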